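/- arXiv:2307.07962 — 4 statements merged into one kernel-verified Lean document; each statement's English description precedes it below -/
import Mathlib

section
/- Let k ≥ 2, and let n, t be integers with 1 ≤ t ≤ 2k−2 and n ≥ 318t²k. Let G be a C_{2k+1}-free graph on n vertices with e(G) ≥ ⌊(n−t−1)²/4⌋ + (t+2 choose 2), and let B' ⊆ V(G) with |B'| ≤ t. If G − B' is not bipartite, then every shortest odd cycle of G − B' has length at most 2k−1. -/
/-- A graph `G` is `Cₘ`-free if it contains no subgraph isomorphic to the cycle of length `m`. -/
def CycleFree {V : Type*} (G : SimpleGraph V) (m : ℕ) : Prop :=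
  ∀ f : SimpleGraph.cycleGraph m →g G, ¬ Function.Injective f

section Auxiliary

open Finset

section PathsAndCycles

variable {V : Type*} {G : SimpleGraph V} {S T : Set V} {L M : ℕ} {a b c d u : V}

/-- There is a path of length `L` from `a` to `b` all of whose vertices lie in `S`. -/
def PathIn (G : SimpleGraph V) (S : Set V) (L : ℕ) (a b : V) : Prop :=
  ∃ p : G.Walk a b, p.IsPath ∧ p.length = L ∧ ∀ w ∈ p.support, w ∈ S

/-- There is a cycle of length `m` all of whose vertices lie in `S`. -/
def CycleIn (G : SimpleGraph V) (S : Set V) (m : ℕ) : Prop :=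
  ∃ (u : V) (p : G.Walk u u), p.IsCycle ∧ p.length = m ∧ ∀ w ∈ p.support, w ∈ S

lemma PathIn.refl (ha : a ∈ S) : PathIn G S 0 a a :=
  ⟨.nil, by simp, by simp, by simpa using ha⟩

lemma PathIn.symm (h : PathIn G S L a b) : PathIn G S L b a := by
  obtain ⟨p, hp, hl, hs⟩ := h
  exact ⟨p.reverse, hp.reverse, by simpa using hl, by simpa using hs⟩

lemma PathIn.mono (h : PathIn G S L a b) (hST : S ⊆ T) : PathIn G T L a b := by
  obtain ⟨p, hp, hl, hs⟩ := h
  exact ⟨p, hp, hl, fun w hw => hST (hs w hw)⟩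

lemma CycleIn.mono (h : CycleIn G S L) (hST : S ⊆ T) : CycleIn G T L := by
  obtain ⟨u, p, hp, hl, hs⟩ := h
  exact ⟨u, p, hp, hl, fun w hw => hST (hs w hw)⟩

lemma PathIn.append (h₁ : PathIn G S L a b) (hbc : G.Adj b c) (h₂ : PathIn G T M c d)
    (hST : Disjoint S T) : PathIn G (S ∪ T) (L + M + 1) a d := by
  obtain ⟨p, hp, hpl, hps⟩ := h₁
  obtain ⟨q, hq, hql, hqs⟩ := h₂
  have hsupp : (p.append (.cons hbc q)).support = p.support ++ q.support := by
    simp [SimpleGraph.Walk.support_append]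
  refine ⟨p.append (.cons hbc q), ?_, ?_, ?_⟩
  · rw [SimpleGraph.Walk.isPath_def, hsupp, List.nodup_append']
    refine ⟨hp.support_nodup, hq.support_nodup, fun w hw hw' => ?_⟩
    exact Set.disjoint_left.1 hST (hps w hw) (hqs w hw')
  · simp [hpl, hql]; omega
  · intro w hw
    rw [hsupp, List.mem_append] at hw
    exact hw.imp (hps w) (hqs w)

lemma PathIn.cons (hab : G.Adj a b) (h : PathIn G T L b c) (ha : a ∉ T) :
    PathIn G (insert a T) (L + 1) a c := by
  have := (PathIn.refl (G := G) (Set.mem_singleton a)).append hab h (by simpa using ha)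
  rw [Nat.zero_add] at this
  exact this.mono (Set.insert_eq a T).ge

lemma PathIn.close (h : PathIn G S L a b) (hL : 1 ≤ L) (hu : u ∉ S) (hua : G.Adj u a)
    (hub : G.Adj u b) : CycleIn G (insert u S) (L + 2) := by
  obtain ⟨p, hp, hl, hs⟩ := h
  have hup : u ∉ p.support := fun h => hu (hs u h)
  have hab : b ≠ a := by
    rintro rfl
    have := SimpleGraph.Walk.length_eq_zero_iff.2 (SimpleGraph.Walk.isPath_iff_nil.1 hp)
    omega
  have hpath := hp.concat hup hub.symm
  refine ⟨u, .cons hua (p.concat hub.symm), ?_, by simp [hl], ?_⟩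
  · rw [SimpleGraph.Walk.cons_isCycle_iff]
    refine ⟨hpath, ?_⟩
    rw [SimpleGraph.Walk.edges_concat]
    simp only [List.concat_eq_append, List.mem_append, List.mem_singleton, not_or]
    refine ⟨fun h => hup (p.fst_mem_support_of_mem_edges h), fun h => ?_⟩
    rw [Sym2.eq_swap, Sym2.eq_iff] at h
    rcases h with ⟨h, -⟩ | ⟨-, h⟩
    · exact hab h.symm
    · exact hub.ne h
  · intro w hw
    simp only [SimpleGraph.Walk.support_cons, SimpleGraph.Walk.support_concat,
      List.mem_cons, List.mem_append, List.not_mem_nil, or_false] at hw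
    rcases hw with rfl | hw | rfl
    · simp
    · exact Or.inr (hs w hw)
    · simp

lemma CycleFree.not_cycleIn {m : ℕ} (h : CycleFree G m) (hm : 2 < m) : ¬ CycleIn G S m := by
  rintro ⟨u, p, hp, hl, -⟩
  obtain ⟨f⟩ := (SimpleGraph.cycleGraph_isContained_iff hm).2 ⟨u, p, hp, hl⟩
  exact h f.toHom f.injective

end PathsAndCycles

section ShortestOddCycle

variable {V : Type*} {G : SimpleGraph V} {x : ℕ → V} {l : ℕ} {S B : Set V} {u v : V}

/-- `x` runs periodically through the vertices of a cycle of length `l` of `G`. -/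
structure IsCyclicSeq (G : SimpleGraph V) (x : ℕ → V) (l : ℕ) : Prop where
  adj : ∀ i, G.Adj (x i) (x (i + 1))
  eq_iff : ∀ i j, x i = x j ↔ i ≡ j [MOD l]

lemma IsCyclicSeq.pathIn (hx : IsCyclicSeq G x l) (i : ℕ) {d : ℕ} (hd : d < l) :
    PathIn G {w | ∃ e ≤ d, w = x (i + e)} d (x i) (x (i + d)) := by
  induction d with
  | zero => exact PathIn.refl ⟨0, le_rfl, rfl⟩
  | succ d ih =>
    have h := (ih (by omega)).symm
    refine ((PathIn.cons (hx.adj (i + d)).symm h ?_).symm).mono ?_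
    · rintro ⟨e, he, heq⟩
      have h := (hx.eq_iff _ _).1 heq
      rw [add_assoc] at h
      have := Nat.ModEq.add_left_cancel' i h
      rw [Nat.ModEq, Nat.mod_eq_of_lt hd, Nat.mod_eq_of_lt (by omega)] at this
      omega
    · rintro w (rfl | ⟨e, he, rfl⟩)
      · exact ⟨d + 1, le_rfl, rfl⟩
      · exact ⟨e, by omega, rfl⟩

lemma IsCyclicSeq.add_period (hx : IsCyclicSeq G x l) (i : ℕ) : x (i + l) = x i :=
  (hx.eq_iff _ _).2 (by simp [Nat.ModEq])

lemma IsCyclicSeq.exists_eq_add (hx : IsCyclicSeq G x l) (hl : 0 < l) (i j : ℕ) :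
    ∃ d < l, x j = x (i + d) := by
  refine ⟨(j + (l - i % l)) % l, Nat.mod_lt _ hl, (hx.eq_iff _ _).2 ?_⟩
  have h1 : i % l < l := Nat.mod_lt _ hl
  have h2 : i + (j + (l - i % l)) ≡ j [MOD l] := by
    have : i + (j + (l - i % l)) = j + (i / l + 1) * l := by
      have := Nat.div_add_mod i l
      nlinarith [Nat.sub_add_cancel h1.le]
    rw [this]; simp [Nat.ModEq]
  exact h2.symm.trans ((Nat.mod_modEq _ _).symm.add_left i)

/-- Two neighbours on a shortest odd cycle of a vertex off the arcs considered are at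
distance two along the cycle. -/
lemma IsCyclicSeq.dist_eq_two (hx : IsCyclicSeq G x l) (hl : Odd l)
    (hxB : ∀ i, x i ∉ B) (hmin : ∀ m, Odd m → CycleIn G Bᶜ m → l ≤ m)
    (huB : u ∉ B) (hu : ∀ i, u ≠ x i) {i d : ℕ} (hd : 0 < d) (hdl : d < l)
    (h1 : G.Adj u (x i)) (h2 : G.Adj u (x (i + d))) : d = 2 ∨ d + 2 = l := by
  have key : ∀ i d, 0 < d → d < l → G.Adj u (x i) → G.Adj u (x (i + d)) → Odd d → l ≤ d + 2 := by
    intro i d hd hdl h1 h2 ho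
    refine hmin (d + 2) (by grind) (((hx.pathIn i hdl).close hd ?_ h1 h2).mono ?_)
    · rintro ⟨e, -, he⟩; exact hu _ he
    · rintro w (rfl | ⟨e, -, rfl⟩)
      exacts [huB, hxB _]
  rcases Nat.even_or_odd d with he | ho
  · have := key (i + d) (l - d) (by omega) (by omega) h2
      (by rw [add_assoc, Nat.add_sub_cancel' hdl.le, hx.add_period]; exact h1) (by grind)
    left; have := he.two_dvd; omega
  · have := key i d hd hdl h1 h2 ho
    grind

lemma IsCyclicSeq.chord (hx : IsCyclicSeq G x l) (hl : Odd l)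
    (hxB : ∀ i, x i ∉ B) (hmin : ∀ m, Odd m → CycleIn G Bᶜ m → l ≤ m)
    {i d : ℕ} (hd : 0 < d) (hdl : d < l) (h : G.Adj (x i) (x (i + d))) : d = 1 ∨ d + 1 = l := by
  have key : ∀ i d, 1 < d → d < l → G.Adj (x i) (x (i + d)) → Even d → l ≤ d + 1 := by
    intro i d hd hdl h ho
    obtain ⟨d, rfl⟩ : ∃ d', d = d' + 1 := ⟨d - 1, by omega⟩
    refine hmin (d + 2) (by grind) (((hx.pathIn i (d := d) (by omega)).close (u := x (i + (d + 1)))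
      (by omega) ?_ h.symm (hx.adj (i + d)).symm).mono ?_)
    · rintro ⟨e, he, heq⟩
      have := Nat.ModEq.add_left_cancel' i ((hx.eq_iff _ _).1 heq)
      rw [Nat.ModEq, Nat.mod_eq_of_lt hdl, Nat.mod_eq_of_lt (by omega)] at this
      omega
    · rintro w (rfl | ⟨e, -, rfl⟩) <;> exact hxB _
  rcases Nat.even_or_odd d with he | ho
  · have := key i d (by grind) hdl h he
    omega
  · by_contra hcon
    have := key (i + d) (l - d) (by grind) (by omega)
      (by rw [add_assoc, Nat.add_sub_cancel' hdl.le, hx.add_period]; exact h.symm) (by grind)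
    omega

end ShortestOddCycle

section CyclicSequences

variable {V : Type*} {G : SimpleGraph V} {x : ℕ → V} {l : ℕ} {B : Set V}

/-- A cycle yields a periodic enumeration of its vertices. -/
lemma SimpleGraph.Walk.IsCycle.exists_isCyclicSeq {v : V} {c : G.Walk v v} (hc : c.IsCycle) :
    ∃ x : ℕ → V, IsCyclicSeq G x c.length ∧ ∀ i, x i ∈ c.support := by
  have hpos : 0 < c.length := by have := hc.three_le_length; omega
  refine ⟨fun i => c.getVert (i % c.length), ⟨fun i => ?_, fun i j => ⟨fun h => ?_, fun h => ?_⟩⟩,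
    fun i => c.getVert_mem_support _⟩
  · have hlt := Nat.mod_lt i hpos
    have hadj := c.adj_getVert_succ hlt
    rcases Nat.lt_or_ge (i % c.length + 1) c.length with h | h
    · have : (i + 1) % c.length = i % c.length + 1 := by
        rw [Nat.add_mod, Nat.mod_eq_of_lt (a := 1) (by omega), Nat.mod_eq_of_lt h]
      simpa [this] using hadj
    · have h' : i % c.length + 1 = c.length := by omega
      have : (i + 1) % c.length = 0 := by
        rw [Nat.add_mod, Nat.mod_eq_of_lt (a := 1) (by have := hc.three_le_length; omega), h',
          Nat.mod_self]
      rw [h'] at hadj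
      simpa [this] using hadj
  · exact hc.getVert_injOn' (by have := Nat.mod_lt i hpos; simp; omega)
      (by have := Nat.mod_lt j hpos; simp; omega) h
  · exact congrArg c.getVert h

lemma IsCyclicSeq.map {W : Type*} {H : SimpleGraph W} {y : ℕ → W} (hy : IsCyclicSeq H y l)
    (f : H ↪g G) : IsCyclicSeq G (fun i => f (y i)) l where
  adj i := f.map_adj_iff.2 (hy.adj i)
  eq_iff i j := by rw [f.injective.eq_iff]; exact hy.eq_iff i j

/-- A cycle avoiding a set lives in the graph induced on the complement. -/
lemma CycleIn.exists_induce {S : Set V} {m : ℕ} (h : CycleIn G S m) :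
    ∃ (u : S) (d : (G.induce S).Walk u u), d.IsCycle ∧ d.length = m := by
  obtain ⟨u, p, hp, hl, hs⟩ := h
  refine ⟨⟨u, hs u p.start_mem_support⟩, p.induce S hs, ?_, ?_⟩
  · refine (SimpleGraph.Walk.isCycle_map_iff_of_injective
      (f := (SimpleGraph.Embedding.induce (G := G) S).toHom) Subtype.val_injective).1 ?_
    have h := SimpleGraph.Walk.map_induce p hs
    exact h.symm ▸ hp
  · have h := congrArg SimpleGraph.Walk.length (SimpleGraph.Walk.map_induce p hs)
    rw [SimpleGraph.Walk.length_map] at h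
    exact h.trans hl

variable [DecidableEq V]

/-- The vertex set of a cyclic sequence. -/
def cyclicSupport (x : ℕ → V) (l : ℕ) : Finset V := (range l).image x

lemma IsCyclicSeq.mem_cyclicSupport (hx : IsCyclicSeq G x l) (hl : 0 < l) {v : V} :
    v ∈ cyclicSupport x l ↔ ∃ i, v = x i := by
  simp only [cyclicSupport, mem_image, mem_range]
  constructor
  · rintro ⟨i, -, rfl⟩; exact ⟨i, rfl⟩
  · rintro ⟨i, rfl⟩
    exact ⟨i % l, Nat.mod_lt _ hl, (hx.eq_iff _ _).2 (Nat.mod_modEq _ _)⟩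

lemma IsCyclicSeq.card_cyclicSupport (hx : IsCyclicSeq G x l) : #(cyclicSupport x l) = l := by
  rw [cyclicSupport, card_image_of_injOn, card_range]
  intro i hi j hj h
  have := (hx.eq_iff i j).1 h
  simp only [coe_range, Set.mem_Iio] at hi hj
  rwa [Nat.ModEq, Nat.mod_eq_of_lt hi, Nat.mod_eq_of_lt hj] at this

variable [DecidableRel G.Adj]

/-- Every vertex of `G - B` has at most two neighbours on a shortest odd cycle. -/
lemma IsCyclicSeq.card_neighbors_le_two (hx : IsCyclicSeq G x l) (hl : Odd l) (hl7 : 7 ≤ l)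
    (hxB : ∀ i, x i ∉ B) (hmin : ∀ m, Odd m → CycleIn G Bᶜ m → l ≤ m) {u : V} (huB : u ∉ B) :
    #{w ∈ cyclicSupport x l | G.Adj u w} ≤ 2 := by
  have hpos : 0 < l := by omega
  by_cases huC : ∃ i, u = x i
  · obtain ⟨i, rfl⟩ := huC
    refine (card_le_card (t := {x (i + 1), x (i + (l - 1))}) fun w hw => ?_).trans card_le_two
    rw [mem_filter, hx.mem_cyclicSupport hpos] at hw
    obtain ⟨⟨j, rfl⟩, hadj⟩ := hw
    obtain ⟨d, hd, he⟩ := hx.exists_eq_add hpos i j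
    rw [he] at hadj ⊢
    rcases Nat.eq_zero_or_pos d with rfl | hd0
    · simp at hadj
    rcases hx.chord hl hxB hmin hd0 hd hadj with rfl | h
    · simp
    · obtain rfl : d = l - 1 := by omega
      simp
  · push Not at huC
    by_contra! hcon
    obtain ⟨a, ha⟩ := card_pos.1 (by omega : 0 < #{w ∈ cyclicSupport x l | G.Adj u w})
    rw [mem_filter, hx.mem_cyclicSupport hpos] at ha
    obtain ⟨⟨i, rfl⟩, hai⟩ := ha
    have hsub : ({w ∈ cyclicSupport x l | G.Adj u w}.erase (x i)) ⊆
        {x (i + 2), x (i + (l - 2))} := by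
      intro w hw
      rw [mem_erase, mem_filter, hx.mem_cyclicSupport hpos] at hw
      obtain ⟨hne, ⟨j, rfl⟩, hadj⟩ := hw
      obtain ⟨d, hd, he⟩ := hx.exists_eq_add hpos i j
      rw [he] at hadj hne ⊢
      rcases Nat.eq_zero_or_pos d with rfl | hd0
      · simp at hne
      rcases hx.dist_eq_two hl hxB hmin huB huC hd0 hd hai hadj with rfl | h
      · simp
      · obtain rfl : d = l - 2 := by omega
        simp
    have hcard : #({w ∈ cyclicSupport x l | G.Adj u w}.erase (x i)) =
        #{w ∈ cyclicSupport x l | G.Adj u w} - 1 :=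
      card_erase_of_mem (by
        rw [mem_filter, hx.mem_cyclicSupport hpos]; exact ⟨⟨i, rfl⟩, hai⟩)
    have heq := eq_of_subset_of_card_le hsub (card_le_two.trans (by omega))
    have m1 : x (i + 2) ∈ ({w ∈ cyclicSupport x l | G.Adj u w}.erase (x i)) := by simp [heq]
    have m2 : x (i + (l - 2)) ∈ ({w ∈ cyclicSupport x l | G.Adj u w}.erase (x i)) := by simp [heq]
    have a1 := (mem_filter.1 (mem_of_mem_erase m1)).2
    have a2 := (mem_filter.1 (mem_of_mem_erase m2)).2
    have h4 := hx.dist_eq_two hl hxB hmin huB huC (i := i + 2) (d := l - 4) (by omega) (by omega)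
      a1 (by rwa [show i + 2 + (l - 4) = i + (l - 2) by omega])
    omega

/-- A vertex of `G - B` off a shortest odd cycle with two neighbours on it
sees both ends of a subpath of length two. -/
lemma IsCyclicSeq.exists_adj_adj_add_two (hx : IsCyclicSeq G x l) (hl : Odd l) (hl7 : 7 ≤ l)
    (hxB : ∀ i, x i ∉ B) (hmin : ∀ m, Odd m → CycleIn G Bᶜ m → l ≤ m) {u : V} (huB : u ∉ B)
    (huC : ∀ i, u ≠ x i) (hcard : 1 < #{w ∈ cyclicSupport x l | G.Adj u w}) :
    ∃ i, G.Adj u (x i) ∧ G.Adj u (x (i + 2)) := by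
  have hpos : 0 < l := by omega
  obtain ⟨a, ha, b, hb, hab⟩ := one_lt_card.1 hcard
  rw [mem_filter, hx.mem_cyclicSupport hpos] at ha hb
  obtain ⟨⟨i, rfl⟩, hai⟩ := ha
  obtain ⟨⟨j, rfl⟩, hbj⟩ := hb
  obtain ⟨d, hd, he⟩ := hx.exists_eq_add hpos i j
  rw [he] at hbj hab
  rcases Nat.eq_zero_or_pos d with rfl | hd0
  · simp at hab
  rcases hx.dist_eq_two hl hxB hmin huB huC hd0 hd hai hbj with rfl | h
  · exact ⟨i, hai, hbj⟩
  · exact ⟨i + d, hbj, by rwa [add_assoc, h, hx.add_period]⟩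

end CyclicSequences

section EdgeCounts

variable {V : Type*} {G : SimpleGraph V} [DecidableRel G.Adj] {S T U : Finset V}

/-- The number of ordered pairs of adjacent vertices in `S × T`. -/
def adjCount (G : SimpleGraph V) [DecidableRel G.Adj] (S T : Finset V) : ℕ :=
  ∑ a ∈ S, #{b ∈ T | G.Adj a b}

lemma adjCount_comm (S T : Finset V) : adjCount G S T = adjCount G T S := by
  simp only [adjCount, card_filter]
  rw [sum_comm]
  simp only [G.adj_comm]

lemma adjCount_le_mul {c : ℕ} (h : ∀ a ∈ S, #{b ∈ T | G.Adj a b} ≤ c) :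
    adjCount G S T ≤ #S * c :=
  (sum_le_card_nsmul S _ c h).trans_eq (smul_eq_mul _ _)

lemma adjCount_le_card_mul_card (S T : Finset V) : adjCount G S T ≤ #S * #T :=
  adjCount_le_mul fun _ _ => card_filter_le _ _

lemma adjCount_eq_zero (h : ∀ a ∈ S, ∀ b ∈ T, ¬ G.Adj a b) : adjCount G S T = 0 :=
  sum_eq_zero fun a ha => by
    rw [card_eq_zero, filter_eq_empty_iff]; exact fun b hb => h a ha b hb

lemma adjCount_univ [Fintype V] : adjCount G univ univ = 2 * #G.edgeFinset := by
  classical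
  rw [← G.sum_degrees_eq_twice_card_edges]
  refine sum_congr rfl fun a _ => ?_
  rw [← G.card_neighborFinset_eq_degree]
  congr 1
  ext b; simp

variable [DecidableEq V]

lemma adjCount_union_left (h : Disjoint S T) :
    adjCount G (S ∪ T) U = adjCount G S U + adjCount G T U :=
  sum_union h

lemma adjCount_union_right (h : Disjoint S T) :
    adjCount G U (S ∪ T) = adjCount G U S + adjCount G U T := by
  rw [adjCount_comm, adjCount_union_left h, adjCount_comm S, adjCount_comm T]

lemma adjCount_union_union (h : Disjoint S T) :
    adjCount G (S ∪ T) (S ∪ T) = adjCount G S S + 2 * adjCount G S T + adjCount G T T := by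
  rw [adjCount_union_left h, adjCount_union_right h, adjCount_union_right h, adjCount_comm T S]
  ring

lemma adjCount_sdiff_add (h : S ⊆ T) (U : Finset V) :
    adjCount G (T \ S) U + adjCount G S U = adjCount G T U := by
  rw [← adjCount_union_left sdiff_disjoint, sdiff_union_of_subset h]

/-- Counting pairs in a bipartite piece. -/
lemma adjCount_union_self_le (hST : Disjoint S T) (hS : ∀ a ∈ S, ∀ b ∈ S, ¬ G.Adj a b)
    (hT : ∀ a ∈ T, ∀ b ∈ T, ¬ G.Adj a b) :
    adjCount G (S ∪ T) (S ∪ T) ≤ 2 * (#S * #T) := by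
  rw [adjCount_union_union hST, adjCount_eq_zero hS, adjCount_eq_zero hT]
  have := adjCount_le_card_mul_card (G := G) S T
  omega

lemma two_mul_adjCount_le_sq {X Y : Finset V} (hXY : Disjoint X Y)
    (hX : ∀ a ∈ X, ∀ b ∈ X, ¬ G.Adj a b) (hY : ∀ a ∈ Y, ∀ b ∈ Y, ¬ G.Adj a b) :
    2 * adjCount G (X ∪ Y) (X ∪ Y) ≤ #(X ∪ Y) ^ 2 := by
  have h := adjCount_union_self_le hXY hX hY
  rw [card_union_of_disjoint hXY]
  nlinarith [four_mul_le_sq_add #X #Y]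

lemma adjCount_erase {v : V} (hv : v ∈ S) :
    adjCount G S S = adjCount G (S.erase v) (S.erase v) + 2 * #{b ∈ S | G.Adj v b} := by
  have h1 : S = S.erase v ∪ {v} := by rw [union_comm, ← insert_eq, insert_erase hv]
  have h2 : adjCount G (S.erase v) {v} = #{b ∈ S | G.Adj v b} := by
    rw [adjCount_comm, adjCount, sum_singleton]
    congr 1
    ext b
    simp only [mem_filter, mem_erase]
    exact ⟨fun h => ⟨h.1.2, h.2⟩, fun h => ⟨⟨h.2.ne', h.1⟩, h.2⟩⟩
  have h3 : adjCount G ({v} : Finset V) {v} = 0 :=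
    adjCount_eq_zero (by simp)
  conv_lhs => rw [h1]
  rw [adjCount_union_union (by simp), h2, h3, add_zero]

lemma adjCount_add_le_of_mem {S T : Finset V} {v : V} (hv : v ∈ S) :
    adjCount G S T + #T ≤ #S * #T + #{b ∈ T | G.Adj v b} := by
  have h1 := adjCount_sdiff_add (G := G) (singleton_subset_iff.2 hv) T
  have h2 := adjCount_le_card_mul_card (G := G) (S \ {v}) T
  have h3 : #(S \ {v}) + 1 = #S := by
    rw [sdiff_singleton_eq_erase, card_erase_add_one hv]
  have h4 : adjCount G {v} T = #{b ∈ T | G.Adj v b} := by rw [adjCount, sum_singleton]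
  nlinarith

end EdgeCounts

section RichPairDef

variable {V : Type*} {G : SimpleGraph V} [DecidableRel G.Adj]

/-- `X` and `Y` are disjoint, and any two vertices of one of them have at least `q` common
neighbours in the other. -/
structure IsRichPair (G : SimpleGraph V) [DecidableRel G.Adj] (X Y : Finset V) (q : ℕ) : Prop where
  disj : Disjoint X Y
  left : ∀ a ∈ X, ∀ b ∈ X, q ≤ #{w ∈ Y | G.Adj a w ∧ G.Adj b w}
  right : ∀ a ∈ Y, ∀ b ∈ Y, q ≤ #{w ∈ X | G.Adj a w ∧ G.Adj b w}

lemma IsRichPair.symm {X Y : Finset V} {q : ℕ} (h : IsRichPair G X Y q) : IsRichPair G Y X q :=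
  ⟨h.disj.symm, h.right, h.left⟩

end RichPairDef

section DenseCore

variable {V : Type*} [DecidableEq V] {G : SimpleGraph V} [DecidableRel G.Adj]

/-- Every vertex set contains a subset whose induced minimum degree is at least
`(42|K| - 21) / 100` and which keeps the excess `50 · adjCount - 21 · |K| ^ 2`. -/
lemma exists_dense_core (W : Finset V) :
    ∃ K ⊆ W, (50 * adjCount G W W - 21 * #W ^ 2 : ℤ) ≤ 50 * adjCount G K K - 21 * #K ^ 2 ∧
      ∀ v ∈ K, 42 * #K ≤ 100 * #{b ∈ K | G.Adj v b} + 21 := by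
  obtain ⟨K, hK, hmax⟩ := exists_max_image W.powerset
    (fun K => (50 * adjCount G K K - 21 * #K ^ 2 : ℤ)) ⟨W, mem_powerset_self W⟩
  rw [mem_powerset] at hK
  refine ⟨K, hK, hmax W (mem_powerset_self W), fun v hv => ?_⟩
  have h := hmax (K.erase v) (mem_powerset.2 ((erase_subset v K).trans hK))
  have hc : (#K : ℤ) = #(K.erase v) + 1 := by exact_mod_cast (card_erase_add_one hv).symm
  rw [adjCount_erase hv, hc] at h
  push_cast at h
  zify
  rw [hc]
  nlinarith

/-- Andrásfai's theorem for a vertex subset. -/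
lemma exists_bipartition_of_dense {K : Finset V} (hK : 11 ≤ #K)
    (hdeg : ∀ v ∈ K, 42 * #K ≤ 100 * #{b ∈ K | G.Adj v b} + 21)
    (htri : ∀ a ∈ K, ∀ b ∈ K, ∀ c ∈ K, G.Adj a b → G.Adj b c → ¬ G.Adj a c) :
    ∃ X Y : Finset V, Disjoint X Y ∧ X ∪ Y = K ∧ (∀ a ∈ X, ∀ b ∈ X, ¬ G.Adj a b) ∧
      (∀ a ∈ Y, ∀ b ∈ Y, ¬ G.Adj a b) := by
  have hdeg' : ∀ v : K, (G.induce (K : Set V)).degree v = #{b ∈ K | G.Adj v b} := by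
    intro v
    rw [← SimpleGraph.card_neighborFinset_eq_degree]
    refine card_bij (fun b _ => b.1) ?_ ?_ ?_
    · rintro ⟨b, hb⟩ h
      simpa using ⟨hb, by simpa using h⟩
    · intro a _ b _ h; exact Subtype.ext h
    · intro b hb
      rw [mem_filter] at hb
      exact ⟨⟨b, hb.1⟩, by simpa using hb.2, rfl⟩
  have hne : Nonempty K := by
    obtain ⟨a, ha⟩ := card_pos.1 (by omega : 0 < #K)
    exact ⟨a, ha⟩
  have hcol : (G.induce (K : Set V)).Colorable 2 := by
    apply SimpleGraph.colorable_of_cliqueFree_lt_minDegree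
    · intro s hs
      rw [SimpleGraph.is3Clique_iff] at hs
      obtain ⟨a, b, c, hab, hac, hbc, -⟩ := hs
      exact htri a a.2 b b.2 c c.2 hab hbc hac
    · obtain ⟨v, hv⟩ := (G.induce (K : Set V)).exists_minimal_degree_vertex
      rw [hv, hdeg' v]
      have := hdeg v v.2
      have hcK : Fintype.card (K : Set V) = #K := by simp
      rw [hcK]
      omega
  obtain ⟨col⟩ := hcol
  refine ⟨{v ∈ K | ∃ h : v ∈ K, col ⟨v, h⟩ = 0}, {v ∈ K | ∃ h : v ∈ K, col ⟨v, h⟩ = 1},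
    ?_, ?_, ?_, ?_⟩
  · rw [disjoint_left]
    intro a ha hb
    simp only [mem_filter] at ha hb
    obtain ⟨_, _, h1⟩ := ha
    obtain ⟨_, _, h2⟩ := hb
    rw [h1] at h2; exact absurd h2 (by decide)
  · ext v
    simp only [mem_union, mem_filter]
    constructor
    · rintro (h | h) <;> exact h.1
    · intro h
      rcases Fin.exists_fin_two.1 ⟨col ⟨v, h⟩, rfl⟩ with h' | h'
      · exact Or.inl ⟨h, h, h'⟩
      · exact Or.inr ⟨h, h, h'⟩
  all_goals
    intro a ha b hb hab
    simp only [mem_filter] at ha hb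
    obtain ⟨_, h1, e1⟩ := ha
    obtain ⟨_, h2, e2⟩ := hb
    exact col.valid (v := ⟨a, h1⟩) (w := ⟨b, h2⟩) hab (e1.trans e2.symm)

/-- Two vertices on one side of a dense bipartite core have many common neighbours. -/
lemma card_common_neighbors_of_dense {X Y : Finset V} (hXY : Disjoint X Y)
    (hK : 11 ≤ #(X ∪ Y)) (hX : ∀ a ∈ X, ∀ b ∈ X, ¬ G.Adj a b)
    (hY : ∀ a ∈ Y, ∀ b ∈ Y, ¬ G.Adj a b)
    (hdeg : ∀ v ∈ X ∪ Y, 42 * #(X ∪ Y) ≤ 100 * #{b ∈ X ∪ Y | G.Adj v b} + 21) :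
    2 * #(X ∪ Y) < 5 * #Y ∧
    ∀ a ∈ X, ∀ b ∈ X, #(X ∪ Y) ≤ 5 * #{w ∈ Y | G.Adj a w ∧ G.Adj b w} := by
  have hcard : #(X ∪ Y) = #X + #Y := card_union_of_disjoint hXY
  have degX : ∀ a ∈ X, #{b ∈ X ∪ Y | G.Adj a b} = #{b ∈ Y | G.Adj a b} := by
    intro a ha
    congr 1
    ext b
    simp only [mem_filter, mem_union]
    exact ⟨fun h => ⟨h.1.resolve_left fun hb => hX a ha b hb h.2, h.2⟩,
      fun h => ⟨Or.inr h.1, h.2⟩⟩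
  have degY : ∀ a ∈ Y, #{b ∈ X ∪ Y | G.Adj a b} ≤ #X := by
    intro a ha
    refine card_le_card fun b hb => ?_
    simp only [mem_filter, mem_union] at hb
    exact hb.1.resolve_right fun h => hY a ha b h hb.2
  have key : 0 < #X ∧ 0 < #Y := by
    have h1 : 0 < #Y → 0 < #X := fun h => by
      obtain ⟨a, ha⟩ := card_pos.1 h
      have := hdeg a (mem_union_right _ ha)
      have := degY a ha
      omega
    have h2 : 0 < #X → 0 < #Y := fun h => by
      obtain ⟨a, ha⟩ := card_pos.1 h
      have h3 := hdeg a (mem_union_left _ ha)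
      rw [degX a ha] at h3
      have : #{b ∈ Y | G.Adj a b} ≤ #Y := card_filter_le _ _
      omega
    omega
  obtain ⟨x₀, hx₀⟩ := card_pos.1 key.1
  obtain ⟨y₀, hy₀⟩ := card_pos.1 key.2
  have e1 := hdeg x₀ (mem_union_left _ hx₀)
  rw [degX x₀ hx₀] at e1
  have e2 := hdeg y₀ (mem_union_right _ hy₀)
  have e3 := degY y₀ hy₀
  have e4 : #{b ∈ Y | G.Adj x₀ b} ≤ #Y := card_filter_le _ _
  refine ⟨by omega, fun a ha b hb => ?_⟩
  have ea := hdeg a (mem_union_left _ ha)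
  have eb := hdeg b (mem_union_left _ hb)
  rw [degX a ha] at ea
  rw [degX b hb] at eb
  have hu := card_union_add_card_inter {w ∈ Y | G.Adj a w} {w ∈ Y | G.Adj b w}
  have hle : #({w ∈ Y | G.Adj a w} ∪ {w ∈ Y | G.Adj b w}) ≤ #Y :=
    card_le_card (union_subset (filter_subset _ _) (filter_subset _ _))
  rw [← filter_and] at hu
  omega

/-- In a bipartite piece with many common neighbours, vertices on the correct sides
are joined by paths of each prescribed short length. -/
lemma IsRichPair.exists_pathIn_avoiding {q L : ℕ} (hL : 2 ≤ L) : ∀ {X Y : Finset V}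
    (_ : IsRichPair G X Y q) (S : Finset V) (_ : #S + L ≤ q) {a b : V} (_ : a ∈ X)
    (_ : b ∈ if Even L then X else Y) (_ : a ≠ b) (_ : a ∉ S) (_ : b ∉ S),
    PathIn G {w | w ∈ X ∪ Y ∧ w ∉ S} L a b := by
  induction L, hL using Nat.le_induction with
  | base =>
    intro X Y h S hS a b ha hb hab haS hbS
    simp only [even_two, if_true] at hb
    obtain ⟨w, hw, hwS⟩ : ∃ w ∈ ({w ∈ Y | G.Adj a w ∧ G.Adj b w} : Finset V), w ∉ S := by
      by_contra! hcon
      have := card_le_card (show _ ⊆ S from hcon)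
      have := h.left a ha b hb
      omega
    rw [mem_filter] at hw
    have p0 : PathIn G ({b} : Set V) 0 b b := PathIn.refl rfl
    have p1 := p0.cons hw.2.2.symm (by rintro rfl; exact disjoint_left.1 h.disj hb hw.1)
    have p2 := p1.cons hw.2.1 (by
      rintro (rfl | rfl)
      · exact disjoint_left.1 h.disj ha hw.1
      · exact hab rfl)
    refine p2.mono ?_
    rintro v (rfl | rfl | rfl)
    · exact ⟨mem_union_left _ ha, haS⟩
    · exact ⟨mem_union_right _ hw.1, hwS⟩
    · exact ⟨mem_union_left _ hb, hbS⟩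
  | succ L hL ih =>
    intro X Y h S hS a b ha hb hab haS hbS
    obtain ⟨w, hw, hwS⟩ :
        ∃ w ∈ ({w ∈ Y | G.Adj a w ∧ G.Adj a w} : Finset V), w ∉ insert b S := by
      by_contra! hcon
      have := card_le_card (show _ ⊆ insert b S from hcon)
      have := h.left a ha a ha
      have := card_insert_le b S
      omega
    rw [mem_filter] at hw
    rw [mem_insert, not_or] at hwS
    have hwa : w ≠ a := by rintro rfl; exact disjoint_left.1 h.disj ha hw.1
    have p := ih h.symm (insert a S) (by have := card_insert_le a S; omega) hw.1
      (b := b) (by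
        by_cases hE : Even L
        · simpa [hE, Nat.even_add_one] using hb
        · simpa [hE, Nat.even_add_one] using hb) hwS.1 (by simp [hwa, hwS.2])
      (by simp [hab.symm, hbS])
    refine (p.cons hw.2.1 (by simp)).mono ?_
    rintro v (rfl | ⟨hv, hvS⟩)
    · exact ⟨mem_union_left _ ha, haS⟩
    · rw [union_comm] at hv
      exact ⟨hv, fun h => hvS (mem_insert_of_mem h)⟩

lemma IsRichPair.exists_pathIn {X Y : Finset V} {q L : ℕ} (h : IsRichPair G X Y q) (hL : 2 ≤ L)
    (hq : L ≤ q) {a b : V} (ha : a ∈ X) (hb : b ∈ if Even L then X else Y) (hab : a ≠ b) :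
    PathIn G {w | w ∈ X ∪ Y} L a b :=
  (h.exists_pathIn_avoiding hL ∅ (by simpa using hq) ha hb hab (by simp) (by simp)).mono
    fun _ hw => hw.1

end DenseCore

section RichPairs

variable {V : Type*} [DecidableEq V] {G : SimpleGraph V} [DecidableRel G.Adj] {X Y : Finset V}
  {q k : ℕ} {u v : V}

/-- In a `C_{2k+1}`-free graph no outside vertex sees both sides of a rich pair. -/
lemma IsRichPair.not_adj_both (h : IsRichPair G X Y q) (hk : 2 ≤ k) (hq : 2 * k ≤ q)
    (hfree : CycleFree G (2 * k + 1)) (hv : v ∉ X ∪ Y) {x y : V} (hx : x ∈ X) (hy : y ∈ Y)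
    (hvx : G.Adj v x) : ¬ G.Adj v y := by
  intro hvy
  have hodd : ¬ Even (2 * k - 1) := by grind
  have hp := h.exists_pathIn (L := 2 * k - 1) (by omega) (by omega) hx (by simpa [hodd] using hy)
    (by rintro rfl; exact disjoint_left.1 h.disj hx hy)
  have hc := hp.close (by omega) hv hvx hvy
  rw [show 2 * k - 1 + 2 = 2 * k + 1 by omega] at hc
  exact hfree.not_cycleIn (by omega) hc

/-- A path outside a rich pair closes up, through the pair, to a cycle of length `2k+1`. -/
lemma IsRichPair.cycleIn_of_pathIn (h : IsRichPair G X Y q) (hk : 2 ≤ k) (hq : 2 * k ≤ q)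
    (hv : v ∉ X ∪ Y) (hcard : 1 < #{w ∈ Y | G.Adj v w}) {y : V} (hy : y ∈ Y) (hvy : G.Adj v y)
    {P : Set V} {d : ℕ} {a b : V} (hP : PathIn G P d a b) (hPXY : ∀ w ∈ P, w ∉ X ∪ Y)
    (hvP : v ∉ P) (hya : G.Adj y a) (hvb : G.Adj v b) (hd : Even d) (hdk : d ≤ 2 * k - 2) :
    CycleIn G Set.univ (2 * k + 1) := by
  obtain ⟨y', hvy', hpath⟩ : ∃ y', G.Adj v y' ∧
      PathIn G {w | w ∈ X ∪ Y} (2 * k - 2 - d) y y' := by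
    rcases hdk.eq_or_lt with rfl | hlt
    · rw [Nat.sub_self]
      exact ⟨y, hvy, PathIn.refl (mem_union_right _ hy)⟩
    · obtain ⟨y', hy', hne⟩ := exists_mem_ne hcard y
      rw [mem_filter] at hy'
      have he : Even (2 * k - 2 - d) := by grind
      have := h.symm.exists_pathIn (L := 2 * k - 2 - d) (by grind) (by omega) hy
        (by simpa [he] using hy'.1) hne.symm
      rw [union_comm] at this
      exact ⟨y', hy'.2, this⟩
  have hjoin := hP.symm.append hya.symm hpath
    (Set.disjoint_left.2 fun w hw hw' => hPXY w hw hw')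
  have hc := hjoin.close (by omega) (by rintro (hw | hw); exacts [hvP hw, hv hw]) hvb hvy'
  rw [show d + (2 * k - 2 - d) + 1 + 2 = 2 * k + 1 by omega] at hc
  exact hc.mono (Set.subset_univ _)

/-- Outside vertices with several neighbours on the same side of a rich pair
are not adjacent. -/
lemma IsRichPair.not_adj_of_same_side (h : IsRichPair G X Y q) (hk : 2 ≤ k) (hq : 2 * k ≤ q)
    (hfree : CycleFree G (2 * k + 1)) (hu : u ∉ X ∪ Y) (hv : v ∉ X ∪ Y)
    (hcu : 1 < #{w ∈ Y | G.Adj u w}) (hcv : 1 < #{w ∈ Y | G.Adj v w}) : ¬ G.Adj u v := by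
  intro huv
  obtain ⟨y, hy⟩ := card_pos.1 (zero_lt_one.trans hcu)
  obtain ⟨y', hy', hne⟩ := exists_mem_ne hcv y
  rw [mem_filter] at hy hy'
  have he : Even (2 * k - 2) := by grind
  have hp := h.symm.exists_pathIn (L := 2 * k - 2) (by omega) (by omega) hy'.1
    (by simpa [he] using hy.1) hne
  rw [union_comm] at hp
  have hp' := hp.cons hy'.2 (by simpa using hv)
  have hc := hp'.close (by omega) (by
    rintro (rfl | hw)
    · exact huv.ne rfl
    · exact hu hw) huv hy.2
  rw [show 2 * k - 2 + 1 + 2 = 2 * k + 1 by omega] at hc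
  exact hfree.not_cycleIn (by omega) hc

/-- An outside vertex, one of whose neighbours in a rich pair sees two vertices at distance
two of a cycle of length `2k+3`, has at most three neighbours on that cycle. -/
lemma IsRichPair.card_neighbors_cycle_le_three (h : IsRichPair G X Y q) (hk : 2 ≤ k)
    (hq : 2 * k ≤ q) (hfree : CycleFree G (2 * k + 1)) {x : ℕ → V}
    (hx : IsCyclicSeq G x (2 * k + 3)) (hxXY : ∀ i, x i ∉ X ∪ Y) (hv : v ∉ X ∪ Y)
    (hvx : ∀ i, v ≠ x i) (hcard : 1 < #{w ∈ Y | G.Adj v w}) {y : V} (hy : y ∈ Y)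
    (hvy : G.Adj v y) {i : ℕ} (h0 : G.Adj y (x i)) (h2 : G.Adj y (x (i + 2))) :
    #{w ∈ cyclicSupport x (2 * k + 3) | G.Adj v w} ≤ 3 := by
  refine (card_le_card (t := {x (i + 2 + 1), x (i + 2 + 2 * k), x (i + 2 + (2 * k + 2))})
    fun w hw => ?_).trans card_le_three
  rw [mem_filter, hx.mem_cyclicSupport (by omega)] at hw
  obtain ⟨⟨j, rfl⟩, hadj⟩ := hw
  obtain ⟨e, he, hj⟩ := hx.exists_eq_add (by omega) (i + 2) j
  rw [hj] at hadj ⊢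
  have hout : ∀ i d, ∀ w ∈ {w | ∃ e ≤ d, w = x (i + e)}, w ∉ X ∪ Y := by
    rintro i d w ⟨e, -, rfl⟩; exact hxXY _
  have hvout : ∀ i d, v ∉ {w | ∃ e ≤ d, w = x (i + e)} := by
    rintro i d ⟨e, -, he⟩; exact hvx _ he
  rcases Nat.even_or_odd e with hev | hod
  · by_cases hle : e ≤ 2 * k - 2
    · exact absurd (h.cycleIn_of_pathIn hk hq hv hcard hy hvy (hx.pathIn (i + 2) he)
        (hout _ _) (hvout _ _) h2 hadj hev hle) (hfree.not_cycleIn (by omega))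
    · have : e = 2 * k ∨ e = 2 * k + 2 := by grind
      rcases this with rfl | rfl <;> simp
  · by_cases hle : 3 ≤ e
    · have hp := (hx.pathIn (i + 2 + e) (d := 2 * k + 1 - e) (by omega)).symm
      have hend : x (i + 2 + e + (2 * k + 1 - e)) = x i := by
        rw [show i + 2 + e + (2 * k + 1 - e) = i + (2 * k + 3) by grind, hx.add_period]
      rw [hend] at hp
      exact absurd (h.cycleIn_of_pathIn hk hq hv hcard hy hvy hp
        (hout _ _) (hvout _ _) h0 hadj (by grind) (by omega)) (hfree.not_cycleIn (by omega))
    · obtain rfl : e = 1 := by grind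
      simp

end RichPairs

section CoreDecompositions

variable {V : Type*} [DecidableEq V] {G : SimpleGraph V} [DecidableRel G.Adj]
  {X Y P Q C : Finset V} {q : ℕ}

/-- The vertex set is split into a rich bipartite pair `X`, `Y`, vertices `P` without neighbours
in `X`, vertices `Q` without neighbours in `Y`, and a set `C` such that every vertex of `X ∪ Y`
has at most two neighbours in `C`. -/
structure IsCoreDecomposition [Fintype V] (G : SimpleGraph V) [DecidableRel G.Adj]
    (X Y P Q C : Finset V) (q : ℕ) : Prop where
  rich : IsRichPair G X Y q
  left : ∀ a ∈ X, ∀ b ∈ X, ¬ G.Adj a b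
  right : ∀ a ∈ Y, ∀ b ∈ Y, ¬ G.Adj a b
  notAdj_left : ∀ a ∈ P, ∀ b ∈ X, ¬ G.Adj a b
  notAdj_right : ∀ a ∈ Q, ∀ b ∈ Y, ¬ G.Adj a b
  card_le_two : ∀ a ∈ X ∪ Y, #{b ∈ C | G.Adj a b} ≤ 2
  disjPQ : Disjoint P Q
  disjPQC : Disjoint (P ∪ Q) C
  disjCore : Disjoint (X ∪ Y) (P ∪ Q ∪ C)
  cover : X ∪ Y ∪ (P ∪ Q ∪ C) = univ

variable [Fintype V]

lemma IsCoreDecomposition.symm (h : IsCoreDecomposition G X Y P Q C q) :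
    IsCoreDecomposition G Y X Q P C q where
  rich := h.rich.symm
  left := h.right
  right := h.left
  notAdj_left := h.notAdj_right
  notAdj_right := h.notAdj_left
  card_le_two := by rw [union_comm]; exact h.card_le_two
  disjPQ := h.disjPQ.symm
  disjPQC := by rw [union_comm Q]; exact h.disjPQC
  disjCore := by rw [union_comm Q, union_comm Y]; exact h.disjCore
  cover := by rw [union_comm Q, union_comm Y]; exact h.cover

lemma IsCoreDecomposition.card_add (h : IsCoreDecomposition G X Y P Q C q) :
    #X + #Y + (#P + #Q + #C) = Fintype.card V := by
  rw [← card_univ, ← h.cover, card_union_of_disjoint h.disjCore,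
    card_union_of_disjoint h.rich.disj, card_union_of_disjoint h.disjPQC,
    card_union_of_disjoint h.disjPQ]

lemma IsCoreDecomposition.two_mul_card_edgeFinset_le (h : IsCoreDecomposition G X Y P Q C q) :
    2 * #G.edgeFinset ≤ 2 * (#X * #Y) + 2 * (adjCount G P Y + adjCount G Q X +
      adjCount G (X ∪ Y) C) + (#P + #Q + #C) ^ 2 := by
  have hR : #(P ∪ Q ∪ C) = #P + #Q + #C := by
    rw [card_union_of_disjoint h.disjPQC, card_union_of_disjoint h.disjPQ]
  have h1 := adjCount_union_self_le h.rich.disj h.left h.right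
  have h2 := adjCount_le_card_mul_card (G := G) (P ∪ Q ∪ C) (P ∪ Q ∪ C)
  rw [hR] at h2
  have hP : adjCount G (X ∪ Y) P = adjCount G P Y := by
    rw [adjCount_comm, adjCount_union_right h.rich.disj, adjCount_eq_zero h.notAdj_left, zero_add]
  have hQ : adjCount G (X ∪ Y) Q = adjCount G Q X := by
    rw [adjCount_comm, adjCount_union_right h.rich.disj, adjCount_eq_zero h.notAdj_right, add_zero]
  rw [← adjCount_univ, ← h.cover, adjCount_union_union h.disjCore,
    adjCount_union_right h.disjPQC, adjCount_union_right h.disjPQ, hP, hQ]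
  nlinarith

/-- A deficiency `c` among the pairs between the core and the rest lowers the edge count. -/
lemma IsCoreDecomposition.card_edgeFinset_add_le (h : IsCoreDecomposition G X Y P Q C q) {c : ℕ}
    (hc : adjCount G P Y + adjCount G Q X + adjCount G (X ∪ Y) C + c ≤
      #P * #Y + #Q * #X + 2 * (#X + #Y)) :
    2 * #G.edgeFinset + 2 * c ≤ 2 * ((#X + #P) * (#Y + #Q)) + 4 * (#X + #Y) +
      (#P + #Q + #C) ^ 2 := by
  have := h.two_mul_card_edgeFinset_le
  nlinarith [Nat.zero_le (#P * #Q)]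

lemma IsCoreDecomposition.adjCount_core_le (h : IsCoreDecomposition G X Y P Q C q) :
    adjCount G (X ∪ Y) C ≤ 2 * (#X + #Y) := by
  have := adjCount_le_mul h.card_le_two
  rw [card_union_of_disjoint h.rich.disj] at this
  omega

lemma IsCoreDecomposition.card_edgeFinset_le (h : IsCoreDecomposition G X Y P Q C q) :
    2 * #G.edgeFinset ≤ 2 * ((#X + #P) * (#Y + #Q)) + 4 * (#X + #Y) + (#P + #Q + #C) ^ 2 := by
  refine h.card_edgeFinset_add_le (c := 0) ?_
  have h1 := adjCount_le_card_mul_card (G := G) P Y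
  have h2 := adjCount_le_card_mul_card (G := G) Q X
  have h3 := h.adjCount_core_le
  omega

/-- If the edge count is within `#Y - 1` of the upper bound, then every vertex of `P` has two
neighbours in `Y`, one of which has two neighbours in `C`. -/
lemma IsCoreDecomposition.exists_adj_of_lt (h : IsCoreDecomposition G X Y P Q C q)
    (hlt : 2 * ((#X + #P) * (#Y + #Q)) + 4 * (#X + #Y) + (#P + #Q + #C) ^ 2 <
      2 * #G.edgeFinset + 2 * (#Y - 1)) {v : V} (hv : v ∈ P) :
    1 < #{w ∈ Y | G.Adj v w} ∧ ∃ y ∈ Y, G.Adj v y ∧ 1 < #{w ∈ C | G.Adj y w} := by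
  have h1 := adjCount_add_le_of_mem (G := G) (T := Y) hv
  have h2 := adjCount_le_card_mul_card (G := G) Q X
  have h3 := h.adjCount_core_le
  constructor
  · by_contra! hcon
    have h4 : #{w ∈ Y | G.Adj v w} ≤ #Y := card_filter_le _ _
    have := h.card_edgeFinset_add_le (c := #Y - 1) (by omega)
    omega
  · by_contra! hcon
    have hsub : {w ∈ Y | G.Adj v w} ⊆ X ∪ Y := (filter_subset _ _).trans subset_union_right
    have h4 := adjCount_sdiff_add (G := G) hsub C
    have h5 : adjCount G {w ∈ Y | G.Adj v w} C ≤ #{w ∈ Y | G.Adj v w} * 1 :=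
      adjCount_le_mul fun a ha => hcon a (mem_filter.1 ha).1 (mem_filter.1 ha).2
    have h6 : adjCount G ((X ∪ Y) \ {w ∈ Y | G.Adj v w}) C ≤
        #((X ∪ Y) \ {w ∈ Y | G.Adj v w}) * 2 :=
      adjCount_le_mul fun a ha => h.card_le_two a (mem_sdiff.1 ha).1
    have h7 := card_sdiff_add_card_eq_card hsub
    rw [card_union_of_disjoint h.rich.disj] at h7
    have := h.card_edgeFinset_add_le (c := #Y) (by omega)
    omega

end CoreDecompositions

section Counting

variable {V : Type*} [DecidableEq V] [Fintype V] {G : SimpleGraph V} [DecidableRel G.Adj]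
  {B C K : Finset V} {k : ℕ}

lemma two_mul_card_edgeFinset_le_adjCount_sdiff (hBC : Disjoint B C)
    (hC : ∀ u ∉ B, #{b ∈ C | G.Adj u b} ≤ 2) :
    2 * #G.edgeFinset ≤ adjCount G (univ \ (B ∪ C)) (univ \ (B ∪ C)) +
      4 * #(univ \ (B ∪ C)) + 2 * #C + 2 * (#B * Fintype.card V) := by
  obtain ⟨W, hW⟩ : ∃ W, W = univ \ (B ∪ C) := ⟨_, rfl⟩
  rw [← hW]
  have hWB : Disjoint W B := hW ▸ sdiff_disjoint.mono_right subset_union_left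
  have hWC : Disjoint W C := hW ▸ sdiff_disjoint.mono_right subset_union_right
  have hWCB : Disjoint (W ∪ C) B := disjoint_union_left.2 ⟨hWB, hBC.symm⟩
  have hcov : W ∪ C ∪ B = univ := by
    rw [hW, union_assoc, union_comm C, sdiff_union_of_subset (subset_univ _)]
  have hcard : #(W ∪ C) + #B = Fintype.card V := by
    rw [← card_univ, ← hcov, card_union_of_disjoint hWCB]
  have h1 := adjCount_le_mul (S := W) fun a ha => hC a (disjoint_left.1 hWB ha)
  have h2 := adjCount_le_mul (S := C) fun a ha => hC a fun h => disjoint_left.1 hBC h ha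
  have h3 := adjCount_le_card_mul_card (G := G) (W ∪ C) B
  have h4 := adjCount_le_card_mul_card (G := G) B B
  rw [← adjCount_univ, ← hcov, adjCount_union_union hWCB, adjCount_union_union hWC, ← hcard]
  nlinarith

/-- A dense triangle-free core gives rise to a core decomposition. -/
lemma exists_isCoreDecomposition (hk : 2 ≤ k) (hfree : CycleFree G (2 * k + 1))
    (hBC : Disjoint B C) (hC : ∀ u ∉ B, #{b ∈ C | G.Adj u b} ≤ 2) (hKW : K ⊆ univ \ (B ∪ C))
    (hK : 10 * k ≤ #K) (hdeg : ∀ v ∈ K, 42 * #K ≤ 100 * #{b ∈ K | G.Adj v b} + 21)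
    (htri : ∀ a ∈ K, ∀ b ∈ K, ∀ c ∈ K, G.Adj a b → G.Adj b c → ¬ G.Adj a c) :
    ∃ X Y P Q : Finset V, IsCoreDecomposition G X Y P Q C (2 * k) ∧ X ∪ Y = K ∧ B ⊆ P ∪ Q ∧
      2 * #K < 5 * #X ∧ 2 * #K < 5 * #Y := by
  obtain ⟨X, Y, hXY, rfl, hX, hY⟩ := exists_bipartition_of_dense (by omega) hdeg htri
  obtain ⟨hcY, hl⟩ := card_common_neighbors_of_dense hXY (by omega) hX hY hdeg
  obtain ⟨hcX, hr⟩ := card_common_neighbors_of_dense hXY.symm (by rw [union_comm]; omega) hY hX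
    (by rwa [union_comm])
  rw [union_comm] at hcX hr
  have hrich : IsRichPair G X Y (2 * k) := ⟨hXY,
    fun a ha b hb => by have := hl a ha b hb; omega,
    fun a ha b hb => by have := hr a ha b hb; omega⟩
  have hW : ∀ v ∈ X ∪ Y, v ∉ B ∧ v ∉ C := fun v hv => by
    have := (mem_sdiff.1 (hKW hv)).2
    rwa [mem_union, not_or] at this
  refine ⟨X, Y, {v ∈ univ \ (X ∪ Y ∪ C) | ∀ w ∈ X, ¬ G.Adj v w},
    {v ∈ univ \ (X ∪ Y ∪ C) | ¬ ∀ w ∈ X, ¬ G.Adj v w},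
    ⟨hrich, hX, hY, ?_, ?_, fun a ha => hC a (hW a ha).1, disjoint_filter_filter_not _ _ _, ?_, ?_,
      ?_⟩, rfl, ?_, hcX, hcY⟩
  · exact fun a ha => (mem_filter.1 ha).2
  · intro a ha b hb
    simp only [mem_filter, mem_sdiff, mem_union, not_or, not_forall, not_not] at ha
    obtain ⟨⟨-, haXY, -⟩, x, hx, hax⟩ := ha
    exact hrich.not_adj_both hk le_rfl hfree (by simpa using haXY) hx hb hax
  all_goals rw [filter_union_filter_not_eq]
  · exact sdiff_disjoint.mono_right subset_union_right
  · rw [disjoint_union_right]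
    exact ⟨disjoint_sdiff.mono_left subset_union_left,
      disjoint_left.2 fun a ha => (hW a ha).2⟩
  · ext v; simp; tauto
  · intro v hv
    have h1 := disjoint_left.1 hBC hv
    have h2 : v ∉ X ∪ Y := fun h => (hW v h).1 hv
    grind

end Counting

section Arithmetic

/-- The cycle is short and the core misses few vertices. -/
lemma core_arithmetic {n t s l m N : ℤ} (hm : m + s + l = n) (hN : 0 ≤ N) (hNm : N ≤ m)
    (hs : 0 ≤ s) (hst : s ≤ t) (ht : 1 ≤ t) (hl : t + 5 ≤ l) (hn : 636 * t ^ 2 ≤ n)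
    (h : 4 * (m ^ 2 - N ^ 2) ≤ 25 * m ^ 2 - 25 * (n - t - 1) ^ 2 + 25 - 50 * (t + 1) * (t + 2) +
      200 * m + 100 * l + 100 * s * n) :
    l ≤ s + t + 6 ∧ m ≤ N + 13 * t := by
  have htt : t ≤ t ^ 2 := by nlinarith only [ht]
  have hNm2 : N ^ 2 ≤ m ^ 2 := pow_le_pow_left₀ hN hNm 2
  have hn0 : 0 ≤ n := by omega
  have hmn : 9 * n ≤ 10 * m := by
    have h1 : s * n ≤ t * n := mul_le_mul_of_nonneg_right hst hn0
    have h2 : 620 * t * n ≤ n * n := mul_le_mul_of_nonneg_right (by omega) hn0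
    have h3 : n ≤ t * n := by nlinarith only [ht, hn0]
    have h4 : n ^ 2 ≤ m ^ 2 + 20 * (t * n) := by
      linarith only [hNm2, h, h1, h3, hm, hs, ht, hl, htt, hn0]
    by_contra! hcon
    have h5 : (10 * m) ^ 2 ≤ (9 * n) ^ 2 := pow_le_pow_left₀ (by omega) hcon.le 2
    nlinarith only [h2, h4, h5, hn, htt, ht]
  have key : 4 * (m ^ 2 - N ^ 2) ≤ 50 * ((s + t + 5 - l) * m) + 100 * (s * (s + l)) + 100 * l + 25
      - 25 * (s + l - t - 1) ^ 2 - 50 * ((t + 1) * (t + 2)) := by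
    rw [← hm] at h
    linarith only [h]
  have hm570 : 570 * t ^ 2 ≤ m := by omega
  have hls : l ≤ s + t + 6 := by
    by_contra! hcon
    obtain ⟨j, rfl⟩ : ∃ j, l = s + t + 5 + j := ⟨l - (s + t + 5), by ring⟩
    have hj : 2 ≤ j := by omega
    have h5 : 50 * (j * m) ≤ 100 * (s * (s + (s + t + 5 + j))) + 100 * (s + t + 5 + j) + 25 := by
      nlinarith only [sq_nonneg (s + (s + t + 5 + j) - t - 1), key, hNm2, ht]
    have h6 : s * (s + (s + t + 5 + j)) ≤ t * (t + (t + t + 5 + j)) :=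
      mul_le_mul hst (by omega) (by omega) (by omega)
    have h7 : t * j ≤ t ^ 2 * j := mul_le_mul_of_nonneg_right htt (by omega)
    have h8 : 570 * t ^ 2 * j ≤ m * j := mul_le_mul_of_nonneg_right hm570 (by omega)
    have h9 : 2 * t ^ 2 ≤ t ^ 2 * j := by nlinarith only [hj, sq_nonneg t]
    have h10 : j ≤ t * j := by nlinarith only [hj, ht]
    nlinarith only [h5, h6, h7, h8, h9, h10, hst, htt, ht]
  refine ⟨hls, ?_⟩
  by_contra! hcon
  have h2 : (13 * t + 1) * m ≤ m ^ 2 - N ^ 2 := by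
    have : (13 * t + 1) * (m + N) ≤ (m - N) * (m + N) :=
      mul_le_mul_of_nonneg_right (by omega) (by omega)
    nlinarith only [this, hN, ht]
  have h3 : (s + t + 5 - l) * m ≤ t * m := mul_le_mul_of_nonneg_right (by omega) (by omega)
  have h4 : s * (s + l) ≤ t * (3 * t + 6) := mul_le_mul hst (by omega) (by omega) (by omega)
  nlinarith only [h2, h3, h4, key, hm570, htt, ht, sq_nonneg (s + l - t - 1), hls, hst]

/-- The core is not small. -/
lemma core_large_arithmetic {n t s l m N e EK : ℤ} (hm : m + s + l = n) (hN : 0 ≤ N)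
    (hm0 : 0 ≤ m) (hs : 0 ≤ s) (hst : s ≤ t) (ht : 1 ≤ t) (hl : 0 ≤ l) (hn : 636 * t ^ 2 ≤ n)
    (he : (n - t - 1) ^ 2 - 1 + 2 * (t + 1) * (t + 2) ≤ 4 * e) (hEK : EK ≤ N ^ 2)
    (h : 100 * e - 200 * m - 100 * l - 100 * s * n - 21 * m ^ 2 ≤ 50 * EK - 21 * N ^ 2) :
    11 ≤ N := by
  by_contra! hcon
  have htt : t ≤ t ^ 2 := by nlinarith only [ht]
  have hn0 : 0 ≤ n := by omega
  have h1 : N ^ 2 ≤ 10 ^ 2 := pow_le_pow_left₀ hN (by omega) 2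
  have h2 : m ^ 2 ≤ n ^ 2 := pow_le_pow_left₀ hm0 (by omega) 2
  have h3 : s * n ≤ t * n := mul_le_mul_of_nonneg_right hst hn0
  have h4 : n ≤ t * n := by nlinarith only [ht, hn0]
  have h5 : 636 * t * n ≤ n * n := mul_le_mul_of_nonneg_right (by omega) hn0
  nlinarith only [h1, h2, h3, h4, h5, h, he, hEK, htt, hm, hs, ht, hl, hn]

/-- Long cycles leave too few edges. -/
lemma long_cycle_arithmetic {n t s l N r a b e : ℤ} (hN : N + r = n) (hab : a + b = n - l)
    (hs : s ≤ t) (ht : 1 ≤ t) (hlt : t + 6 ≤ l) (hl : l ≤ s + t + 6) (hr0 : 0 ≤ r)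
    (hr : r ≤ s + l + 13 * t) (hn : 636 * t ^ 2 ≤ n)
    (he : (n - t - 1) ^ 2 - 1 + 2 * (t + 1) * (t + 2) ≤ 4 * e) :
    2 * (a * b) + 4 * N + r ^ 2 < 2 * e := by
  have htt : t ≤ t ^ 2 := by nlinarith only [ht]
  have hr23 : r ^ 2 ≤ (23 * t) ^ 2 := pow_le_pow_left₀ hr0 (by omega) 2
  have hln : (n - l) ^ 2 ≤ (n - t - 6) ^ 2 := pow_le_pow_left₀ (by omega) (by omega) 2
  rw [← hab] at hln
  nlinarith only [hr23, hln, he, hn, htt, ht, hr0, hN, sq_nonneg (a - b)]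

/-- In the extremal case the edge count is within `y - 1` of the upper bound. -/
lemma tight_arithmetic {n t l N r a b e y : ℤ} (hN : N + r = n) (hab : a + b = n - l)
    (ht : 2 ≤ t) (hlt : l = t + 5) (hr0 : 0 ≤ r) (hr : r ≤ t + l + 13 * t)
    (hn : 636 * t ^ 2 ≤ n) (hy : 2 * N < 5 * y)
    (he : (n - t - 1) ^ 2 - 1 + 2 * (t + 1) * (t + 2) ≤ 4 * e) :
    2 * (a * b) + 4 * N + r ^ 2 < 2 * e + 2 * (y - 1) := by
  have htt : 2 * t ≤ t ^ 2 := by nlinarith only [ht]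
  have hr18 : r ^ 2 ≤ (18 * t) ^ 2 := pow_le_pow_left₀ hr0 (by omega) 2
  have hln : (a + b) ^ 2 = (n - t - 5) ^ 2 := by rw [hab, hlt]; ring
  nlinarith only [hr18, hln, he, hn, htt, ht, hr0, hr, hlt, hN, hy, sq_nonneg (a - b)]

lemma exact_arithmetic {n t s l a b e : ℤ} (hab : a + b = n - l) (ht : 2 ≤ t) (hs : s ≤ t)
    (hlt : l = t + 5) (he : (n - t - 1) ^ 2 - 1 + 2 * (t + 1) * (t + 2) ≤ 4 * e) :
    2 * (a * b) + 2 * (2 * (a + b) + s) + 2 * l < 2 * e := by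
  have hln : (a + b) ^ 2 = (n - t - 5) ^ 2 := by rw [hab, hlt]; ring
  nlinarith only [hln, he, hs, ht, hab, hlt, sq_nonneg (a - b),
    mul_le_mul_of_nonneg_right ht (by omega : 0 ≤ t)]

end Arithmetic

section Assembly

variable {V : Type*} [DecidableEq V] [Fintype V] {G : SimpleGraph V} [DecidableRel G.Adj]
  {X Y P Q C B : Finset V} {k l q : ℕ} {x : ℕ → V}

/-- The edge count when the two sides of a core decomposition are independent sets. -/
lemma IsCoreDecomposition.card_edgeFinset_le_of_indep (h : IsCoreDecomposition G X Y P Q C q)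
    (hP : ∀ a ∈ P, ∀ b ∈ P, ¬ G.Adj a b) (hQ : ∀ a ∈ Q, ∀ b ∈ Q, ¬ G.Adj a b)
    (hB : B ⊆ P ∪ Q) (hC2 : ∀ u ∉ B, #{w ∈ C | G.Adj u w} ≤ 2)
    (hC3 : ∀ u ∈ B, #{w ∈ C | G.Adj u w} ≤ 3) :
    2 * #G.edgeFinset ≤ 2 * ((#X + #P) * (#Y + #Q)) + 2 * (2 * (#X + #P + (#Y + #Q)) + #B) +
      2 * #C := by
  have hd := h.disjCore
  simp only [disjoint_union_left, disjoint_union_right] at hd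
  obtain ⟨⟨⟨hXP, hYP⟩, hXQ, hYQ⟩, hXC, hYC⟩ := hd
  obtain ⟨hPC, hQC⟩ := disjoint_union_left.1 h.disjPQC
  have hXPYQ : Disjoint (X ∪ P) (Y ∪ Q) := by
    simp only [disjoint_union_left, disjoint_union_right]
    exact ⟨⟨h.rich.disj, hYP.symm⟩, hXQ, h.disjPQ⟩
  have hDC : Disjoint (X ∪ P ∪ (Y ∪ Q)) C := by
    simp only [disjoint_union_left]
    exact ⟨⟨hXC, hPC⟩, hYC, hQC⟩
  have hcov : X ∪ P ∪ (Y ∪ Q) ∪ C = univ := by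
    rw [← h.cover]; ext v; simp only [mem_union]; tauto
  have indep : ∀ {S T : Finset V}, (∀ a ∈ S, ∀ b ∈ S, ¬ G.Adj a b) →
      (∀ a ∈ T, ∀ b ∈ T, ¬ G.Adj a b) → (∀ a ∈ T, ∀ b ∈ S, ¬ G.Adj a b) →
      ∀ a ∈ S ∪ T, ∀ b ∈ S ∪ T, ¬ G.Adj a b := by
    intro S T hS hT hTS a ha b hb hab
    rcases mem_union.1 ha with ha | ha <;> rcases mem_union.1 hb with hb | hb
    exacts [hS a ha b hb hab, hTS b hb a ha hab.symm, hTS a ha b hb hab, hT a ha b hb hab]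
  have hcXP := card_union_of_disjoint hXP
  have hcYQ := card_union_of_disjoint hYQ
  have h1 := adjCount_union_self_le hXPYQ (indep h.left hP h.notAdj_left)
    (indep h.right hQ h.notAdj_right)
  have hBsub : B ⊆ X ∪ P ∪ (Y ∪ Q) := hB.trans (union_subset_union subset_union_right
    subset_union_right)
  have h2 := adjCount_sdiff_add (G := G) hBsub C
  have h3 := adjCount_le_mul (S := (X ∪ P ∪ (Y ∪ Q)) \ B) fun a ha => hC2 a (mem_sdiff.1 ha).2
  have h4 := adjCount_le_mul hC3
  have h5 := adjCount_le_mul (S := C) fun a ha =>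
    hC2 a fun haB => disjoint_left.1 h.disjPQC (hB haB) ha
  have h6 := card_sdiff_add_card_eq_card hBsub
  rw [card_union_of_disjoint hXPYQ] at h6
  rw [← adjCount_univ, ← hcov, adjCount_union_union hDC]
  rw [hcXP, hcYQ] at h1 h6
  omega

lemma IsCoreDecomposition.indep_and_card_le_three
    (h : IsCoreDecomposition G X Y P Q (cyclicSupport x (2 * k + 3)) (2 * k)) (hk : 2 ≤ k)
    (hfree : CycleFree G (2 * k + 1)) (hx : IsCyclicSeq G x (2 * k + 3)) (hB : B ⊆ P ∪ Q)
    (hxB : ∀ i, x i ∉ (B : Set V))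
    (hmin : ∀ m, Odd m → CycleIn G (B : Set V)ᶜ m → 2 * k + 3 ≤ m)
    (hP : ∀ v ∈ P, 1 < #{w ∈ Y | G.Adj v w} ∧
      ∃ y ∈ Y, G.Adj v y ∧ 1 < #{w ∈ cyclicSupport x (2 * k + 3) | G.Adj y w}) :
    (∀ a ∈ P, ∀ b ∈ P, ¬ G.Adj a b) ∧
      ∀ v ∈ P, #{w ∈ cyclicSupport x (2 * k + 3) | G.Adj v w} ≤ 3 := by
  have hxC : ∀ i, x i ∈ cyclicSupport x (2 * k + 3) := fun i =>
    (hx.mem_cyclicSupport (by omega)).2 ⟨i, rfl⟩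
  have hPXY : ∀ v ∈ P, v ∉ X ∪ Y := fun v hv hvXY =>
    disjoint_left.1 h.disjCore hvXY (by simp [hv])
  refine ⟨fun a ha b hb => h.rich.not_adj_of_same_side hk le_rfl hfree (hPXY a ha) (hPXY b hb)
    (hP a ha).1 (hP b hb).1, fun v hv => ?_⟩
  obtain ⟨hcard, y, hy, hvy, hyC⟩ := hP v hv
  have hyB : y ∉ (B : Set V) := fun hyB =>
    disjoint_left.1 h.disjCore (mem_union_right _ hy) (mem_union_left _ (hB hyB))
  have hyx : ∀ i, y ≠ x i := by
    rintro i rfl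
    exact disjoint_left.1 h.disjCore (mem_union_right _ hy) (mem_union_right _ (hxC i))
  obtain ⟨i, h0, h2⟩ := hx.exists_adj_adj_add_two (by grind) (by omega) hxB hmin hyB hyx hyC
  refine h.rich.card_neighbors_cycle_le_three hk le_rfl hfree hx (fun j hj => ?_) (hPXY v hv) ?_
    hcard hy hvy h0 h2
  · exact disjoint_left.1 h.disjCore hj (mem_union_right _ (hxC j))
  · rintro j rfl
    exact disjoint_left.1 h.disjPQC (mem_union_left _ hv) (hxC j)

/-- No odd cycle of length at least `2k + 3` is a shortest odd cycle avoiding `B`. -/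
lemma false_of_long_shortest_odd_cycle {n t : ℕ} (hk : 2 ≤ k) (ht1 : 1 ≤ t)
    (ht2 : t ≤ 2 * k - 2) (hn : 318 * t ^ 2 * k ≤ n) (hcard : Fintype.card V = n)
    (hfree : CycleFree G (2 * k + 1))
    (hedge : (n - t - 1) ^ 2 / 4 + (t + 2).choose 2 ≤ #G.edgeFinset) (hB : #B ≤ t)
    (hx : IsCyclicSeq G x l) (hl : Odd l) (hkl : 2 * k + 3 ≤ l)
    (hxB : ∀ i, x i ∉ (B : Set V)) (hmin : ∀ m, Odd m → CycleIn G (B : Set V)ᶜ m → l ≤ m) :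
    False := by
  obtain ⟨C, hC⟩ : ∃ C, C = cyclicSupport x l := ⟨_, rfl⟩
  have hCcard : #C = l := hC ▸ hx.card_cyclicSupport
  have hC2 : ∀ u ∉ B, #{w ∈ C | G.Adj u w} ≤ 2 := fun u hu => by
    rw [hC]; exact hx.card_neighbors_le_two hl (by omega) hxB hmin (by simpa using hu)
  have hBC : Disjoint B C := by
    rw [hC, disjoint_left]
    intro v hv hvC
    obtain ⟨i, rfl⟩ := (hx.mem_cyclicSupport (by omega)).1 hvC
    exact hxB i hv
  have hW := two_mul_card_edgeFinset_le_adjCount_sdiff hBC hC2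
  have hWcard : #(univ \ (B ∪ C)) + (#B + #C) = n := by
    rw [← card_union_of_disjoint hBC, card_sdiff_add_card_eq_card (subset_univ _), card_univ, hcard]
  obtain ⟨K, hKW, hexc, hdeg⟩ := exists_dense_core (G := G) (univ \ (B ∪ C))
  have hKm := card_le_card hKW
  have htri : ∀ a ∈ K, ∀ b ∈ K, ∀ c ∈ K, G.Adj a b → G.Adj b c → ¬ G.Adj a c := by
    intro a ha b hb c hc hab hbc hac
    have hBK : ∀ v ∈ K, v ∈ (B : Set V)ᶜ := fun v hv hvB =>
      (mem_sdiff.1 (hKW hv)).2 (mem_union_left _ hvB)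
    have hpath : PathIn G {v | v = b ∨ v = c} 1 b c :=
      ((PathIn.refl (S := {c}) rfl).cons hbc hbc.ne).mono fun v hv => hv
    have := hmin 3 (by decide) ((hpath.close le_rfl (by simp [hab.ne, hac.ne]) hab hac).mono (by
      rintro v (rfl | rfl | rfl)
      exacts [hBK v ha, hBK v hb, hBK v hc]))
    omega
  have hn' : 636 * t ^ 2 ≤ n := by nlinarith
  have ht2' : t ≤ t ^ 2 := Nat.le_self_pow two_ne_zero t
  have hnk : 318 * k ≤ n := (Nat.mul_le_mul_right k (by omega)).trans hn
  have htn : 636 * t ≤ n := by omega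
  have he : ((n : ℤ) - t - 1) ^ 2 - 1 + 2 * (t + 1) * (t + 2) ≤ 4 * #G.edgeFinset := by
    have hch : (t + 2).choose 2 * 2 = (t + 2) * (t + 1) := by
      rw [Nat.choose_two_right, Nat.div_mul_cancel (Nat.even_mul_pred_self _).two_dvd]; rfl
    obtain ⟨z, hz⟩ : ∃ z, n = z + t + 1 := ⟨n - t - 1, by omega⟩
    have hsq : z ^ 2 ≤ 4 * (z ^ 2 / 4) + 1 := by
      have : z ^ 2 % 4 = 0 ∨ z ^ 2 % 4 = 1 := by
        rcases Nat.even_or_odd' z with ⟨w, rfl | rfl⟩ <;> ring_nf <;> omega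
      omega
    rw [show n - t - 1 = z by omega] at hedge
    rw [hz]
    push_cast
    zify at hch hedge hsq
    nlinarith
  rw [hcard, hCcard] at hW
  rw [hCcard] at hWcard
  have hWz : (2 * #G.edgeFinset : ℤ) ≤ adjCount G (univ \ (B ∪ C)) (univ \ (B ∪ C)) +
      4 * #(univ \ (B ∪ C)) + 2 * l + 2 * (#B * n) := by exact_mod_cast hW
  have hK11 : 11 ≤ #K := by
    have hEK := adjCount_le_card_mul_card (G := G) K K
    rw [← sq] at hEK
    have := core_large_arithmetic (n := n) (t := t) (s := #B) (l := l) (m := #(univ \ (B ∪ C)))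
      (N := #K) (e := #G.edgeFinset) (EK := adjCount G K K) (by omega) (by omega) (by omega)
      (by omega) (by omega) (by omega) (by omega) (by exact_mod_cast hn') he
      (by exact_mod_cast hEK) (by linarith)
    omega
  have hEK : 2 * adjCount G K K ≤ #K ^ 2 := by
    obtain ⟨X, Y, hXY, rfl, hX, hY⟩ := exists_bipartition_of_dense hK11 hdeg htri
    exact two_mul_adjCount_le_sq hXY hX hY
  obtain ⟨hlt, hKn⟩ := core_arithmetic (n := n) (t := t) (s := #B) (l := l)
    (m := #(univ \ (B ∪ C))) (N := #K) (by omega) (by omega) (by omega)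
      (by omega) (by omega) (by omega) (by omega) (by exact_mod_cast hn')
      (by zify at hEK; linarith)
  obtain ⟨X, Y, P, Q, h, hXY, hBPQ, hX, hY⟩ :=
    exists_isCoreDecomposition hk hfree hBC hC2 hKW (by omega) hdeg htri
  have hadd := h.card_add
  have hKXY : #X + #Y = #K := by rw [← hXY, card_union_of_disjoint h.rich.disj]
  rw [hcard, hCcard] at hadd
  rcases (by omega : t + 6 ≤ l ∨ l = t + 5) with htl | htl
  · have h1 := h.card_edgeFinset_le
    rw [hCcard] at h1
    have h2 := long_cycle_arithmetic (n := n) (t := t) (s := #B) (l := l) (N := #X + #Y)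
      (r := #P + #Q + l) (a := #X + #P) (b := #Y + #Q) (e := #G.edgeFinset) (by omega) (by omega)
      (by omega) (by omega) (by omega) (by omega) (by omega) (by omega) (by exact_mod_cast hn') he
    zify at h1
    omega
  · obtain rfl : l = 2 * k + 3 := by omega
    have htight : ∀ y : ℕ, 2 * #K < 5 * y →
        2 * ((#X + #P) * (#Y + #Q)) + 4 * (#X + #Y) + (#P + #Q + #C) ^ 2 <
          2 * #G.edgeFinset + 2 * (y - 1) := by
      intro y hy
      have h2 := tight_arithmetic (n := n) (t := t) (l := (2 * k + 3 : ℕ)) (N := #X + #Y)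
        (r := #P + #Q + (2 * k + 3 : ℕ)) (a := #X + #P) (b := #Y + #Q) (e := #G.edgeFinset)
        (y := y) (by omega) (by omega) (by omega) (by omega) (by omega) (by omega)
        (by exact_mod_cast hn') (by omega) he
      rw [hCcard]
      zify [show 1 ≤ y by omega]
      exact h2
    have hPY := fun v (hv : v ∈ P) => h.exists_adj_of_lt (htight _ hY) hv
    have hQX := fun v (hv : v ∈ Q) => h.symm.exists_adj_of_lt (by
      have := htight _ hX
      rwa [mul_comm (#Y + #Q), add_comm #Y #X, add_comm #Q #P]) hv
    subst hC
    obtain ⟨hP, hP3⟩ := h.indep_and_card_le_three hk hfree hx hBPQ hxB hmin hPY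
    obtain ⟨hQ, hQ3⟩ := h.symm.indep_and_card_le_three hk hfree hx
      (by rwa [union_comm]) hxB hmin hQX
    have h1 := h.card_edgeFinset_le_of_indep hP hQ hBPQ hC2 fun u hu =>
      (mem_union.1 (hBPQ hu)).elim (hP3 u) (hQ3 u)
    have h2 := exact_arithmetic (n := n) (t := t) (s := #B) (l := (2 * k + 3 : ℕ))
      (a := #X + #P) (b := #Y + #Q) (e := #G.edgeFinset) (by omega) (by omega) (by omega)
      (by omega) he
    rw [hCcard] at h1
    zify at h1
    push_cast at h2
    omega

end Assembly

end Auxiliary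

/-- Claim: let `G` be a `C_{2k+1}`-free graph on `n ≥ 318t²k` vertices with
`e(G) ≥ ⌊(n-t-1)²/4⌋ + C(t+2,2)` and let `B' ⊆ V(G)` with `|B'| ≤ t`.  If `G - B'` is not
bipartite, then every shortest odd cycle of `G - B'` has length at most `2k - 1`. -/
theorem stmt14 {V : Type*} [Fintype V] [DecidableEq V]
    (k n t : ℕ) (hk : 2 ≤ k) (ht1 : 1 ≤ t) (ht2 : t ≤ 2 * k - 2)
    (hn : 318 * t ^ 2 * k ≤ n)
    (G : SimpleGraph V) [DecidableRel G.Adj]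
    (hcard : Fintype.card V = n)
    (hfree : CycleFree G (2 * k + 1))
    (hedge : (n - t - 1) ^ 2 / 4 + (t + 2).choose 2 ≤ G.edgeFinset.card)
    (B' : Finset V) (hB' : B'.card ≤ t)
    (hnonbip : ¬ (G.induce ((↑B' : Set V)ᶜ)).Colorable 2)
    {v : ((↑B' : Set V)ᶜ : Set V)} (c : (G.induce ((↑B' : Set V)ᶜ)).Walk v v)
    (hc : c.IsCycle) (hodd : Odd c.length)
    (hmin : ∀ (u : ((↑B' : Set V)ᶜ : Set V)) (d : (G.induce ((↑B' : Set V)ᶜ)).Walk u u),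
      d.IsCycle → Odd d.length → c.length ≤ d.length) :
    c.length ≤ 2 * k - 1 := by
  have hmod : c.length % 2 = 1 := Nat.odd_iff.1 hodd
  by_contra! hlong
  obtain ⟨y, hy, -⟩ := hc.exists_isCyclicSeq
  have hne : c.length ≠ 2 * k + 1 := by
    intro hlen
    refine hfree.not_cycleIn (S := Set.univ) (by omega)
      ⟨_, c.map (SimpleGraph.Embedding.induce (G := G) _).toHom,
        hc.map Subtype.val_injective, ?_, fun _ _ => trivial⟩
    rw [SimpleGraph.Walk.length_map, hlen]
  refine false_of_long_shortest_odd_cycle hk ht1 ht2 hn hcard hfree hedge hB'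
    (hy.map (SimpleGraph.Embedding.induce _)) hodd (by omega) (fun i => (y i).2) fun m hm hcyc => ?_
  obtain ⟨u, d, hd, rfl⟩ := hcyc.exists_induce
  exact hmin u d hd hm
end

section
/- Let k ≥ 2, and let n, t be integers with 1 ≤ t ≤ 2k−2 and n ≥ 318t²k. Let G be a C_{2k+1}-free graph on n vertices with e(G) ≥ ⌊(n−t−1)²/4⌋ + (t+2 choose 2), and let B' ⊆ {v ∈ V(G) : deg_G(v) < 2√(tn)}. If G − B' is not bipartite and C is a shortest odd cycle of G − B', then C contains at most one vertex v with deg_G(v) ≥ 2√(tn). -/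
/-- The number of neighbours of `v` inside the finite set `S`. -/
def degIn {V : Type*} (G : SimpleGraph V) [DecidableRel G.Adj] (v : V) (S : Finset V) : ℕ :=
  (S.filter (G.Adj v)).card

section Degrees

variable {V : Type*} (G : SimpleGraph V) [DecidableRel G.Adj]

lemma degIn_le_card (v : V) (S : Finset V) : degIn G v S ≤ S.card := Finset.card_filter_le _ _

lemma degIn_mono (v : V) {S T : Finset V} (h : S ⊆ T) : degIn G v S ≤ degIn G v T :=
  Finset.card_le_card (Finset.filter_subset_filter _ h)

lemma degIn_union_le [DecidableEq V] (v : V) (S T : Finset V) :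
    degIn G v (S ∪ T) ≤ degIn G v S + degIn G v T := by
  unfold degIn
  rw [Finset.filter_union]
  exact Finset.card_union_le _ _

lemma degIn_add_sdiff [DecidableEq V] (v : V) {S T : Finset V} (h : S ⊆ T) :
    degIn G v S + degIn G v (T \ S) = degIn G v T := by
  unfold degIn
  rw [← Finset.card_union_of_disjoint, ← Finset.filter_union, Finset.union_sdiff_of_subset h]
  exact Finset.disjoint_filter_filter Finset.disjoint_sdiff

lemma sum_degIn_comm (A B : Finset V) : ∑ v ∈ A, degIn G v B = ∑ v ∈ B, degIn G v A := by
  unfold degIn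
  have := Finset.sum_card_bipartiteAbove_eq_sum_card_bipartiteBelow (s := A) (t := B) G.Adj
  simpa [Finset.bipartiteAbove, Finset.bipartiteBelow, G.adj_comm] using this

lemma degIn_univ [Fintype V] (v : V) : degIn G v Finset.univ = G.degree v := by
  unfold degIn
  rw [← G.card_neighborFinset_eq_degree, G.neighborFinset_eq_filter]

lemma sum_degIn_univ [Fintype V] :
    ∑ v, degIn G v Finset.univ = 2 * G.edgeFinset.card := by
  rw [← G.sum_degrees_eq_twice_card_edges]
  exact Finset.sum_congr rfl fun v _ => degIn_univ G v

/-- Mantel's theorem for the subgraph induced on a finite set. -/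
lemma two_mul_sum_degIn_le_of_triangleFree [DecidableEq V] (S : Finset V)
    (htri : ∀ a ∈ S, ∀ b ∈ S, ∀ c ∈ S, G.Adj a b → G.Adj b c → G.Adj c a → False) :
    2 * ∑ v ∈ S, degIn G v S ≤ S.card ^ 2 := by
  rcases S.eq_empty_or_nonempty with rfl | hS
  · simp
  obtain ⟨v, hv, hmax⟩ := S.exists_max_image (fun v => degIn G v S) hS
  set N := S.filter (G.Adj v) with hN
  have hNS : N ⊆ S := Finset.filter_subset _ _
  have hind : ∀ w ∈ N, degIn G w N = 0 := by
    intro w hw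
    simp only [degIn, Finset.card_eq_zero, Finset.filter_eq_empty_iff, hN, Finset.mem_filter] at hw ⊢
    intro u hu hwu
    exact htri v hv w hw.1 u hu.1 hw.2 hwu hu.2.symm
  have h1 : ∑ w ∈ S, degIn G w S
      = ∑ w ∈ S \ N, degIn G w S + ∑ w ∈ N, degIn G w S :=
    (Finset.sum_sdiff hNS).symm
  have h2 : ∑ w ∈ N, degIn G w S ≤ ∑ w ∈ S \ N, degIn G w S := by
    calc ∑ w ∈ N, degIn G w S = ∑ w ∈ N, degIn G w (S \ N) := by
          refine Finset.sum_congr rfl fun w hw => ?_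
          rw [← degIn_add_sdiff G w hNS, hind w hw, zero_add]
      _ = ∑ w ∈ S \ N, degIn G w N := sum_degIn_comm G _ _
      _ ≤ _ := Finset.sum_le_sum fun w _ => degIn_mono G w hNS
  have h3 : ∑ w ∈ S \ N, degIn G w S ≤ (S \ N).card * N.card := by
    rw [← smul_eq_mul]
    exact Finset.sum_le_card_nsmul _ _ _ fun w hw => hmax w (Finset.mem_sdiff.1 hw).1
  have h4 := Finset.card_sdiff_add_card_eq_card hNS
  nlinarith [sq_nonneg (((S \ N).card : ℤ) - N.card), four_mul_le_sq_add (S \ N).card N.card]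

/-- A finite set spanning many edges contains a nonempty subset of large minimum degree. -/
lemma exists_subset_degIn_ge [DecidableEq V] (δ : ℕ) (S : Finset V)
    (h : 2 * δ * S.card < ∑ v ∈ S, degIn G v S) :
    ∃ T ⊆ S, T.Nonempty ∧ ∀ v ∈ T, δ + 1 ≤ degIn G v T := by
  induction S using Finset.strongInduction with
  | H S ih =>
    by_cases hall : ∀ v ∈ S, δ + 1 ≤ degIn G v S
    · refine ⟨S, subset_rfl, ?_, hall⟩
      by_contra hne
      rw [Finset.not_nonempty_iff_eq_empty] at hne
      simp [hne] at h
    · push Not at hall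
      obtain ⟨v, hv, hlt⟩ := hall
      have hsub : {v} ⊆ S := by simpa using hv
      have hloop : degIn G v {v} = 0 := by simp [degIn]
      have h1 : ∑ w ∈ S, degIn G w S ≤ ∑ w ∈ S.erase v, degIn G w (S.erase v) + 2 * δ := by
        rw [← Finset.add_sum_erase _ _ hv]
        have : ∑ w ∈ S.erase v, degIn G w S
            = ∑ w ∈ S.erase v, degIn G w {v} + ∑ w ∈ S.erase v, degIn G w (S.erase v) := by
          rw [← Finset.sum_add_distrib]
          refine Finset.sum_congr rfl fun w _ => ?_
          rw [← degIn_add_sdiff G w hsub, Finset.sdiff_singleton_eq_erase]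
        rw [this, sum_degIn_comm]
        have h5 := degIn_mono G v (Finset.erase_subset v S)
        simp only [Finset.sum_singleton]
        omega
      have hc := Finset.card_erase_add_one hv
      obtain ⟨T, hT, hdeg⟩ := ih (S.erase v) (Finset.erase_ssubset hv) (by
        rw [← hc] at h
        nlinarith)
      exact ⟨T, hT.trans (Finset.erase_subset v S), hdeg⟩

/-- A finite set of minimum degree at least `m` contains a path on `m + 1` vertices. -/
lemma exists_path_of_degIn_ge [DecidableEq V] {T : Finset V} (hT : T.Nonempty) (m : ℕ)
    (h : ∀ v ∈ T, m ≤ degIn G v T) :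
    ∃ x l, (x :: l).Nodup ∧ (x :: l).length = m + 1 ∧ (x :: l).IsChain G.Adj ∧ ∀ y ∈ x :: l, y ∈ T := by
  induction m with
  | zero =>
    obtain ⟨x, hx⟩ := hT
    exact ⟨x, [], by simp, by simp, by simp, by simpa using hx⟩
  | succ m ih =>
    obtain ⟨x, l, h1, h2, h3, h4⟩ := ih fun v hv => (Nat.le_succ m).trans (h v hv)
    have hx : x ∈ T := h4 x (by simp)
    have hcard : l.toFinset.card < (T.filter (G.Adj x)).card := by
      have := List.toFinset_card_le l
      have := h x hx
      simp only [List.length_cons, degIn] at *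
      omega
    obtain ⟨y, hy, hyl⟩ := Finset.exists_mem_notMem_of_card_lt_card hcard
    simp only [Finset.mem_filter, List.mem_toFinset] at hy hyl
    refine ⟨y, x :: l, ?_, by simpa using h2, ?_, ?_⟩
    · exact List.nodup_cons.2 ⟨by simpa [hyl] using hy.2.ne', h1⟩
    · exact List.isChain_cons_cons.2 ⟨hy.2.symm, h3⟩
    · intro z hz
      rcases List.mem_cons.1 hz with rfl | hz
      · exact hy.1
      · exact h4 z hz

end Degrees

section Cores

variable {V : Type*} {G : SimpleGraph V}

/-- A `C_m`-free graph has no cyclic list of `m` distinct, consecutively adjacent vertices. -/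
lemma CycleFree.false_of_list {m : ℕ} (h : CycleFree G m) (x : V) (l : List V)
    (hnd : (x :: l).Nodup) (hlen : (x :: l).length = m)
    (hch : (x :: (l ++ [x])).IsChain G.Adj) : False := by
  have hL : (x :: (l ++ [x])).length = m + 1 := by simpa using hlen
  have hstep : ∀ i (hi : i < m), G.Adj ((x :: (l ++ [x]))[i]) ((x :: (l ++ [x]))[i + 1]) :=
    fun i hi => hch.getElem i (by omega)
  have hlast : (x :: (l ++ [x]))[m] = x := by
    subst hlen
    simp
  have hget : ∀ i (hi : i < m), (x :: (l ++ [x]))[i] = (x :: l)[i] := by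
    intro i hi
    simp only [← List.cons_append]
    exact List.getElem_append_left (by omega)
  have key : ∀ u v : Fin m, (u - v).val = 1 →
      G.Adj ((x :: (l ++ [x]))[u.val]) ((x :: (l ++ [x]))[v.val]) := by
    intro u v huv
    rcases le_or_gt v u with hle | hlt
    · rw [Fin.sub_val_of_le hle] at huv
      have : u.val = v.val + 1 := by omega
      simp only [this]
      exact (hstep v v.2).symm
    · rw [Fin.coe_sub_iff_lt.2 hlt] at huv
      have hv : v.val + 1 = m := by omega
      have hu : u.val = 0 := by omega
      have := hstep v v.2
      simp only [hv, hlast] at this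
      simpa [hu] using this.symm
  refine h ⟨fun i => (x :: (l ++ [x]))[i.val], ?_⟩ ?_
  · intro u v huv
    rcases SimpleGraph.cycleGraph_adj'.1 huv with h1 | h1
    · exact key u v h1
    · exact (key v u h1).symm
  · intro u v huv
    have huv_get : (x :: (l ++ [x]))[u.val] = (x :: (l ++ [x]))[v.val] := huv
    rw [hget u u.2, hget v v.2] at huv_get
    exact Fin.ext ((hnd.getElem_inj_iff).1 huv_get)

/-- Two disjoint vertex classes such that each vertex of one class is adjacent to all but at most
`β` vertices of the other class, and both classes have more than `2 * β + s` vertices. -/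
structure IsCore (G : SimpleGraph V) [DecidableRel G.Adj] (A B : Finset V) (β s : ℕ) : Prop where
  disj : Disjoint A B
  left : ∀ a ∈ A, B.card ≤ degIn G a B + β
  right : ∀ b ∈ B, A.card ≤ degIn G b A + β
  cardA : 2 * β + s + 1 ≤ A.card
  cardB : 2 * β + s + 1 ≤ B.card

variable [DecidableRel G.Adj] [DecidableEq V] {A B : Finset V} {β s : ℕ}

omit [DecidableEq V] in
lemma IsCore.symm (h : IsCore G A B β s) : IsCore G B A β s :=
  ⟨h.disj.symm, h.right, h.left, h.cardB, h.cardA⟩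

lemma IsCore.exists_common (h : IsCore G A B β s) {b b' : V} (hb : b ∈ B) (hb' : b' ∈ B)
    (S : Finset V) (hS : S.card ≤ s) : ∃ a ∈ A, G.Adj b a ∧ G.Adj a b' ∧ a ∉ S := by
  by_contra! hcon
  have hsub : A.filter (G.Adj b) ⊆ (A \ A.filter (G.Adj b')) ∪ S := by
    intro a ha
    simp only [Finset.mem_filter, Finset.mem_union, Finset.mem_sdiff] at ha ⊢
    by_cases hab : G.Adj a b'
    · exact Or.inr (hcon a ha.1 ha.2 hab)
    · exact Or.inl ⟨ha.1, fun hc => hab hc.2.symm⟩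
  have h1 := (Finset.card_le_card hsub).trans (Finset.card_union_le _ _)
  have h2 := Finset.card_sdiff_add_card_eq_card (Finset.filter_subset (G.Adj b') A)
  have h3 := h.right b hb
  have h4 := h.right b' hb'
  have h5 := h.cardA
  unfold degIn at h3 h4
  omega

lemma IsCore.even_path (h : IsCore G A B β s) (j : ℕ) {b b' : V} (hb : b ∈ B) (hb' : b' ∈ B)
    (S : Finset V) (hbS : b ∈ S) (hbS' : b' ∈ S) (hS : S.card + 2 * j ≤ s) :
    ∃ l : List V, l.length = 2 * j + 1 ∧ l.Nodup ∧ (∀ x ∈ l, x ∉ S) ∧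
      (b :: (l ++ [b'])).IsChain G.Adj := by
  induction j generalizing b S with
  | zero =>
    obtain ⟨a, -, h1, h2, h3⟩ := h.exists_common hb hb' S (by omega)
    exact ⟨[a], by simp, by simp, by simpa using h3, by simp [h1, h2]⟩
  | succ j ih =>
    obtain ⟨c, hc, hcS⟩ := Finset.exists_mem_notMem_of_card_lt_card
      (s := S) (t := B) (by have := h.cardB; omega)
    have hc1 := Finset.card_insert_le c S
    obtain ⟨a, -, h1, h2, h3⟩ := h.exists_common hb hc (insert c S) (by omega)
    have hc2 := Finset.card_insert_le a (insert c S)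
    obtain ⟨l, hl1, hl2, hl3, hl4⟩ := ih (b := c) hc (insert a (insert c S)) (by simp)
      (by simp [hbS']) (by omega)
    refine ⟨a :: c :: l, by simp [hl1]; omega, ?_, ?_, ?_⟩
    · simp only [Finset.mem_insert] at hl3 h3
      simp only [List.nodup_cons, List.mem_cons, hl2]
      grind
    · simp only [Finset.mem_insert] at hl3 h3
      simp only [List.mem_cons]
      grind
    · simp only [List.cons_append, List.isChain_cons_cons]
      exact ⟨h1, h2, hl4⟩

lemma IsCore.odd_path (h : IsCore G A B β s) (j : ℕ) {a b : V} (ha : a ∈ A) (hb : b ∈ B)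
    (S : Finset V) (hbS : b ∈ S) (hS : S.card + 2 * j + 1 ≤ s) :
    ∃ l : List V, l.length = 2 * j + 2 ∧ l.Nodup ∧ (∀ x ∈ l, x ∉ S) ∧
      (a :: (l ++ [b])).IsChain G.Adj := by
  obtain ⟨c, hc, hcS⟩ := Finset.exists_mem_notMem_of_card_lt_card
      (s := S) (t := B.filter (G.Adj a)) (by
        have := h.cardB; have := h.left a ha; unfold degIn at this; omega)
  rw [Finset.mem_filter] at hc
  have hc1 := Finset.card_insert_le c S
  obtain ⟨l, hl1, hl2, hl3, hl4⟩ := h.even_path j hc.1 hb (insert c S) (by simp)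
      (by simp [hbS]) (by omega)
  refine ⟨c :: l, by simp [hl1], ?_, ?_, ?_⟩
  · simp only [Finset.mem_insert] at hl3
    simp only [List.nodup_cons, hl2]
    grind
  · simp only [Finset.mem_insert] at hl3
    simp only [List.mem_cons]
    grind
  · simp only [List.cons_append, List.isChain_cons_cons]
    exact ⟨hc.2, hl4⟩

variable [Fintype V]

/-- The vertices with at least two neighbours in `S`. -/
def attached (G : SimpleGraph V) [DecidableRel G.Adj] (S : Finset V) : Finset V :=
  Finset.univ.filter fun w => 2 ≤ degIn G w S

omit [DecidableEq V] in
lemma mem_attached {S : Finset V} {w : V} : w ∈ attached G S ↔ 2 ≤ degIn G w S := by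
  simp [attached]

omit [DecidableEq V] in
lemma exists_adj_ne_of_mem_attached {S : Finset V} {w : V} (h : w ∈ attached G S) (z : V) :
    ∃ b ∈ S, G.Adj w b ∧ b ≠ z := by
  rw [mem_attached] at h
  obtain ⟨b, hb, hbz⟩ := Finset.exists_mem_notMem_of_card_lt_card
    (s := {z}) (t := S.filter (G.Adj w)) (by rw [Finset.card_singleton]; exact h)
  simp only [Finset.mem_filter, Finset.mem_singleton] at hb hbz
  exact ⟨b, hb.1, hb.2, hbz⟩

omit [DecidableEq V] in
lemma IsCore.subset_attached (h : IsCore G A B β s) (hs : 1 ≤ s) : A ⊆ attached G B := by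
  intro a ha
  rw [mem_attached]
  have := h.left a ha
  have := h.cardB
  omega

lemma IsCore.disjoint_attached {k : ℕ} (h : IsCore G A B β (2 * k)) (hk : 2 ≤ k)
    (hfree : CycleFree G (2 * k + 1)) : Disjoint (attached G B) (attached G A) := by
  rw [Finset.disjoint_left]
  intro w hwB hwA
  obtain ⟨b, hb, hwb, -⟩ := exists_adj_ne_of_mem_attached hwB w
  obtain ⟨a, ha, hwa, -⟩ := exists_adj_ne_of_mem_attached hwA w
  obtain ⟨l, hl1, hl2, hl3, hl4⟩ := h.odd_path (k - 2) ha hb {w, a, b} (by simp) (by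
    have := Finset.card_le_three (a := w) (b := a) (c := b)
    omega)
  have hab : a ≠ b := fun e => Finset.disjoint_left.1 h.disj ha (e ▸ hb)
  have h1 := hwa.ne
  have h2 := hwb.ne
  simp only [Finset.mem_insert, Finset.mem_singleton] at hl3
  refine hfree.false_of_list w (a :: (l ++ [b])) ?_ (by simp; omega) ?_
  · simp only [List.nodup_cons, List.nodup_append, List.mem_cons, List.mem_append]
    grind
  · have : w :: (a :: (l ++ [b]) ++ [w]) = w :: a :: (l ++ b :: [w]) := by simp
    rw [this, List.isChain_cons_cons, List.isChain_cons_split]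
    exact ⟨hwa, hl4, by simpa using hwb.symm⟩

lemma IsCore.not_adj_attached {k : ℕ} (h : IsCore G A B β (2 * k)) (hk : 2 ≤ k)
    (hfree : CycleFree G (2 * k + 1)) {w w' : V} (hw : w ∈ attached G B) (hw' : w' ∈ attached G B) :
    ¬ G.Adj w w' := by
  intro hadj
  have hBd : ∀ b ∈ B, b ∉ attached G B := fun b hb hb' =>
    Finset.disjoint_left.1 (h.disjoint_attached hk hfree) hb' (h.symm.subset_attached (by omega) hb)
  obtain ⟨b, hb, hwb, -⟩ := exists_adj_ne_of_mem_attached hw w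
  obtain ⟨b', hb', hwb', hbb⟩ := exists_adj_ne_of_mem_attached hw' b
  obtain ⟨l, hl1, hl2, hl3, hl4⟩ := h.even_path (k - 2) hb hb' {w, w', b, b'} (by simp) (by simp) (by
    have := Finset.card_le_four (a := w) (b := w') (c := b) (d := b')
    omega)
  have h1 := hadj.ne
  have h2 := hwb.ne
  have h3 := hwb'.ne
  have h4 : b ≠ w' := fun e => hBd b hb (e ▸ hw')
  have h5 : b' ≠ w := fun e => hBd b' hb' (e ▸ hw)
  simp only [Finset.mem_insert, Finset.mem_singleton] at hl3
  refine hfree.false_of_list w (b :: (l ++ [b', w'])) ?_ (by simp; omega) ?_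
  · simp only [List.nodup_cons, List.nodup_append, List.mem_cons, List.mem_append]
    grind
  · have : w :: (b :: (l ++ [b', w']) ++ [w]) = w :: b :: (l ++ b' :: [w', w]) := by simp
    rw [this, List.isChain_cons_cons, List.isChain_cons_split]
    exact ⟨hwb, hl4, by simp [hwb'.symm, hadj.symm]⟩

end Cores

section Extraction

variable {V : Type*} [Fintype V] [DecidableEq V] {G : SimpleGraph V} [DecidableRel G.Adj]

/-- Neighbourhoods in a `C_{2k+1}`-free graph span few edges. -/
lemma CycleFree.sum_degIn_le {k : ℕ} (hk : 1 ≤ k) (hfree : CycleFree G (2 * k + 1)) (v : V)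
    (S : Finset V) (hS : S ⊆ G.neighborFinset v) :
    ∑ u ∈ S, degIn G u S ≤ 2 * (2 * k - 2) * S.card := by
  by_contra! hcon
  obtain ⟨T, hTS, hT, hdeg⟩ := exists_subset_degIn_ge G _ S hcon
  obtain ⟨x, l, h1, h2, h3, h4⟩ := exists_path_of_degIn_ge G hT _ hdeg
  have hadj : ∀ y ∈ x :: l, G.Adj v y := fun y hy => by
    simpa using hS (hTS (h4 y hy))
  refine hfree.false_of_list v (x :: l) ?_ (by simp at h2 ⊢; omega) ?_
  · exact List.nodup_cons.2 ⟨fun hv => (hadj v hv).ne rfl, h1⟩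
  · rw [List.cons_append, List.isChain_cons_cons]
    refine ⟨hadj x (by simp), ?_⟩
    rw [← List.cons_append, List.isChain_append]
    refine ⟨h3, by simp, ?_⟩
    intro y hy z hz
    simp only [List.head?_cons, Option.mem_def, Option.some.injEq] at hz
    subst hz
    exact (hadj y (List.mem_of_mem_getLast? hy)).symm

/-- If neighbourhoods span few edges, some edge has a large joint neighbourhood. -/
lemma exists_adj_card_neighborFinset_union_ge (c : ℕ)
    (hsp : ∀ v, ∑ u ∈ G.neighborFinset v, degIn G u (G.neighborFinset v) ≤ c * G.degree v)
    (he : 0 < G.edgeFinset.card) :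
    ∃ u v, G.Adj u v ∧ 4 * G.edgeFinset.card ≤
      Fintype.card V * ((G.neighborFinset u ∪ G.neighborFinset v).card + c) := by
  by_contra! hcon
  set e := G.edgeFinset.card with hedef
  set n := Fintype.card V with hn
  have hd : ∑ u, G.degree u = 2 * e := G.sum_degrees_eq_twice_card_edges
  have hpt : ∀ u, ∀ v ∈ G.neighborFinset u,
      n * (G.degree u + G.degree v + c) + 1 ≤ 4 * e + n * degIn G v (G.neighborFinset u) := by
    intro u v hv
    have h1 := hcon u v (by simpa using hv)
    have h2 := Finset.card_union_add_card_inter (G.neighborFinset u) (G.neighborFinset v)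
    have h3 : (G.neighborFinset u ∩ G.neighborFinset v).card = degIn G v (G.neighborFinset u) := by
      unfold degIn
      congr 1
      ext w
      simp
    simp only [SimpleGraph.card_neighborFinset_eq_degree] at h2
    rw [← h2, h3]
    nlinarith
  have hsum : ∑ u, ∑ v ∈ G.neighborFinset u, (n * (G.degree u + G.degree v + c) + 1) ≤
      ∑ u, ∑ v ∈ G.neighborFinset u, (4 * e + n * degIn G v (G.neighborFinset u)) :=
    Finset.sum_le_sum fun u _ => Finset.sum_le_sum fun v hv => hpt u v hv
  have hswap : ∑ u, ∑ v ∈ G.neighborFinset u, G.degree v = ∑ u, G.degree u ^ 2 := by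
    rw [Finset.sum_comm' (t' := Finset.univ) (s' := fun v => G.neighborFinset v)
      (by intro x y; simp [G.adj_comm])]
    simp [sq]
  have hL : ∑ u, ∑ v ∈ G.neighborFinset u, (n * (G.degree u + G.degree v + c) + 1)
      = n * (2 * ∑ u, G.degree u ^ 2 + c * (2 * e)) + 2 * e := by
    simp only [Finset.sum_add_distrib, ← Finset.mul_sum, mul_add, hswap]
    simp only [Finset.sum_const, SimpleGraph.card_neighborFinset_eq_degree, smul_eq_mul,
      ← Finset.sum_mul, hd, mul_one, ← sq]
    ring
  have hR : ∑ u, ∑ v ∈ G.neighborFinset u, (4 * e + n * degIn G v (G.neighborFinset u))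
      ≤ 2 * e * (4 * e) + n * (c * (2 * e)) := by
    simp only [Finset.sum_add_distrib, ← Finset.mul_sum, Finset.sum_const,
      SimpleGraph.card_neighborFinset_eq_degree, smul_eq_mul, ← Finset.sum_mul, hd]
    have : ∑ u, ∑ v ∈ G.neighborFinset u, degIn G v (G.neighborFinset u) ≤ c * (2 * e) := by
      rw [← hd, Finset.mul_sum]
      exact Finset.sum_le_sum fun u _ => hsp u
    exact add_le_add (le_of_eq (by ring)) (Nat.mul_le_mul_left n this)
  have hcs : (2 * e) ^ 2 ≤ n * ∑ u, G.degree u ^ 2 := by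
    rw [← hd]
    simpa using sq_sum_le_card_mul_sum_sq (s := Finset.univ) (f := fun u => G.degree u)
  nlinarith

/-- A dense `C_{2k+1}`-free graph has two disjoint classes with almost all edges between them. -/
lemma CycleFree.exists_dense_pair {k t : ℕ} (hk : 2 ≤ k) (ht : 1 ≤ t)
    (hn : 318 * (t * k) ≤ Fintype.card V) (hfree : CycleFree G (2 * k + 1))
    (he : Fintype.card V ^ 2 ≤ 4 * G.edgeFinset.card + 4 * t * Fintype.card V) :
    ∃ A B : Finset V, Disjoint A B ∧ Fintype.card V ≤ A.card + B.card + 4 * (t * k) ∧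
      Fintype.card V ^ 2 ≤ 4 * ∑ a ∈ A, degIn G a B + 24 * (t * k) * Fintype.card V := by
  set n := Fintype.card V with hndef
  set e := G.edgeFinset.card with hedef
  have htk : k + t ≤ t * k + 1 := by nlinarith
  have hn0 : 0 < n := by nlinarith
  have he0 : 0 < e := by
    by_contra! h0
    have : e = 0 := by omega
    rw [this] at he
    nlinarith
  obtain ⟨u, v, huv, hcard⟩ := exists_adj_card_neighborFinset_union_ge (G := G) (2 * (2 * k - 2))
    (fun v => by
      simpa using hfree.sum_degIn_le (by omega) v (G.neighborFinset v) subset_rfl) he0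
  set A := G.neighborFinset u with hA
  set B := G.neighborFinset v \ A with hB
  have hdisj : Disjoint A B := Finset.disjoint_sdiff
  have hun : A ∪ B = G.neighborFinset u ∪ G.neighborFinset v := Finset.union_sdiff_self_eq_union
  rw [← hun, Finset.card_union_of_disjoint hdisj, ← hedef, ← hndef] at hcard
  have hsA := hfree.sum_degIn_le (by omega) u A subset_rfl
  have hsB := hfree.sum_degIn_le (by omega) v B Finset.sdiff_subset
  obtain ⟨j, rfl⟩ : ∃ j, k = j + 1 := ⟨k - 1, by omega⟩
  have hj : 2 * (2 * (j + 1) - 2) = 4 * j := by omega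
  rw [hj] at hcard hsA hsB
  have hsize : n ≤ A.card + B.card + 4 * t + 4 * j := by
    have : n * n ≤ n * (A.card + B.card + 4 * t + 4 * j) := by nlinarith
    exact Nat.le_of_mul_le_mul_left this hn0
  have hAB : A.card + B.card ≤ n := by
    rw [← Finset.card_union_of_disjoint hdisj]
    exact Finset.card_le_univ _
  refine ⟨A, B, hdisj, by omega, ?_⟩
  have hdeg : ∀ w, degIn G w Finset.univ ≤ degIn G w A + degIn G w B + degIn G w (A ∪ B)ᶜ := by
    intro w
    have h1 := degIn_add_sdiff G w (Finset.subset_univ (A ∪ B))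
    have h2 := degIn_union_le G w A B
    rw [← Finset.compl_eq_univ_sdiff] at h1
    omega
  have hC : ((A ∪ B)ᶜ).card + A.card + B.card = n := by
    rw [add_assoc, ← Finset.card_union_of_disjoint hdisj]
    exact Finset.card_compl_add_card _
  have htot := sum_degIn_univ G
  have hsplit : ∑ w, degIn G w Finset.univ = ∑ w ∈ A, degIn G w Finset.univ
      + ∑ w ∈ B, degIn G w Finset.univ + ∑ w ∈ (A ∪ B)ᶜ, degIn G w Finset.univ := by
    rw [← Finset.sum_union hdisj, Finset.sum_add_sum_compl]
  have hout : ∑ w ∈ (A ∪ B)ᶜ, degIn G w Finset.univ ≤ ((A ∪ B)ᶜ).card * n := by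
    rw [← smul_eq_mul]
    exact Finset.sum_le_card_nsmul _ _ _ fun w _ => degIn_le_card G w _
  have hcomm : ∑ w ∈ (A ∪ B)ᶜ, degIn G w Finset.univ =
      ∑ w ∈ A, degIn G w (A ∪ B)ᶜ + ∑ w ∈ B, degIn G w (A ∪ B)ᶜ
        + ∑ w ∈ (A ∪ B)ᶜ, degIn G w (A ∪ B)ᶜ := by
    rw [sum_degIn_comm, ← Finset.sum_union hdisj, Finset.sum_add_sum_compl]
  have hAs := Finset.sum_le_sum (s := A) fun w _ => hdeg w
  have hBs := Finset.sum_le_sum (s := B) fun w _ => hdeg w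
  simp only [Finset.sum_add_distrib] at hAs hBs
  have hEcomm := sum_degIn_comm G A B
  rw [← hedef] at htot
  set E := ∑ a ∈ A, degIn G a B
  set c := ((A ∪ B)ᶜ).card
  have h2e : 2 * e ≤ 2 * E + 4 * j * n + 2 * (c * n) := by
    have h1 : 4 * j * A.card + 4 * j * B.card ≤ 4 * j * n := by
      rw [← mul_add]
      exact Nat.mul_le_mul_left _ hAB
    omega
  have hc : c ≤ 4 * t + 4 * j := by omega
  have hcn : c * n ≤ (4 * t + 4 * j) * n := Nat.mul_le_mul_right _ hc
  have hfin : (4 * t + 8 * j + 4 * (4 * t + 4 * j)) * n ≤ 24 * (t * (j + 1)) * n := by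
    apply Nat.mul_le_mul_right
    nlinarith
  linarith

/-- The vertices of `A` adjacent to all but at most `β` vertices of `B`. -/
def trim (G : SimpleGraph V) [DecidableRel G.Adj] (A B : Finset V) (β : ℕ) : Finset V :=
  A.filter fun a => B.card ≤ degIn G a B + β

omit [Fintype V] [DecidableEq V] in
lemma trim_subset (A B : Finset V) (β : ℕ) : trim G A B β ⊆ A := Finset.filter_subset _ _

omit [Fintype V] in
lemma card_sdiff_trim (A B : Finset V) (β : ℕ) :
    (A \ trim G A B β).card * (β + 1) + ∑ a ∈ A, degIn G a B ≤ A.card * B.card := by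
  rw [← smul_eq_mul A.card, ← Finset.sum_const, ← Finset.sum_sdiff (trim_subset (G := G) A B β),
    ← Finset.sum_sdiff (f := fun _ => B.card) (trim_subset (G := G) A B β), ← add_assoc,
    ← smul_eq_mul, ← Finset.sum_const, ← Finset.sum_add_distrib]
  refine add_le_add (Finset.sum_le_sum fun a ha => ?_)
    (Finset.sum_le_sum fun a _ => degIn_le_card G a B)
  simp only [trim, Finset.mem_sdiff, Finset.mem_filter, not_and, not_le] at ha
  have := ha.2 ha.1
  omega

omit [Fintype V] in
lemma isCore_trim {A B : Finset V} {β s : ℕ} (hd : Disjoint A B)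
    (hA : 2 * β + s + 1 ≤ (trim G A B β).card) (hB : 2 * β + s + 1 ≤ (trim G B A β).card) :
    IsCore G (trim G A B β) (trim G B A β) β s := by
  have key : ∀ {A B : Finset V}, ∀ a ∈ trim G A B β,
      (trim G B A β).card ≤ degIn G a (trim G B A β) + β := by
    intro A B a ha
    have h1 := (Finset.mem_filter.1 ha).2
    have h2 := degIn_add_sdiff G a (trim_subset (G := G) B A β)
    have h3 := degIn_le_card G a (B \ trim G B A β)
    have h4 := Finset.card_sdiff_add_card_eq_card (trim_subset (G := G) B A β)
    omega
  exact ⟨hd.mono (trim_subset _ _ _) (trim_subset _ _ _), key, key, hA, hB⟩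

end Extraction

lemma remaining_card_ge {a b n x y β E : ℕ} (hab : a + b ≤ n) (hx : x * (β + 1) + E ≤ a * b)
    (hxy : x + y = a) (hβ : n ≤ 7 * (β + 1)) (hE : 49 * n ^ 2 ≤ 212 * E) (hn : 0 < n) :
    33 * n ≤ 100 * y := by
  subst hxy
  have h1 : x * n ≤ x * (7 * (β + 1)) := Nat.mul_le_mul_left _ hβ
  have h2 : (x + y) * (x + y + b) ≤ (x + y) * n := Nat.mul_le_mul_left _ hab
  refine Nat.le_of_mul_le_mul_right (?_ : 33 * n * n ≤ 100 * y * n) hn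
  zify at *
  have h3 := sq_nonneg (7 * ((x : ℤ) + y) - 3 * n)
  linarith

lemma removed_card_le {a b n x β E : ℕ} (hab : a + b ≤ n) (hx : x * (β + 1) + E ≤ a * b)
    (hβ : n ≤ 7 * (β + 1)) (hE : 49 * n ^ 2 ≤ 212 * E) (hn : 0 < n) : 53 * x ≤ 7 * n := by
  have h1 : x * n ≤ x * (7 * (β + 1)) := Nat.mul_le_mul_left _ hβ
  have h2 : (a + b) ^ 2 ≤ n ^ 2 := Nat.pow_le_pow_left hab 2
  refine Nat.le_of_mul_le_mul_right (?_ : 53 * x * n ≤ 7 * n * n) hn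
  zify at *
  have h3 := sq_nonneg ((a : ℤ) - b)
  linarith

lemma loss_bounds {a b n x y r t β E : ℕ} (hn : 0 < n) (hβ : n ≤ 7 * (β + 1))
    (hx : x * (β + 1) + E ≤ a * b) (hy : y * (β + 1) + E ≤ b * a)
    (h : 14 * (a * b) + r * n ≤ 14 * E + 14 * t * n) :
    x + y + r ≤ 14 * t ∧ a * b ≤ E + t * n := by
  have h1 : x * n ≤ x * (7 * (β + 1)) := Nat.mul_le_mul_left _ hβ
  have h2 : y * n ≤ y * (7 * (β + 1)) := Nat.mul_le_mul_left _ hβ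
  have h3 : 0 ≤ r * n := Nat.zero_le _
  refine ⟨Nat.le_of_mul_le_mul_right (?_ : (x + y + r) * n ≤ 14 * t * n) hn, ?_⟩
  all_goals linarith

section Structure

variable {V : Type*} [Fintype V] [DecidableEq V] {G : SimpleGraph V} [DecidableRel G.Adj]

/-- A dense `C_{2k+1}`-free graph contains a core covering most of its vertices. -/
lemma CycleFree.exists_core {k t : ℕ} (hk : 2 ≤ k) (ht : 1 ≤ t)
    (hn : 318 * (t * k) ≤ Fintype.card V) (hfree : CycleFree G (2 * k + 1))
    (he : Fintype.card V ^ 2 ≤ 4 * G.edgeFinset.card + 4 * t * Fintype.card V) :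
    ∃ A B : Finset V, IsCore G A B (Fintype.card V / 7) (2 * k) ∧
      33 * Fintype.card V ≤ 100 * A.card ∧ 33 * Fintype.card V ≤ 100 * B.card ∧
      72 * Fintype.card V ≤ 100 * (A.card + B.card) := by
  obtain ⟨A, B, hd, hsize, hE⟩ := hfree.exists_dense_pair hk ht hn he
  set n := Fintype.card V with hndef
  have hkt : k ≤ t * k := by nlinarith
  have hn0 : 0 < n := by omega
  have hAB : A.card + B.card ≤ n := by
    rw [← Finset.card_union_of_disjoint hd]
    exact Finset.card_le_univ _
  have hEn : 49 * n ^ 2 ≤ 212 * ∑ a ∈ A, degIn G a B := by nlinarith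
  have hA := card_sdiff_trim (G := G) A B (n / 7)
  have hB := card_sdiff_trim (G := G) B A (n / 7)
  rw [← sum_degIn_comm] at hB
  have hA' := Finset.card_sdiff_add_card_eq_card (trim_subset (G := G) A B (n / 7))
  have hB' := Finset.card_sdiff_add_card_eq_card (trim_subset (G := G) B A (n / 7))
  have hβ : n ≤ 7 * (n / 7 + 1) := by omega
  set β := n / 7 with hβdef
  set E := ∑ a ∈ A, degIn G a B
  set A₀ := trim G A B β
  set B₀ := trim G B A β
  have hA0 := remaining_card_ge hAB hA hA' hβ hEn hn0
  have hB0 := remaining_card_ge ((add_comm _ _).trans_le hAB) hB hB' hβ hEn hn0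
  have hA1 := removed_card_le hAB hA hβ hEn hn0
  have hB1 := removed_card_le ((add_comm _ _).trans_le hAB) hB hβ hEn hn0
  have hA2 : 2 * β + 2 * k + 1 ≤ A₀.card := by omega
  have hB2 : 2 * β + 2 * k + 1 ≤ B₀.card := by omega
  exact ⟨A₀, B₀, isCore_trim hd hA2 hB2, hA0, hB0, by omega⟩

/-- Vertices attached to neither side of a core have small degree, so the two attached classes
span almost a complete bipartite graph. -/
lemma IsCore.card_attached_le {k t β : ℕ} {A B : Finset V} (h : IsCore G A B β (2 * k))
    (hk : 2 ≤ k) (hn : 318 * k ≤ Fintype.card V) (hfree : CycleFree G (2 * k + 1))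
    (he : Fintype.card V ^ 2 ≤ 4 * G.edgeFinset.card + 4 * t * Fintype.card V)
    (hsize : 72 * Fintype.card V ≤ 100 * (A.card + B.card)) :
    14 * ((attached G B).card * (attached G A).card)
      + (attached G B ∪ attached G A)ᶜ.card * Fintype.card V
      ≤ 14 * ∑ a ∈ attached G B, degIn G a (attached G A) + 14 * t * Fintype.card V := by
  have hdisj := h.disjoint_attached hk hfree
  have hA0 := h.subset_attached (by omega)
  have hB0 := h.symm.subset_attached (by omega)
  have hindA : ∀ w ∈ attached G B, degIn G w (attached G B) = 0 := by
    intro w hw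
    simp only [degIn, Finset.card_eq_zero, Finset.filter_eq_empty_iff]
    exact fun u hu => h.not_adj_attached hk hfree hw hu
  have hindB : ∀ w ∈ attached G A, degIn G w (attached G A) = 0 := by
    intro w hw
    simp only [degIn, Finset.card_eq_zero, Finset.filter_eq_empty_iff]
    exact fun u hu => h.symm.not_adj_attached hk hfree hw hu
  have hcov : ∀ w, degIn G w Finset.univ ≤ degIn G w A + degIn G w B + ((A ∪ B)ᶜ).card := by
    intro w
    have h1 := degIn_add_sdiff G w (Finset.subset_univ (A ∪ B))
    have h2 := degIn_union_le G w A B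
    have h3 := degIn_le_card G w (Finset.univ \ (A ∪ B))
    rw [Finset.compl_eq_univ_sdiff]
    omega
  have hRsub : (attached G B ∪ attached G A)ᶜ ⊆ (A ∪ B)ᶜ :=
    Finset.compl_subset_compl.2 (Finset.union_subset_union hA0 hB0)
  have hrD := Finset.card_le_card hRsub
  have hRdeg : ∀ w ∈ (attached G B ∪ attached G A)ᶜ,
      degIn G w Finset.univ ≤ ((A ∪ B)ᶜ).card + 2 := by
    intro w hw
    simp only [Finset.mem_compl, Finset.mem_union, mem_attached, not_or, not_le] at hw
    have := hcov w
    omega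
  have hD : ((A ∪ B)ᶜ).card + A.card + B.card = Fintype.card V := by
    rw [add_assoc, ← Finset.card_union_of_disjoint h.disj]
    exact Finset.card_compl_add_card _
  have hr : ((attached G B ∪ attached G A)ᶜ).card + (attached G B).card + (attached G A).card
      = Fintype.card V := by
    rw [add_assoc, ← Finset.card_union_of_disjoint hdisj]
    exact Finset.card_compl_add_card _
  have htot := sum_degIn_univ G
  set n := Fintype.card V
  set e := G.edgeFinset.card
  set P := attached G B
  set Q := attached G A
  set R := (P ∪ Q)ᶜ with hRdef
  have hdeg : ∀ w, degIn G w Finset.univ ≤ degIn G w P + degIn G w Q + degIn G w R := by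
    intro w
    have h1 := degIn_add_sdiff G w (Finset.subset_univ (P ∪ Q))
    have h2 := degIn_union_le G w P Q
    rw [← Finset.compl_eq_univ_sdiff, ← hRdef] at h1
    omega
  have hsplit : ∑ w, degIn G w Finset.univ = ∑ w ∈ P, degIn G w Finset.univ
      + ∑ w ∈ Q, degIn G w Finset.univ + ∑ w ∈ R, degIn G w Finset.univ := by
    rw [← Finset.sum_union hdisj, Finset.sum_add_sum_compl]
  have hcomm : ∑ w ∈ R, degIn G w Finset.univ =
      ∑ w ∈ P, degIn G w R + ∑ w ∈ Q, degIn G w R + ∑ w ∈ R, degIn G w R := by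
    rw [sum_degIn_comm, ← Finset.sum_union hdisj, Finset.sum_add_sum_compl]
  have hout : ∑ w ∈ R, degIn G w Finset.univ ≤ R.card * (((A ∪ B)ᶜ).card + 2) := by
    rw [← smul_eq_mul]
    exact Finset.sum_le_card_nsmul _ _ _ hRdeg
  have hPs := Finset.sum_le_sum (s := P) fun w _ => hdeg w
  have hQs := Finset.sum_le_sum (s := Q) fun w _ => hdeg w
  simp only [Finset.sum_add_distrib] at hPs hQs
  rw [Finset.sum_eq_zero hindA] at hPs
  rw [Finset.sum_eq_zero hindB] at hQs
  have hEcomm := sum_degIn_comm G P Q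
  set E := ∑ a ∈ P, degIn G a Q
  set D := ((A ∪ B)ᶜ).card
  set r := R.card
  set p := P.card
  set q := Q.card
  have h2e : e ≤ E + r * (D + 2) := by omega
  have h4 := four_mul_le_sq_add p q
  have h5 : 4 * (p * q) + 2 * r * n ≤ n ^ 2 + r ^ 2 := by
    rw [← hr]
    nlinarith
  have h6 : r * (7 * r + 28 * D + 56 + 2 * n) ≤ r * (14 * n) :=
    Nat.mul_le_mul_left _ (by omega)
  nlinarith

/-- A dense `C_{2k+1}`-free graph contains a core missing only `14 * t` vertices and at most
`t * n` of the edges between its two classes. -/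
lemma CycleFree.exists_large_core {k t : ℕ} (hk : 2 ≤ k) (ht : 1 ≤ t)
    (hn : 318 * (t * k) ≤ Fintype.card V) (hfree : CycleFree G (2 * k + 1))
    (he : Fintype.card V ^ 2 ≤ 4 * G.edgeFinset.card + 4 * t * Fintype.card V) :
    ∃ A B : Finset V, IsCore G A B (Fintype.card V / 7) (2 * k) ∧
      Fintype.card V ≤ A.card + B.card + 14 * t ∧
      ∀ P ⊆ A, ∀ Q ⊆ B, t * Fintype.card V < P.card * Q.card → ∃ p ∈ P, ∃ q ∈ Q, G.Adj p q := by
  obtain ⟨A₀, B₀, h, hA0, hB0, hsize⟩ := hfree.exists_core hk ht hn he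
  have hkt : k ≤ t * k := by nlinarith
  have hcount := h.card_attached_le (t := t) hk (by omega) hfree he hsize
  have hdisj := h.disjoint_attached hk hfree
  have hA1 := Finset.card_le_card (h.subset_attached (by omega))
  have hB1 := Finset.card_le_card (h.symm.subset_attached (by omega))
  have hr : ((attached G B₀ ∪ attached G A₀)ᶜ).card + (attached G B₀).card + (attached G A₀).card
      = Fintype.card V := by
    rw [add_assoc, ← Finset.card_union_of_disjoint hdisj]
    exact Finset.card_compl_add_card _
  set n := Fintype.card V
  have hn0 : 0 < n := by omega
  have htk : 2 * t ≤ t * k := by nlinarith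
  set A := attached G B₀
  set B := attached G A₀
  have hA := card_sdiff_trim (G := G) A B (n / 7)
  have hB := card_sdiff_trim (G := G) B A (n / 7)
  rw [← sum_degIn_comm] at hB
  have hA' := Finset.card_sdiff_add_card_eq_card (trim_subset (G := G) A B (n / 7))
  have hB' := Finset.card_sdiff_add_card_eq_card (trim_subset (G := G) B A (n / 7))
  have hβ : n ≤ 7 * (n / 7 + 1) := by omega
  set β := n / 7 with hβdef
  set a := A.card
  set b := B.card
  set E := ∑ a ∈ A, degIn G a B
  obtain ⟨hlost, hmiss⟩ := loss_bounds hn0 hβ hA hB hcount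
  refine ⟨trim G A B β, trim G B A β, isCore_trim hdisj (by omega) (by omega), by omega, ?_⟩
  intro P hP Q hQ hPQ
  by_contra! hno
  have hPA := hP.trans (trim_subset _ _ _)
  have hQB := hQ.trans (trim_subset _ _ _)
  have h1 : ∑ a ∈ A, degIn G a B + P.card * Q.card ≤ A.card * B.card := by
    rw [← smul_eq_mul A.card, ← Finset.sum_const, ← smul_eq_mul P.card, ← Finset.sum_const,
      ← Finset.sum_sdiff hPA, ← Finset.sum_sdiff (f := fun _ => B.card) hPA, add_assoc,
      ← Finset.sum_add_distrib]
    refine add_le_add (Finset.sum_le_sum fun a _ => degIn_le_card G a B)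
      (Finset.sum_le_sum fun a ha => ?_)
    have h2 := degIn_add_sdiff G a hQB
    have h3 := degIn_le_card G a (B \ Q)
    have h4 := Finset.card_sdiff_add_card_eq_card hQB
    have h5 : degIn G a Q = 0 := by
      simp only [degIn, Finset.card_eq_zero, Finset.filter_eq_empty_iff]
      exact fun u hu => hno a ha u hu
    omega
  exact absurd (h1.trans hmiss) (by omega)

end Structure

section OddCycle

variable {V : Type*} {G : SimpleGraph V}

/-- A walk visiting a vertex twice splits into a closed walk and a shorter walk. -/
lemma exists_walk_split {u v : V} (w : G.Walk u v) {i j : ℕ} (hij : i ≤ j) (hj : j ≤ w.length)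
    (h : w.getVert i = w.getVert j) :
    ∃ (q : G.Walk (w.getVert i) (w.getVert i)) (r : G.Walk u v),
      q.length = j - i ∧ r.length + (j - i) = w.length := by
  refine ⟨((w.drop i).take (j - i)).copy rfl ?_, (w.take i).append ((w.drop j).copy h.symm rfl),
    ?_, ?_⟩
  · rw [SimpleGraph.Walk.drop_getVert, Nat.add_sub_cancel' hij, h]
  · simp
    omega
  · simp
    omega

/-- Every odd closed walk contains an odd cycle that is not longer. -/
lemma exists_odd_cycle_length_le {v : V} (w : G.Walk v v) (hw : Odd w.length) :
    ∃ (u : V) (d : G.Walk u u), d.IsCycle ∧ Odd d.length ∧ d.length ≤ w.length := by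
  induction hm : w.length using Nat.strong_induction_on generalizing v with
  | _ m ih =>
    by_cases hcyc : w.IsCycle
    · exact ⟨v, w, hcyc, hw, hm.le⟩
    cases w with
    | nil => simp at hw
    | cons hadj p =>
      by_cases hp : p.IsPath
      · rw [SimpleGraph.Walk.cons_isCycle_iff] at hcyc
        simp only [hp, true_and, not_not] at hcyc
        have h1 := hp.length_eq_one_of_mem_edges (Sym2.eq_swap ▸ hcyc)
        rw [SimpleGraph.Walk.length_cons, h1] at hw
        exact absurd hw (by decide)
      · rw [← SimpleGraph.Walk.IsPath.getVert_injOn_iff] at hp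
        obtain ⟨i, j, hij, hj, h⟩ : ∃ i j, i < j ∧ j ≤ p.length ∧ p.getVert i = p.getVert j := by
          simp only [Set.InjOn, Set.mem_ofPred_eq, not_forall] at hp
          obtain ⟨i, hi, j, hj, h, hne⟩ := hp
          rcases lt_or_gt_of_ne hne with hlt | hlt
          · exact ⟨i, j, hlt, hj, h⟩
          · exact ⟨j, i, hlt, hi, h.symm⟩
        obtain ⟨q, r, hq, hr⟩ := exists_walk_split p hij.le hj h
        rw [SimpleGraph.Walk.length_cons] at hm hw
        rcases Nat.even_or_odd q.length with he | ho
        · have hodd : Odd (SimpleGraph.Walk.cons hadj r).length := by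
            rw [SimpleGraph.Walk.length_cons]
            grind
          obtain ⟨u, d, h1, h2, h3⟩ := ih _ (by rw [SimpleGraph.Walk.length_cons]; omega) _ hodd rfl
          rw [SimpleGraph.Walk.length_cons] at h3
          exact ⟨u, d, h1, h2, by omega⟩
        · obtain ⟨u, d, h1, h2, h3⟩ := ih _ (by omega) q ho rfl
          exact ⟨u, d, h1, h2, by omega⟩

lemma exists_walk_getVert {u v : V} (w : G.Walk u v) {i j : ℕ} (hij : i ≤ j) (hj : j ≤ w.length) :
    ∃ q : G.Walk (w.getVert i) (w.getVert j), q.length = j - i := by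
  refine ⟨((w.drop i).take (j - i)).copy rfl ?_, ?_⟩
  · rw [SimpleGraph.Walk.drop_getVert, Nat.add_sub_cancel' hij]
  · simp
    omega

lemma exists_getVert_lt_of_mem_support {v x : V} {c : G.Walk v v} (hc : 0 < c.length)
    (hx : x ∈ c.support) : ∃ i < c.length, c.getVert i = x := by
  obtain ⟨i, hi, hle⟩ := SimpleGraph.Walk.mem_support_iff_exists_getVert.1 hx
  rcases hle.lt_or_eq with h | h
  · exact ⟨i, h, hi⟩
  · refine ⟨0, hc, ?_⟩
    rw [← hi, h, SimpleGraph.Walk.getVert_zero, SimpleGraph.Walk.getVert_length]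

/-- A vertex has at most two neighbours on a shortest odd cycle of length at least five. -/
lemma not_three_adj_of_shortest_odd {v : V} {c : G.Walk v v} (hodd : Odd c.length)
    (h5 : 5 ≤ c.length) (hmin : ∀ (u : V) (d : G.Walk u u), Odd d.length → c.length ≤ d.length)
    (w : V) {x y z : V} (hx : x ∈ c.support) (hy : y ∈ c.support) (hz : z ∈ c.support)
    (hxy : x ≠ y) (hxz : x ≠ z) (hyz : y ≠ z) (hwx : G.Adj w x) (hwy : G.Adj w y)
    (hwz : G.Adj w z) : False := by
  have key : ∀ {i j l : ℕ}, i < j → j < l → l < c.length → G.Adj w (c.getVert i) →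
      G.Adj w (c.getVert j) → G.Adj w (c.getVert l) → False := by
    intro i j l hij hjl hl hi hj hl'
    obtain ⟨q₁, h₁⟩ := exists_walk_getVert c hij.le (by omega)
    obtain ⟨q₂, h₂⟩ := exists_walk_getVert c hjl.le (by omega)
    have m₁ := hmin w (.cons hi (q₁.concat hj.symm))
    have m₂ := hmin w (.cons hj (q₂.concat hl'.symm))
    have m₃ := hmin w (.cons hl' (((c.drop l).append (c.take i)).concat hi.symm))
    simp only [SimpleGraph.Walk.length_cons, SimpleGraph.Walk.length_concat,
      SimpleGraph.Walk.length_append, SimpleGraph.Walk.drop_length, SimpleGraph.Walk.take_length,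
      h₁, h₂, Nat.odd_iff] at m₁ m₂ m₃ hodd
    have : min i c.length = i := by omega
    omega
  obtain ⟨i, hi, rfl⟩ := exists_getVert_lt_of_mem_support (by omega) hx
  obtain ⟨j, hj, rfl⟩ := exists_getVert_lt_of_mem_support (by omega) hy
  obtain ⟨l, hl, rfl⟩ := exists_getVert_lt_of_mem_support (by omega) hz
  have hij : i ≠ j := fun e => hxy (by rw [e])
  have hil : i ≠ l := fun e => hxz (by rw [e])
  have hjl : j ≠ l := fun e => hyz (by rw [e])
  rcases lt_or_gt_of_ne hij with h1 | h1 <;> rcases lt_or_gt_of_ne hil with h2 | h2 <;>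
    rcases lt_or_gt_of_ne hjl with h3 | h3
  · exact key h1 h3 hl hwx hwy hwz
  · exact key h2 h3 hj hwx hwz hwy
  · omega
  · exact key h2 h1 hj hwz hwx hwy
  · exact key h1 h2 hl hwy hwx hwz
  · omega
  · exact key h3 h2 hi hwy hwz hwx
  · exact key h3 h1 hi hwz hwy hwx

lemma exists_support_eq {x y : V} (p : G.Walk x y) (hxy : x ≠ y) :
    ∃ m : List V, m.length + 1 = p.length ∧ p.support = x :: (m ++ [y]) := by
  cases p with
  | nil => exact absurd rfl hxy
  | cons h q =>
    have hq := List.dropLast_append_getLast q.support_ne_nil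
    rw [SimpleGraph.Walk.getLast_support] at hq
    refine ⟨q.support.dropLast, ?_, ?_⟩
    · simp
    · rw [SimpleGraph.Walk.support_cons, hq]

/-- Two vertices of an odd cycle are joined by arcs of both parities. -/
lemma exists_arc [DecidableEq V] {v : V} {c : G.Walk v v} (hc : c.IsCycle) (hodd : Odd c.length)
    {x y : V} (hx : x ∈ c.support) (hy : y ∈ c.support) (hxy : x ≠ y) {r : ℕ} (hr : r < 2) :
    ∃ m : List V, m.length % 2 = r ∧ m.length + 2 ≤ c.length ∧ (x :: (m ++ [y])).Nodup ∧
      (x :: (m ++ [y])).IsChain G.Adj ∧ ∀ z ∈ m, z ∈ c.support := by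
  have hc' := hc.rotate hx
  have hlen : (c.rotate x hx).length = c.length := by simp
  have hmem : ∀ z, z ∈ (c.rotate x hx).support ↔ z ∈ c.support := by simp
  generalize c.rotate x hx = d at hc' hlen hmem
  have hy' := (hmem y).2 hy
  simp only [← hmem]
  have hspec := d.take_spec hy'
  have hnil : ¬ (d.takeUntil y hy').Nil := SimpleGraph.Walk.not_nil_of_ne hxy
  have hpath : (d.dropUntil y hy').IsPath := SimpleGraph.Walk.IsCycle.isPath_of_append_right hnil
    (hspec.symm ▸ hc')
  obtain ⟨m₁, h1, h2⟩ := exists_support_eq (d.takeUntil y hy') hxy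
  obtain ⟨m₂, h3, h4⟩ := exists_support_eq (d.dropUntil y hy').reverse hxy
  have hl := congrArg SimpleGraph.Walk.length hspec
  rw [SimpleGraph.Walk.length_append] at hl
  rw [SimpleGraph.Walk.length_reverse] at h3
  have hm1 : ∀ z ∈ m₁, z ∈ d.support := fun z hz =>
    d.support_takeUntil_subset_support hy' (by rw [h2]; simp [hz])
  have hm2 : ∀ z ∈ m₂, z ∈ d.support := fun z hz =>
    d.support_dropUntil_subset_support hy' (by
      rw [← List.mem_reverse, ← SimpleGraph.Walk.support_reverse, h4]; simp [hz])
  have hn1 := (hc'.isPath_takeUntil hy').support_nodup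
  have hn2 := hpath.reverse.support_nodup
  have hch1 := (d.takeUntil y hy').isChain_adj_support
  have hch2 := (d.dropUntil y hy').reverse.isChain_adj_support
  rw [h2] at hn1 hch1
  rw [h4] at hn2 hch2
  rw [Nat.odd_iff] at hodd
  by_cases hpar : m₁.length % 2 = r
  · exact ⟨m₁, hpar, by omega, hn1, hch1, hm1⟩
  · exact ⟨m₂, by omega, by omega, hn2, hch2, hm2⟩

end OddCycle

section Closing

variable {V : Type*} {G : SimpleGraph V}

/-- Two disjoint paths joined end to end form a cycle. -/
lemma CycleFree.false_of_two_paths {N : ℕ} (hfree : CycleFree G N) {x y p q : V} {m l : List V}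
    (h1 : (x :: (m ++ [y])).Nodup) (h2 : (x :: (m ++ [y])).IsChain G.Adj)
    (h3 : (q :: (l ++ [p])).Nodup) (h4 : (q :: (l ++ [p])).IsChain G.Adj)
    (hdisj : ∀ z ∈ q :: (l ++ [p]), z ∉ x :: (m ++ [y])) (hyq : G.Adj y q) (hpx : G.Adj p x)
    (hlen : m.length + l.length + 4 = N) : False := by
  refine hfree.false_of_list x ((m ++ [y]) ++ (q :: (l ++ [p]))) ?_ ?_ ?_
  · rw [← List.cons_append, List.nodup_append']
    exact ⟨h1, h3, fun z hz hz' => hdisj z hz' hz⟩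
  · simp only [List.length_cons, List.length_append, List.length_nil]
    omega
  · have h5 : (q :: (l ++ [p]) ++ [x]).IsChain G.Adj := by
      rw [List.isChain_append]
      refine ⟨h4, by simp, ?_⟩
      rw [← List.cons_append, List.getLast?_append]
      simpa using hpx
    rw [List.append_assoc, ← List.cons_append, List.isChain_append]
    refine ⟨h2, h5, ?_⟩
    rw [← List.cons_append, List.getLast?_append]
    simpa using hyq

variable [DecidableEq V] [DecidableRel G.Adj] {A B : Finset V} {β k : ℕ}

/-- A path of even length at most `2 * k - 2` cannot have both endpoints adjacent to the same
class of a core. -/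
lemma IsCore.false_of_even (h : IsCore G A B β (2 * k)) (hfree : CycleFree G (2 * k + 1))
    {x y p q : V} {m : List V} (h1 : (x :: (m ++ [y])).Nodup)
    (h2 : (x :: (m ++ [y])).IsChain G.Adj) (hm : m.length % 2 = 0) (hmk : m.length + 4 ≤ 2 * k)
    (hp : p ∈ B) (hq : q ∈ B) (hpq : p ≠ q) (hxp : G.Adj x p) (hyq : G.Adj y q)
    (hp' : p ∉ x :: (m ++ [y])) (hq' : q ∉ x :: (m ++ [y])) : False := by
  obtain ⟨l, hl1, hl2, hl3, hl4⟩ := h.even_path ((2 * k - 4 - m.length) / 2) hq hp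
    (q :: p :: x :: (m ++ [y])).toFinset (by simp) (by simp) (by
      have := List.toFinset_card_le (q :: p :: x :: (m ++ [y]))
      simp only [List.length_cons, List.length_append, List.length_nil] at this
      omega)
  refine hfree.false_of_two_paths h1 h2 ?_ hl4 ?_ hyq hxp.symm (by omega)
  · simp only [List.mem_toFinset] at hl3
    grind
  · simp only [List.mem_toFinset] at hl3
    grind

/-- A path of odd length at most `2 * k - 3` cannot have its endpoints adjacent to different
classes of a core. -/
lemma IsCore.false_of_odd (h : IsCore G A B β (2 * k)) (hfree : CycleFree G (2 * k + 1))
    {x y p q : V} {m : List V} (h1 : (x :: (m ++ [y])).Nodup)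
    (h2 : (x :: (m ++ [y])).IsChain G.Adj) (hm : m.length % 2 = 1) (hmk : m.length + 5 ≤ 2 * k)
    (hp : p ∈ B) (hq : q ∈ A) (hxp : G.Adj x p) (hyq : G.Adj y q)
    (hp' : p ∉ x :: (m ++ [y])) (hq' : q ∉ x :: (m ++ [y])) : False := by
  have hpq : p ≠ q := fun e => Finset.disjoint_left.1 h.disj hq (e ▸ hp)
  obtain ⟨l, hl1, hl2, hl3, hl4⟩ := h.odd_path ((2 * k - 5 - m.length) / 2) hq hp
    (q :: p :: x :: (m ++ [y])).toFinset (by simp) (by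
      have := List.toFinset_card_le (q :: p :: x :: (m ++ [y]))
      simp only [List.length_cons, List.length_append, List.length_nil] at this
      omega)
  refine hfree.false_of_two_paths h1 h2 ?_ hl4 ?_ hyq hxp.symm (by omega)
  · simp only [List.mem_toFinset] at hl3
    grind
  · simp only [List.mem_toFinset] at hl3
    grind

variable [Fintype V]

lemma degree_add_le {x : V} (hd : Disjoint A B) :
    G.degree x + (A.card + B.card) ≤ degIn G x A + degIn G x B + Fintype.card V := by
  have h1 := degIn_add_sdiff G x (Finset.subset_univ (A ∪ B))
  have h2 := degIn_union_le G x A B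
  have h3 := degIn_le_card G x (Finset.univ \ (A ∪ B))
  have h4 := Finset.card_sdiff_add_card_eq_card (Finset.subset_univ (A ∪ B))
  rw [Finset.card_union_of_disjoint hd, Finset.card_univ] at h4
  rw [degIn_univ] at h1
  omega

lemma IsCore.mem_attached_or (h : IsCore G A B β (2 * k)) {x : V}
    (hx : Fintype.card V + 3 ≤ G.degree x + (A.card + B.card)) :
    x ∈ attached G B ∨ x ∈ attached G A := by
  have := degree_add_le (G := G) (x := x) h.disj
  rw [mem_attached, mem_attached]
  omega

lemma IsCore.degree_lt_of_mem_attached (h : IsCore G A B β (2 * k)) (hk : 2 ≤ k)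
    (hfree : CycleFree G (2 * k + 1)) {t : ℕ} (ht : 1 ≤ t)
    (hmiss : Fintype.card V ≤ A.card + B.card + 14 * t) {x : V} (hx : x ∈ attached G B)
    (hdeg : 50 * t ≤ G.degree x) {S : Finset V} (hS : degIn G x S ≤ 2) :
    G.degree x < 2 * (B.filter (G.Adj x) \ S).card := by
  have h1 := degree_add_le (G := G) (x := x) h.disj
  have h2 : degIn G x A = 0 := by
    simp only [degIn, Finset.card_eq_zero, Finset.filter_eq_empty_iff]
    exact fun u hu => h.not_adj_attached hk hfree hx (h.subset_attached (by omega) hu)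
  have h3 : degIn G x B ≤ (B.filter (G.Adj x) \ S).card + degIn G x S := by
    refine (Finset.card_le_card fun z hz => ?_).trans (Finset.card_union_le _ _)
    by_cases hzS : z ∈ S
    · exact Finset.mem_union_right _ (Finset.mem_filter.2 ⟨hzS, (Finset.mem_filter.1 hz).2⟩)
    · exact Finset.mem_union_left _ (Finset.mem_sdiff.2 ⟨hz, hzS⟩)
  omega

/-- Two vertices of large degree, one of them attached to `B`, cannot be joined by arcs of both
parities on a cycle of length at most `2 * k - 1`. -/
lemma IsCore.false_of_arcs (h : IsCore G A B β (2 * k)) (hk : 2 ≤ k)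
    (hfree : CycleFree G (2 * k + 1)) {t L : ℕ} (ht : 1 ≤ t)
    (hmiss : Fintype.card V ≤ A.card + B.card + 14 * t)
    (hadj : ∀ P ⊆ A, ∀ Q ⊆ B, t * Fintype.card V < P.card * Q.card → ∃ p ∈ P, ∃ q ∈ Q, G.Adj p q)
    {x y : V} {S : Finset V} (hxS : x ∈ S) (hyS : y ∈ S) (hL : L + 1 ≤ 2 * k)
    (harc : ∀ r < 2, ∃ m : List V, m.length % 2 = r ∧ m.length + 2 ≤ L ∧
      (x :: (m ++ [y])).Nodup ∧ (x :: (m ++ [y])).IsChain G.Adj ∧ ∀ z ∈ m, z ∈ S)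
    (hdx : 50 * t ≤ G.degree x) (hdy : 50 * t ≤ G.degree y)
    (hxy : 4 * (t * Fintype.card V) ≤ G.degree x * G.degree y)
    (hx2 : degIn G x S ≤ 2) (hy2 : degIn G y S ≤ 2) (hx : x ∈ attached G B) : False := by
  have hPx := h.degree_lt_of_mem_attached hk hfree ht hmiss hx hdx hx2
  set P := B.filter (G.Adj x) \ S with hP
  have hmemP : ∀ p ∈ P, p ∈ B ∧ G.Adj x p ∧ p ∉ S := fun p hp => by
    simpa [hP, and_assoc] using hp
  rcases h.mem_attached_or (x := y) (by omega) with hy | hy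
  · have hPy := h.degree_lt_of_mem_attached hk hfree ht hmiss hy hdy hy2
    obtain ⟨p, hp⟩ : P.Nonempty := Finset.card_pos.1 (by omega)
    obtain ⟨q, hq, hqp⟩ := Finset.exists_mem_notMem_of_card_lt_card
      (s := {p}) (t := B.filter (G.Adj y) \ S) (by rw [Finset.card_singleton]; omega)
    simp only [Finset.mem_sdiff, Finset.mem_filter, Finset.mem_singleton] at hq hqp
    obtain ⟨hpB, hxp, hpS⟩ := hmemP p hp
    obtain ⟨m, hm1, hm2, hm3, hm4, hm5⟩ := harc 0 (by omega)
    exact h.false_of_even hfree hm3 hm4 hm1 (by omega) hpB hq.1.1 (Ne.symm hqp) hxp hq.1.2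
      (by grind) (by grind)
  · have hPy := h.symm.degree_lt_of_mem_attached hk hfree ht (by omega) hy hdy hy2
    set Q := A.filter (G.Adj y) \ S with hQ
    have hmemQ : ∀ q ∈ Q, q ∈ A ∧ G.Adj y q ∧ q ∉ S := fun q hq => by
      simpa [hQ, and_assoc] using hq
    obtain ⟨q, hq, p, hp, hqp⟩ := hadj Q (fun q hq => (hmemQ q hq).1) P
      (fun p hp => (hmemP p hp).1) (by
        have h1 : (G.degree x + 1) * (G.degree y + 1) ≤ (2 * P.card) * (2 * Q.card) :=
          Nat.mul_le_mul hPx hPy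
        linarith)
    obtain ⟨hpB, hxp, hpS⟩ := hmemP p hp
    obtain ⟨hqA, hyq, hqS⟩ := hmemQ q hq
    obtain ⟨m, hm1, hm2, hm3, hm4, hm5⟩ := harc 1 (by omega)
    by_cases hmk : m.length + 5 ≤ 2 * k
    · exact h.false_of_odd hfree hm3 hm4 hm1 hmk hpB hqA hxp hyq (by grind) (by grind)
    · refine hfree.false_of_two_paths (l := []) hm3 hm4 ?_ ?_ ?_ hyq hxp.symm ?_
      · simpa using hqp.ne
      · simpa using hqp
      · grind
      · simp only [List.length_nil]
        omega

/-- Edge count in terms of an induced triangle-free subgraph and a set in which its vertices have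
at most two neighbours. -/
lemma card_edgeFinset_le_of_sparse_set {S U : Finset V} {n : ℕ} (hSU : S ⊆ U)
    (h2 : ∀ w ∈ U, degIn G w S ≤ 2)
    (htri : ∀ a ∈ U, ∀ b ∈ U, ∀ c ∈ U, G.Adj a b → G.Adj b c → G.Adj c a → False)
    (hlow : ∀ w ∉ U, 12 * G.degree w ≤ n) :
    12 * G.edgeFinset.card ≤
      Uᶜ.card * n + 12 * S.card + 24 * (U \ S).card + 3 * (U \ S).card ^ 2 := by
  have h0 := sum_degIn_univ G
  rw [← Finset.sum_add_sum_compl U] at h0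
  have h1 : ∀ w ∈ U, degIn G w Finset.univ = degIn G w S + degIn G w (U \ S) + degIn G w Uᶜ := by
    intro w _
    rw [degIn_add_sdiff G w hSU, Finset.compl_eq_univ_sdiff,
      degIn_add_sdiff G w (Finset.subset_univ U)]
  rw [Finset.sum_congr rfl h1, Finset.sum_add_distrib, Finset.sum_add_distrib, sum_degIn_comm G U Uᶜ,
    sum_degIn_comm G U (U \ S), ← Finset.sum_sdiff hSU] at h0
  have h3 : ∀ w ∈ U \ S, degIn G w U = degIn G w S + degIn G w (U \ S) :=
    fun w _ => (degIn_add_sdiff G w hSU).symm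
  rw [Finset.sum_congr rfl h3, Finset.sum_add_distrib] at h0
  have h4 : ∑ w ∈ Uᶜ, degIn G w U ≤ ∑ w ∈ Uᶜ, degIn G w Finset.univ :=
    Finset.sum_le_sum fun w _ => degIn_mono G w (Finset.subset_univ U)
  have h5 : ∑ w ∈ Uᶜ, 12 * degIn G w Finset.univ ≤ Uᶜ.card * n := by
    rw [← smul_eq_mul]
    refine Finset.sum_le_card_nsmul _ _ _ fun w hw => ?_
    rw [degIn_univ]
    exact hlow w (Finset.mem_compl.1 hw)
  rw [← Finset.mul_sum] at h5
  have h6 : ∑ w ∈ S, degIn G w S ≤ S.card * 2 := by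
    rw [← smul_eq_mul]
    exact Finset.sum_le_card_nsmul _ _ _ fun w hw => h2 w (hSU hw)
  have h7 : ∑ w ∈ U \ S, degIn G w S ≤ (U \ S).card * 2 := by
    rw [← smul_eq_mul]
    exact Finset.sum_le_card_nsmul _ _ _ fun w hw => h2 w (Finset.sdiff_subset hw)
  have hsub := Finset.sdiff_subset (s := U) (t := S)
  have h8 := two_mul_sum_degIn_le_of_triangleFree (G := G) (U \ S) fun a ha b hb c hc =>
    htri a (hsub ha) b (hsub hb) c (hsub hc)
  omega

end Closing

lemma lt_of_long_cycle {n t L b M e : ℕ} (hn : 636 * t ≤ n) (ht : 1 ≤ t) (hsum : b + M + L = n)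
    (hL : t + 5 ≤ L) (he : 12 * e ≤ b * n + 12 * L + 24 * M + 3 * M ^ 2) :
    e < (n - t - 1) ^ 2 / 4 + (t + 2).choose 2 := by
  obtain ⟨z, rfl⟩ : ∃ z, n = z + (t + 1) := ⟨n - (t + 1), by omega⟩
  obtain ⟨s, rfl⟩ : ∃ s, L = t + 5 + s := ⟨L - (t + 5), by omega⟩
  obtain rfl : z = b + M + s + 4 := by omega
  have hc : 2 * (t + 2).choose 2 = (t + 2) * (t + 1) := by
    rw [Nat.choose_two_right, Nat.mul_div_cancel' (Nat.even_mul_pred_self _).two_dvd]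
    simp
  have hz : b + M + s + 4 + (t + 1) - t - 1 = b + M + s + 4 := by omega
  rw [hz]
  have h4 : (b + M + s + 4) ^ 2 < 4 * ((b + M + s + 4) ^ 2 / 4) + 4 := by omega
  by_contra! hcon
  have h5 : 3 * (b + M + s + 4) ^ 2 + 6 * ((t + 2) * (t + 1)) ≤ 12 * e + 9 := by omega
  have h6 : b * (636 * t) ≤ b * (b + M + s + 4 + (t + 1)) := Nat.mul_le_mul_left _ hn
  have h7 : 0 ≤ s * M := Nat.zero_le _
  have h8 : 0 ≤ b * M := Nat.zero_le _
  have h9 : 0 ≤ b * s := Nat.zero_le _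
  have h10 : b * 1 ≤ b * t := Nat.mul_le_mul_left _ ht
  have h11 : t * 1 ≤ t * t := Nat.mul_le_mul_left _ ht
  nlinarith

lemma twelve_mul_le_of_lt_sqrt {d t k n : ℕ} (hk : 2 ≤ k) (ht : 1 ≤ t) (hn : 318 * t ^ 2 * k ≤ n)
    (h : (d : ℝ) < 2 * Real.sqrt (t * n)) : 12 * d ≤ n := by
  have h1 : (d : ℝ) ^ 2 < 4 * (t * n) := by
    have := pow_lt_pow_left₀ h (Nat.cast_nonneg d) two_ne_zero
    rwa [mul_pow, Real.sq_sqrt (by positivity), show (2 : ℝ) ^ 2 = 4 by norm_num] at this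
  have h2 : d ^ 2 < 4 * (t * n) := by exact_mod_cast h1
  have h3 : 636 * t ≤ n := by nlinarith
  have h4 : 636 * t * n ≤ n * n := Nat.mul_le_mul_right _ h3
  nlinarith

lemma sq_le_mul_of_sqrt_le {d d' t n : ℕ} (h : 2 * Real.sqrt (t * n) ≤ d)
    (h' : 2 * Real.sqrt (t * n) ≤ d') : 4 * (t * n) ≤ d * d' := by
  have h1 := mul_le_mul h h' (by positivity) (by positivity)
  rw [mul_mul_mul_comm, Real.mul_self_sqrt (by positivity)] at h1
  have h2 : 2 * 2 * (t * n) ≤ d * d' := by exact_mod_cast h1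
  omega

lemma fifty_mul_le_of_sqrt_le {d t k n : ℕ} (hk : 2 ≤ k) (ht : 1 ≤ t) (hn : 318 * t ^ 2 * k ≤ n)
    (h : 2 * Real.sqrt (t * n) ≤ d) : 50 * t ≤ d := by
  have h1 := sq_le_mul_of_sqrt_le h h
  have h3 : 636 * t ≤ n := by nlinarith
  nlinarith

lemma sq_le_of_edges {n t e : ℕ} (hn : 636 * t ≤ n) (ht : 1 ≤ t)
    (h : (n - t - 1) ^ 2 / 4 + (t + 2).choose 2 ≤ e) : n ^ 2 ≤ 4 * e + 4 * t * n := by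
  obtain ⟨z, rfl⟩ : ∃ z, n = z + (t + 1) := ⟨n - (t + 1), by omega⟩
  have hc : 2 * (t + 2).choose 2 = (t + 2) * (t + 1) := by
    rw [Nat.choose_two_right, Nat.mul_div_cancel' (Nat.even_mul_pred_self _).two_dvd]
    simp
  rw [show z + (t + 1) - t - 1 = z by omega] at h
  have h1 : z ^ 2 + 2 * ((t + 2) * (t + 1)) ≤ 4 * e + 3 := by omega
  nlinarith

section Induced

variable {V : Type*} [Fintype V] [DecidableEq V] {G : SimpleGraph V} [DecidableRel G.Adj]

omit [Fintype V] in
/-- A vertex of an induced subgraph has at most two neighbours on a shortest odd cycle of it, when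
that cycle has length at least five. -/
lemma degIn_support_le_two {s : Set V} {v : s} {c : (G.induce s).Walk v v}
    (hodd : Odd c.length) (h5 : 5 ≤ c.length)
    (hmin : ∀ (u : s) (d : (G.induce s).Walk u u), Odd d.length → c.length ≤ d.length)
    {w : V} (hw : w ∈ s) : degIn G w (c.support.map Subtype.val).toFinset ≤ 2 := by
  by_contra! hcon
  obtain ⟨x, hx, y, hy, z, hz, hxy, hxz, hyz⟩ := Finset.two_lt_card.1 hcon
  simp only [Finset.mem_filter, List.mem_toFinset, List.mem_map] at hx hy hz
  obtain ⟨⟨x, hx, rfl⟩, hwx⟩ := hx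
  obtain ⟨⟨y, hy, rfl⟩, hwy⟩ := hy
  obtain ⟨⟨z, hz, rfl⟩, hwz⟩ := hz
  exact not_three_adj_of_shortest_odd hodd h5 hmin ⟨w, hw⟩ hx hy hz (fun e => hxy (by rw [e]))
    (fun e => hxz (by rw [e])) (fun e => hyz (by rw [e])) hwx hwy hwz

omit [Fintype V] [DecidableRel G.Adj] in
lemma card_support_toFinset {v : V} {c : G.Walk v v} (hc : c.IsCycle) :
    c.support.toFinset.card = c.length := by
  have h : c.support.toFinset = c.support.tail.toFinset := by
    ext z
    simp only [List.mem_toFinset]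
    refine ⟨fun hz => ?_, List.mem_of_mem_tail⟩
    rcases (c.mem_support_iff).1 hz with rfl | hz
    · exact c.end_mem_tail_support hc.not_nil
    · exact hz
  rw [h, List.toFinset_card_of_nodup hc.support_nodup, List.length_tail, c.length_support]
  omega

end Induced

/-- Claim: let `G` be a `C_{2k+1}`-free graph on `n ≥ 318t²k` vertices with
`e(G) ≥ ⌊(n-t-1)²/4⌋ + C(t+2,2)` and let `B'` be a set of vertices of degree less than
`2√(tn)`.  If `G - B'` is not bipartite and `C` is a shortest odd cycle of `G - B'`, then `C`
contains at most one vertex of degree at least `2√(tn)` in `G` (expressed by saying that any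
two such vertices on `C` coincide). -/
theorem stmt15 {V : Type*} [Fintype V] (G : SimpleGraph V) [DecidableRel G.Adj]
    (k n t : ℕ) (hk : 2 ≤ k) (ht1 : 1 ≤ t) (ht2 : t ≤ 2 * k - 2)
    (hn : 318 * t ^ 2 * k ≤ n)
    (hcard : Fintype.card V = n)
    (hfree : CycleFree G (2 * k + 1))
    (hedge : (n - t - 1) ^ 2 / 4 + (t + 2).choose 2 ≤ G.edgeFinset.card)
    (B' : Set V) (hB' : ∀ v ∈ B', (G.degree v : ℝ) < 2 * Real.sqrt (t * n))
    (hnonbip : ¬ (G.induce B'ᶜ).Colorable 2)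
    {v : (B'ᶜ : Set V)} (c : (G.induce B'ᶜ).Walk v v)
    (hc : c.IsCycle) (hodd : Odd c.length)
    (hmin : ∀ (u : (B'ᶜ : Set V)) (d : (G.induce B'ᶜ).Walk u u),
      d.IsCycle → Odd d.length → c.length ≤ d.length) :
    ∀ x ∈ c.support, ∀ y ∈ c.support,
      2 * Real.sqrt (t * n) ≤ (G.degree (x : V) : ℝ) →
      2 * Real.sqrt (t * n) ≤ (G.degree (y : V) : ℝ) → x = y := by
  classical
  have htk : t * k ≤ t ^ 2 * k := Nat.mul_le_mul_right _ (Nat.le_self_pow two_ne_zero t)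
  have hn' : 318 * (t * k) ≤ n := by linarith
  have hnt : 636 * t ≤ n := by nlinarith
  have he := sq_le_of_edges hnt ht1 hedge
  have hmin' : ∀ (u : (B'ᶜ : Set V)) (d : (G.induce B'ᶜ).Walk u u), Odd d.length →
      c.length ≤ d.length := by
    intro u d hd
    obtain ⟨u', d', h1, h2, h3⟩ := exists_odd_cycle_length_le d hd
    exact (hmin u' d' h1 h2).trans h3
  set f := (SimpleGraph.Embedding.induce (G := G) B'ᶜ).toHom with hf
  have hfinj : Function.Injective f := Subtype.val_injective
  have hcyc : (c.map f).IsCycle := hc.map hfinj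
  have hlen : (c.map f).length = c.length := c.length_map f
  have hsupp : (c.map f).support = c.support.map Subtype.val := c.support_map f
  set S := (c.support.map Subtype.val).toFinset with hS
  have hScard : S.card = c.length := by
    rw [hS, ← hsupp, card_support_toFinset hcyc, hlen]
  have hmemS : ∀ z : (B'ᶜ : Set V), z ∈ c.support → (z : V) ∈ S := by
    intro z hz
    rw [hS, List.mem_toFinset]
    exact List.mem_map_of_mem hz
  have hmemS' : ∀ z ∈ S, z ∈ (B'ᶜ : Set V) := by
    intro z hz
    rw [hS, List.mem_toFinset, List.mem_map] at hz
    obtain ⟨z, -, rfl⟩ := hz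
    exact z.2
  have h3 := hc.three_le_length
  have hdeg2 : ∀ w ∈ S, degIn G w S ≤ 2 := by
    intro w hw
    rcases (show c.length = 3 ∨ 5 ≤ c.length by rw [Nat.odd_iff] at hodd; omega) with h | h
    · have h1 : degIn G w S ≤ (S.erase w).card := by
        refine Finset.card_le_card fun z hz => ?_
        rw [Finset.mem_filter] at hz
        exact Finset.mem_erase.2 ⟨hz.2.ne', hz.1⟩
      rw [Finset.card_erase_of_mem hw] at h1
      omega
    · exact degIn_support_le_two hodd h hmin' (hmemS' w hw)
  intro x hx y hy hdx hdy
  by_contra hne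
  rcases lt_trichotomy c.length (2 * k + 1) with hL | hL | hL
  · subst hcard
    obtain ⟨A, B, h, hmiss, hadj⟩ := hfree.exists_large_core hk ht1 hn' he
    have hx50 := fifty_mul_le_of_sqrt_le hk ht1 hn hdx
    have hy50 := fifty_mul_le_of_sqrt_le hk ht1 hn hdy
    have hxy := sq_le_mul_of_sqrt_le hdx hdy
    have hL' : c.length + 1 ≤ 2 * k := by
      rw [Nat.odd_iff] at hodd
      omega
    have harc : ∀ r < 2, ∃ m : List V, m.length % 2 = r ∧ m.length + 2 ≤ c.length ∧
        ((x : V) :: (m ++ [(y : V)])).Nodup ∧ ((x : V) :: (m ++ [(y : V)])).IsChain G.Adj ∧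
        ∀ z ∈ m, z ∈ S := by
      intro r hr
      rw [hS, ← hsupp, ← hlen]
      simp only [List.mem_toFinset]
      refine exists_arc hcyc (hlen ▸ hodd) ?_ ?_ (fun e => hne (Subtype.ext e)) hr
      · rw [hsupp]
        exact List.mem_map_of_mem hx
      · rw [hsupp]
        exact List.mem_map_of_mem hy
    have hxS := hmemS x hx
    have hyS := hmemS y hy
    rcases h.mem_attached_or (x := (x : V)) (by omega) with hxB | hxA
    · exact h.false_of_arcs hk hfree ht1 hmiss hadj hxS hyS hL' harc hx50 hy50 hxy
        (hdeg2 _ hxS) (hdeg2 _ hyS) hxB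
    · refine h.symm.false_of_arcs hk hfree ht1 (by omega) ?_ hxS hyS hL' harc hx50 hy50 hxy
        (hdeg2 _ hxS) (hdeg2 _ hyS) hxA
      intro P hP Q hQ hPQ
      obtain ⟨q, hq, p, hp, hqp⟩ := hadj Q hQ P hP (by rwa [mul_comm Q.card])
      exact ⟨p, hp, q, hq, hqp.symm⟩
  · obtain ⟨g⟩ := (SimpleGraph.cycleGraph_isContained_iff (G := G) (n := 2 * k + 1) (by omega)).2
      ⟨_, c.map f, hcyc, hlen.trans hL⟩
    exact hfree g.toHom g.injective
  · set U : Finset V := Finset.univ.filter (· ∈ (B'ᶜ : Set V)) with hU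
    have hmemU : ∀ w, w ∈ U ↔ w ∈ (B'ᶜ : Set V) := fun w => by simp [hU]
    have hSU : S ⊆ U := fun z hz => (hmemU z).2 (hmemS' z hz)
    have hcount := card_edgeFinset_le_of_sparse_set (G := G) (n := n) hSU
      (fun w hw => degIn_support_le_two hodd (by omega) hmin' ((hmemU w).1 hw))
      (fun a ha b hb d hd hab hbd hda => by
        have h1 := hmin' ⟨a, (hmemU a).1 ha⟩
          (.cons (show (G.induce B'ᶜ).Adj _ ⟨b, (hmemU b).1 hb⟩ from hab)
            (.cons (show (G.induce B'ᶜ).Adj _ ⟨d, (hmemU d).1 hd⟩ from hbd)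
              (.cons (show (G.induce B'ᶜ).Adj _ ⟨a, (hmemU a).1 ha⟩ from hda) .nil))) (by simp [Nat.odd_iff])
        simp only [SimpleGraph.Walk.length_cons, SimpleGraph.Walk.length_nil] at h1
        omega)
      (fun w hw => twelve_mul_le_of_lt_sqrt hk ht1 hn (hB' w (by simpa [hU] using hw)))
    have h1 := Finset.card_sdiff_add_card_eq_card hSU
    have h2 := Finset.card_compl_add_card U
    rw [Nat.odd_iff] at hodd
    have h4 := lt_of_long_cycle (L := S.card) hnt ht1 (by omega) (by omega) hcount
    omega
end

section
/- Let k ≥ 2, and let n, t be integers with 1 ≤ t ≤ 2k−2 and n ≥ t+3. Then the graph H(n,t) is C_{2k+1}-free, has exactly ⌊(n−t−1)²/4⌋ + (t+2 choose 2) edges, and satisfies d₂(H(n,t)) = t and γ₂(H(n,t)) = (⌊(t+2)/2⌋ choose 2) + (⌈(t+2)/2⌉ choose 2). -/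
/-- `Hgraph n t` is the graph `H(n,t)` on `n` vertices obtained from the Turán graph
`T₂(n-t-1)` and the complete graph `K_{t+2}` by identifying a vertex of each. -/
def Hgraph (n t : ℕ) : SimpleGraph (Fin n) :=
  SimpleGraph.fromRel (fun u v =>
    (u.val < (n - t - 1 + 1) / 2 ∧ (n - t - 1 + 1) / 2 ≤ v.val ∧ v.val < n - t - 1) ∨
    ((u.val = 0 ∨ n - t - 1 ≤ u.val) ∧ (v.val = 0 ∨ n - t - 1 ≤ v.val)))

open Finset in
theorem card_filter_fin_eq_card_filter_range (n : ℕ) (p : ℕ → Prop) [DecidablePred p] :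
    #{v : Fin n | p v.val} = #{x ∈ range n | p x} := by
  rw [← card_map Fin.valEmbedding]
  congr 1
  ext x
  simp only [mem_map, mem_filter, mem_univ, true_and, Fin.valEmbedding_apply, mem_range]
  constructor
  · rintro ⟨v, hv, rfl⟩
    exact ⟨v.isLt, hv⟩
  · rintro ⟨hx, hp⟩
    exact ⟨⟨x, hx⟩, hp, rfl⟩

theorem Hgraph_adj {m t : ℕ} {u v : Fin (m + t + 1)} :
    (Hgraph (m + t + 1) t).Adj u v ↔ u.val ≠ v.val ∧
      ((u.val < (m + 1) / 2 ∧ (m + 1) / 2 ≤ v.val ∧ v.val < m) ∨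
        (v.val < (m + 1) / 2 ∧ (m + 1) / 2 ≤ u.val ∧ u.val < m) ∨
        ((u.val = 0 ∨ m ≤ u.val) ∧ (v.val = 0 ∨ m ≤ v.val))) := by
  have h : m + t + 1 - t - 1 = m := by omega
  simp only [Hgraph, SimpleGraph.fromRel_adj, h, ne_eq, Fin.ext_iff]
  tauto

/-- The vertices of the copy of `K_{t+2}` in `H(m+t+1,t)`. -/
def Hclique (m t : ℕ) : Finset (Fin (m + t + 1)) := {v | v.val = 0 ∨ m ≤ v.val}

theorem mem_Hclique {m t : ℕ} {v : Fin (m + t + 1)} :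
    v ∈ Hclique m t ↔ v.val = 0 ∨ m ≤ v.val := by
  simp [Hclique]

theorem card_Hclique {m t : ℕ} (hm : 1 ≤ m) : (Hclique m t).card = t + 2 := by
  rw [Hclique, card_filter_fin_eq_card_filter_range _ (fun x => x = 0 ∨ m ≤ x)]
  have : (Finset.range (m + t + 1)).filter (fun x => x = 0 ∨ m ≤ x) =
      insert 0 (Finset.Ico m (m + t + 1)) := by
    ext x
    simp only [Finset.mem_filter, Finset.mem_range, Finset.mem_insert, Finset.mem_Ico]
    omega
  rw [this, Finset.card_insert_of_notMem (by simp; omega), Nat.card_Ico]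
  omega

theorem Hgraph_adj_of_mem_Hclique {m t : ℕ} {u v : Fin (m + t + 1)} (hu : u ∈ Hclique m t)
    (hv : v ∈ Hclique m t) (huv : u ≠ v) : (Hgraph (m + t + 1) t).Adj u v := by
  rw [mem_Hclique] at hu hv
  exact Hgraph_adj.2 ⟨fun h => huv (Fin.ext h), Or.inr (Or.inr ⟨hu, hv⟩)⟩

theorem not_forall_lt_of_odd_closed {m t k : ℕ} {g : ℕ → Fin (m + t + 1)}
    (hadj : ∀ i, (Hgraph (m + t + 1) t).Adj (g i) (g (i + 1)))
    (hlt : ∀ i, i ≤ 2 * k + 1 → (g i).val < m) (hper : g (2 * k + 1) = g 0) : False := by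
  have hstep : ∀ i, i + 1 ≤ 2 * k + 1 →
      ((g (i + 1)).val < (m + 1) / 2 ↔ ¬ (g i).val < (m + 1) / 2) := by
    intro i hi
    have h3 := Hgraph_adj.1 (hadj i)
    have h4 := hlt i (by omega)
    have h5 := hlt (i + 1) hi
    clear hadj hlt hper hi
    omega
  have halt : ∀ i, i ≤ 2 * k + 1 →
      ((g i).val < (m + 1) / 2 ↔ ((g 0).val < (m + 1) / 2 ↔ i % 2 = 0)) := by
    intro i
    induction i with
    | zero => simp
    | succ i ih =>
      intro hi
      have h7 : (i + 1) % 2 = 0 ↔ ¬ i % 2 = 0 := by omega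
      rw [hstep i hi, h7, ih (by omega)]
      tauto
  have := halt (2 * k + 1) le_rfl
  rw [hper] at this
  have h7 : ¬ (2 * k + 1) % 2 = 0 := by omega
  tauto

theorem Hgraph_cycleFree {m t k : ℕ} (hm : 2 ≤ m) (hk : 2 ≤ k) (ht : t + 2 ≤ 2 * k) :
    CycleFree (Hgraph (m + t + 1) t) (2 * k + 1) := by
  intro f hf
  obtain ⟨j, hj⟩ : ∃ j, ∀ i, i ≠ j → (f i).val ≠ 0 := by
    by_cases h : ∃ j, (f j).val = 0
    · obtain ⟨j, hj⟩ := h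
      exact ⟨j, fun i hij hi => hij (hf (Fin.ext (hi.trans hj.symm)))⟩
    · push Not at h
      exact ⟨0, fun i _ => h i⟩
  let g : ℕ → Fin (m + t + 1) := fun i => f (j + Fin.ofNat (2 * k + 1) i)
  have hinj : ∀ a b, a < 2 * k + 1 → b < 2 * k + 1 → g a = g b → a = b := by
    intro a b ha hb hab
    have h := add_left_cancel (hf hab)
    simpa [Fin.ofNat, Nat.mod_eq_of_lt ha, Nat.mod_eq_of_lt hb] using h
  have hper : g (2 * k + 1) = g 0 := by
    have : Fin.ofNat (2 * k + 1) (2 * k + 1) = Fin.ofNat (2 * k + 1) 0 := by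
      simp [Fin.ofNat]
    simp only [g, this]
  have hadj : ∀ i, (Hgraph (m + t + 1) t).Adj (g i) (g (i + 1)) := by
    intro i
    apply f.map_rel
    obtain ⟨l, rfl⟩ : ∃ l, k = l + 1 := ⟨k - 1, by omega⟩
    change (SimpleGraph.cycleGraph ((2 * l + 1) + 2)).Adj _ _
    rw [SimpleGraph.cycleGraph_adj]
    right
    rw [add_sub_add_left_eq_sub, sub_eq_iff_eq_add]
    simp [Fin.ext_iff, Fin.ofNat, Fin.val_add, add_comm]
  have hne : ∀ i, i < 2 * k → (g (i + 1)).val ≠ 0 := by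
    intro i hi
    apply hj
    intro h
    have h' : Fin.ofNat (2 * k + 1) (i + 1) = 0 := by simpa using h
    have := congrArg Fin.val h'
    simp [Fin.ofNat, Nat.mod_eq_of_lt (show i + 1 < 2 * k + 1 by omega)] at this
  by_cases h1 : (g 1).val < m
  · have hlt : ∀ i, i < 2 * k → (g (i + 1)).val < m := by
      intro i
      induction i with
      | zero => exact fun _ => h1
      | succ i ih =>
        intro hi
        have h2 := ih (by omega)
        have h3 := Hgraph_adj.1 (hadj (i + 1))
        have h4 := hne i (by omega)
        have h5 := hne (i + 1) hi
        omega
    have hlt' : ∀ i, i ≤ 2 * k + 1 → (g i).val < m := by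
      have h0 : (g 0).val < m := by
        have h3 := Hgraph_adj.1 (hadj 0)
        have h4 := hne 0 (by omega)
        simp only [zero_add] at h3 h4
        omega
      intro i hi
      rcases Nat.eq_zero_or_pos i with rfl | hpos
      · exact h0
      · rcases eq_or_lt_of_le hi with rfl | hi
        · rwa [hper]
        · obtain ⟨l, rfl⟩ : ∃ l, i = l + 1 := ⟨i - 1, by omega⟩
          exact hlt l (by omega)
    exact not_forall_lt_of_odd_closed hadj hlt' hper
  · have hge : ∀ i, i < 2 * k → m ≤ (g (i + 1)).val := by
      intro i
      induction i with
      | zero => exact fun _ => not_lt.1 h1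
      | succ i ih =>
        intro hi
        have h2 := ih (by omega)
        have h3 := Hgraph_adj.1 (hadj (i + 1))
        have h4 := hne i (by omega)
        have h5 := hne (i + 1) hi
        omega
    have hmem : ∀ i ∈ Finset.range (2 * k + 1), g i ∈ Hclique m t := by
      intro i hi
      rw [Finset.mem_range] at hi
      rw [mem_Hclique]
      rcases Nat.eq_zero_or_pos i with rfl | hpos
      · have h3 := Hgraph_adj.1 (hadj 0)
        have h4 := hge 0 (by omega)
        simp only [zero_add] at h3 h4
        omega
      · obtain ⟨l, rfl⟩ : ∃ l, i = l + 1 := ⟨i - 1, by omega⟩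
        exact Or.inr (hge l (by omega))
    have hcard := Finset.card_le_card_of_injOn g hmem (by
      intro a ha b hb hab
      exact hinj a b (by simpa using ha) (by simpa using hb) hab)
    rw [card_Hclique (by omega), Finset.card_range] at hcard
    omega

theorem mk_mem_image_offDiag {α : Type*} [DecidableEq α] {s : Finset α} {u v : α} :
    s(u, v) ∈ s.offDiag.image Sym2.mk.uncurry ↔ u ∈ s ∧ v ∈ s ∧ u ≠ v := by
  simp only [Finset.mem_image, Finset.mem_offDiag, Prod.exists, Function.uncurry_apply_pair,
    Sym2.eq_iff]
  constructor
  · rintro ⟨a, b, ⟨ha, hb, hab⟩, ⟨rfl, rfl⟩ | ⟨rfl, rfl⟩⟩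
    · exact ⟨ha, hb, hab⟩
    · exact ⟨hb, ha, hab.symm⟩
  · rintro ⟨hu, hv, huv⟩
    exact ⟨u, v, ⟨hu, hv, huv⟩, Or.inl ⟨rfl, rfl⟩⟩

theorem card_union_image_offDiag {α : Type*} [DecidableEq α] {s r : Finset α}
    (h : Disjoint s r) :
    (s.offDiag.image Sym2.mk.uncurry ∪ r.offDiag.image Sym2.mk.uncurry).card =
      s.card.choose 2 + r.card.choose 2 := by
  rw [Finset.card_union_of_disjoint, Sym2.card_image_offDiag, Sym2.card_image_offDiag]
  rw [Finset.disjoint_left]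
  intro e
  induction e with
  | _ u v =>
    rw [mk_mem_image_offDiag, mk_mem_image_offDiag]
    exact fun h1 h2 => Finset.disjoint_left.1 h h1.1 h2.1

theorem Hgraph_ncard_edgeSet {m t : ℕ} (hm : 2 ≤ m) :
    (Hgraph (m + t + 1) t).edgeSet.ncard = m ^ 2 / 4 + (t + 2).choose 2 := by
  classical
  let A : Finset (Fin (m + t + 1)) := {v | v.val < (m + 1) / 2}
  let B : Finset (Fin (m + t + 1)) := {v | (m + 1) / 2 ≤ v.val ∧ v.val < m}
  have hA : A.card = (m + 1) / 2 := by
    have : (Finset.range (m + t + 1)).filter (fun x => x < (m + 1) / 2) =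
        Finset.range ((m + 1) / 2) := by
      ext x
      simp only [Finset.mem_filter, Finset.mem_range]
      omega
    simp only [A]
    rw [card_filter_fin_eq_card_filter_range _ (fun x => x < (m + 1) / 2), this,
      Finset.card_range]
  have hB : B.card = m / 2 := by
    have : (Finset.range (m + t + 1)).filter (fun x => (m + 1) / 2 ≤ x ∧ x < m) =
        Finset.Ico ((m + 1) / 2) m := by
      ext x
      simp only [Finset.mem_filter, Finset.mem_range, Finset.mem_Ico]
      omega
    simp only [B]
    rw [card_filter_fin_eq_card_filter_range _ (fun x => (m + 1) / 2 ≤ x ∧ x < m), this,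
      Nat.card_Ico]
    omega
  have hmk : ∀ u v, s(u, v) ∈ (A ×ˢ B).image Sym2.mk.uncurry ↔
      (u ∈ A ∧ v ∈ B) ∨ (v ∈ A ∧ u ∈ B) := by
    intro u v
    simp only [Finset.mem_image, Finset.mem_product, Prod.exists, Function.uncurry_apply_pair,
      Sym2.eq_iff]
    constructor
    · rintro ⟨a, b, hab, ⟨rfl, rfl⟩ | ⟨rfl, rfl⟩⟩
      · exact Or.inl hab
      · exact Or.inr hab
    · rintro (h | h)
      · exact ⟨u, v, h, Or.inl ⟨rfl, rfl⟩⟩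
      · exact ⟨v, u, h, Or.inr ⟨rfl, rfl⟩⟩
  have hE : (Hgraph (m + t + 1) t).edgeSet =
      ↑((A ×ˢ B).image Sym2.mk.uncurry ∪ (Hclique m t).offDiag.image Sym2.mk.uncurry) := by
    ext e
    induction e with
    | _ u v =>
      rw [SimpleGraph.mem_edgeSet, Hgraph_adj, Finset.mem_coe, Finset.mem_union, hmk,
        mk_mem_image_offDiag, mem_Hclique, mem_Hclique]
      simp only [A, B, Finset.mem_filter, Finset.mem_univ, true_and, ne_eq, Fin.ext_iff]
      omega
  have hdisj : Disjoint ((A ×ˢ B).image Sym2.mk.uncurry)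
      ((Hclique m t).offDiag.image Sym2.mk.uncurry) := by
    rw [Finset.disjoint_left]
    intro e
    induction e with
    | _ u v =>
      rw [hmk, mk_mem_image_offDiag, mem_Hclique, mem_Hclique]
      simp only [A, B, Finset.mem_filter, Finset.mem_univ, true_and]
      omega
  have hinj : Set.InjOn (Sym2.mk.uncurry : Fin (m + t + 1) × Fin (m + t + 1) → _)
      ↑(A ×ˢ B) := by
    rintro ⟨a, b⟩ hab ⟨c, d⟩ hcd h
    simp only [A, B, Finset.coe_product, Set.mem_prod, Finset.mem_coe, Finset.mem_filter,
      Finset.mem_univ, true_and] at hab hcd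
    simp only [Function.uncurry_apply_pair, Sym2.eq_iff] at h
    rcases h with ⟨rfl, rfl⟩ | ⟨rfl, rfl⟩
    · rfl
    · omega
  rw [hE, Set.ncard_coe_finset, Finset.card_union_of_disjoint hdisj,
    Finset.card_image_of_injOn hinj, Finset.card_product, hA, hB, Sym2.card_image_offDiag,
    card_Hclique (by omega)]
  congr 1
  obtain ⟨c, rfl | rfl⟩ := Nat.even_or_odd' m
  · rw [show (2 * c + 1) / 2 = c by omega, show 2 * c / 2 = c by omega,
      show (2 * c) ^ 2 = 4 * (c * c) by ring]
    omega
  · rw [show (2 * c + 1 + 1) / 2 = c + 1 by omega, show (2 * c + 1) / 2 = c by omega,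
      show (2 * c + 1) ^ 2 = 4 * ((c + 1) * c) + 1 by ring]
    omega

theorem exists_card_eq_colorable_induce_Hgraph {m : ℕ} (t : ℕ) (hm : 2 ≤ m) :
    ∃ T : Finset (Fin (m + t + 1)), T.card = t ∧
      ((Hgraph (m + t + 1) t).induce ((↑T : Set (Fin (m + t + 1)))ᶜ)).Colorable 2 := by
  refine ⟨Finset.univ.filter (fun v => m + 1 ≤ v.val), ?_, ?_⟩
  · rw [card_filter_fin_eq_card_filter_range _ (fun x => m + 1 ≤ x)]
    have : (Finset.range (m + t + 1)).filter (fun x => m + 1 ≤ x) =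
        Finset.Ico (m + 1) (m + t + 1) := by
      ext x
      simp only [Finset.mem_filter, Finset.mem_range, Finset.mem_Ico]
      omega
    rw [this, Nat.card_Ico]
    omega
  · refine (SimpleGraph.Coloring.mk (α := Bool)
      (fun v => decide (v.val.val < (m + 1) / 2)) ?_).colorable
    intro u v h
    have hu := u.2
    have hv := v.2
    rw [SimpleGraph.induce_adj, Hgraph_adj] at h
    simp only [Finset.coe_filter, Finset.mem_univ, true_and, Set.mem_compl_iff,
      Set.mem_ofPred_eq] at hu hv
    simp only [ne_eq, decide_eq_decide]
    omega

theorem le_card_of_colorable_induce_Hgraph {m t : ℕ} (hm : 1 ≤ m)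
    (T : Finset (Fin (m + t + 1)))
    (hT : ((Hgraph (m + t + 1) t).induce ((↑T : Set (Fin (m + t + 1)))ᶜ)).Colorable 2) :
    t ≤ T.card := by
  obtain ⟨C⟩ := hT
  by_contra! hlt
  have hcard : 2 < (Hclique m t \ T).card := by
    have := Finset.le_card_sdiff T (Hclique m t)
    rw [card_Hclique hm] at this
    omega
  let c : Fin (m + t + 1) → Fin 2 := fun v => if h : v ∈ T then 0 else C ⟨v, by simpa using h⟩
  obtain ⟨u, hu, v, hv, huv, hc⟩ := Finset.exists_ne_map_eq_of_card_lt_of_maps_to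
    (t := (Finset.univ : Finset (Fin 2))) (f := c) (by simpa using hcard) (by simp)
  rw [Finset.mem_sdiff] at hu hv
  simp only [c, dif_neg hu.2, dif_neg hv.2] at hc
  refine C.valid ?_ hc
  rw [SimpleGraph.induce_adj]
  exact Hgraph_adj_of_mem_Hclique hu.1 hv.1 huv

theorem exists_card_eq_colorable_deleteEdges_Hgraph {m : ℕ} (t : ℕ) (hm : 2 ≤ m) :
    ∃ E' : Finset (Sym2 (Fin (m + t + 1))),
      (↑E' : Set (Sym2 (Fin (m + t + 1)))) ⊆ (Hgraph (m + t + 1) t).edgeSet ∧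
      E'.card = ((t + 2) / 2).choose 2 + ((t + 3) / 2).choose 2 ∧
      ((Hgraph (m + t + 1) t).deleteEdges ↑E').Colorable 2 := by
  classical
  let A : Finset (Fin (m + t + 1)) := {v | v.val = 0 ∨ m ≤ v.val ∧ v.val + 1 < m + (t + 2) / 2}
  let B : Finset (Fin (m + t + 1)) := {v | m + (t + 2) / 2 ≤ v.val + 1}
  have hA : A.card = (t + 2) / 2 := by
    have : (Finset.range (m + t + 1)).filter (fun x => x = 0 ∨ m ≤ x ∧ x + 1 < m + (t + 2) / 2) =
        insert 0 (Finset.Ico m (m + (t + 2) / 2 - 1)) := by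
      ext x
      simp only [Finset.mem_filter, Finset.mem_range, Finset.mem_insert, Finset.mem_Ico]
      omega
    simp only [A]
    rw [card_filter_fin_eq_card_filter_range _ (fun x => x = 0 ∨ m ≤ x ∧ x + 1 < m + (t + 2) / 2), this,
      Finset.card_insert_of_notMem (by simp; omega), Nat.card_Ico]
    omega
  have hB : B.card = (t + 3) / 2 := by
    have : (Finset.range (m + t + 1)).filter (fun x => m + (t + 2) / 2 ≤ x + 1) =
        Finset.Ico (m + (t + 2) / 2 - 1) (m + t + 1) := by
      ext x
      simp only [Finset.mem_filter, Finset.mem_range, Finset.mem_Ico]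
      omega
    simp only [B]
    rw [card_filter_fin_eq_card_filter_range _ (fun x => m + (t + 2) / 2 ≤ x + 1), this, Nat.card_Ico]
    omega
  have hdisj : Disjoint A B := by
    rw [Finset.disjoint_left]
    intro v
    simp only [A, B, Finset.mem_filter, Finset.mem_univ, true_and]
    omega
  refine ⟨A.offDiag.image Sym2.mk.uncurry ∪ B.offDiag.image Sym2.mk.uncurry, ?_, ?_, ?_⟩
  · intro e
    induction e with
    | _ u v =>
      rw [SimpleGraph.mem_edgeSet, Hgraph_adj, Finset.mem_coe, Finset.mem_union,
        mk_mem_image_offDiag, mk_mem_image_offDiag]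
      simp only [A, B, Finset.mem_filter, Finset.mem_univ, true_and, ne_eq, Fin.ext_iff]
      omega
  · rw [card_union_image_offDiag hdisj, hA, hB]
  · refine (SimpleGraph.Coloring.mk (α := Bool) (fun v => decide (v.val < (m + 1) / 2 ∨
      m ≤ v.val ∧ v.val + 1 < m + (t + 2) / 2)) ?_).colorable
    intro u v h
    rw [SimpleGraph.deleteEdges_adj, Hgraph_adj, Finset.mem_coe, Finset.mem_union,
        mk_mem_image_offDiag, mk_mem_image_offDiag] at h
    simp only [A, B, Finset.mem_filter, Finset.mem_univ, true_and, ne_eq,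
      Fin.ext_iff] at h
    simp only [ne_eq, decide_eq_decide]
    omega

theorem choose_two_half_add_le (x y : ℕ) :
    ((x + y) / 2).choose 2 + ((x + y + 1) / 2).choose 2 ≤ x.choose 2 + y.choose 2 := by
  have key : ∀ a : ℕ, ((a.choose 2 : ℕ) : ℤ) * 2 = a * (a - 1) := by
    intro a
    induction a with
    | zero => simp
    | succ a ih =>
      rw [Nat.choose_succ_succ' a 1]
      push_cast [Nat.choose_one_right]
      linarith
  have hx := key x
  have hy := key y
  have hp := key ((x + y) / 2)
  have hq := key ((x + y + 1) / 2)
  zify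
  generalize hP : (x + y) / 2 = P at *
  generalize hQ : (x + y + 1) / 2 = Q at *
  have hsum : (x : ℤ) + y = P + Q := by omega
  rcases (by omega : Q = P ∨ Q = P + 1) with rfl | rfl
  · nlinarith [sq_nonneg ((x : ℤ) - y)]
  · push_cast at *
    have : 0 ≤ ((x : ℤ) - P) * (x - P - 1) := by
      rcases le_or_gt (x : ℤ) P with h | h <;> nlinarith
    have hy' : (y : ℤ) = 2 * P + 1 - x := by linarith
    rw [hy'] at hy
    nlinarith

theorem le_card_of_colorable_deleteEdges_Hgraph {m t : ℕ} (hm : 1 ≤ m)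
    (E' : Finset (Sym2 (Fin (m + t + 1))))
    (hE' : ((Hgraph (m + t + 1) t).deleteEdges ↑E').Colorable 2) :
    ((t + 2) / 2).choose 2 + ((t + 3) / 2).choose 2 ≤ E'.card := by
  classical
  obtain ⟨C⟩ := hE'
  let A : Finset (Fin (m + t + 1)) := (Hclique m t).filter (fun v => C v = 0)
  let B : Finset (Fin (m + t + 1)) := (Hclique m t).filter (fun v => ¬ C v = 0)
  have hdisj : Disjoint A B := Finset.disjoint_filter_filter_not _ _ _
  have hsum : A.card + B.card = t + 2 := by
    rw [← card_Hclique (t := t) hm]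
    exact Finset.card_filter_add_card_filter_not _
  have hmono : ∀ u ∈ Hclique m t, ∀ v ∈ Hclique m t, u ≠ v → C u = C v → s(u, v) ∈ E' := by
    intro u hu v hv huv hc
    by_contra hmem
    exact C.valid (SimpleGraph.deleteEdges_adj.2
      ⟨Hgraph_adj_of_mem_Hclique hu hv huv, hmem⟩) hc
  have hle := choose_two_half_add_le A.card B.card
  rw [hsum, ← card_union_image_offDiag hdisj] at hle
  refine hle.trans (Finset.card_le_card ?_)
  intro e
  induction e with
  | _ u v =>
    rw [Finset.mem_union, mk_mem_image_offDiag, mk_mem_image_offDiag]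
    simp only [A, B, Finset.mem_filter]
    rintro (⟨⟨hu, hcu⟩, ⟨hv, hcv⟩, huv⟩ | ⟨⟨hu, hcu⟩, ⟨hv, hcv⟩, huv⟩)
    · exact hmono u hu v hv huv (hcu.trans hcv.symm)
    · exact hmono u hu v hv huv (by omega)

/-- Properties of the extremal graph: for `k ≥ 2`, `1 ≤ t ≤ 2k-2` and `n ≥ t+3`, the graph
`H(n,t)` is `C_{2k+1}`-free, has `⌊(n-t-1)²/4⌋ + C(t+2,2)` edges, `d₂(H(n,t)) = t`
(the minimum size of a vertex set whose removal leaves a bipartite graph is `t`) and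
`γ₂(H(n,t)) = C(⌊(t+2)/2⌋,2) + C(⌈(t+2)/2⌉,2)` (the minimum number of edges whose deletion
leaves a bipartite graph is that value). -/
theorem stmt16 (k n t : ℕ) (hk : 2 ≤ k) (ht1 : 1 ≤ t) (ht2 : t ≤ 2 * k - 2)
    (hn : t + 3 ≤ n) :
    CycleFree (Hgraph n t) (2 * k + 1) ∧
    (Hgraph n t).edgeSet.ncard = (n - t - 1) ^ 2 / 4 + (t + 2).choose 2 ∧
    ((∃ T : Finset (Fin n), T.card = t ∧
        ((Hgraph n t).induce ((↑T : Set (Fin n))ᶜ)).Colorable 2) ∧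
      (∀ T : Finset (Fin n), ((Hgraph n t).induce ((↑T : Set (Fin n))ᶜ)).Colorable 2 →
        t ≤ T.card)) ∧
    ((∃ E' : Finset (Sym2 (Fin n)), (↑E' : Set (Sym2 (Fin n))) ⊆ (Hgraph n t).edgeSet ∧
        E'.card = ((t + 2) / 2).choose 2 + ((t + 3) / 2).choose 2 ∧
        ((Hgraph n t).deleteEdges ↑E').Colorable 2) ∧
      (∀ E' : Finset (Sym2 (Fin n)), (↑E' : Set (Sym2 (Fin n))) ⊆ (Hgraph n t).edgeSet →
        ((Hgraph n t).deleteEdges ↑E').Colorable 2 →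
        ((t + 2) / 2).choose 2 + ((t + 3) / 2).choose 2 ≤ E'.card)) := by
  obtain ⟨m, rfl⟩ : ∃ m, n = m + t + 1 := ⟨n - t - 1, by omega⟩
  have hm : 2 ≤ m := by omega
  refine ⟨Hgraph_cycleFree hm hk (by omega), ?_,
    ⟨exists_card_eq_colorable_induce_Hgraph t hm,
      fun T hT => le_card_of_colorable_induce_Hgraph (by omega) T hT⟩,
    ⟨exists_card_eq_colorable_deleteEdges_Hgraph t hm,
      fun E' _ hE' => le_card_of_colorable_deleteEdges_Hgraph (by omega) E' hE'⟩⟩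
  rw [Hgraph_ncard_edgeSet hm, show m + t + 1 - t - 1 = m by omega]
end

section
/- Let G be a triangle-free graph on n vertices that is not bipartite. Then e(G) ≤ (n−1)²/4 + 1. -/
open Finset in
/-- Mantel's theorem for the subgraph induced on a finset, counting ordered adjacent pairs. -/
theorem two_mul_sum_card_neighbors_le_sq {V : Type*} (G : SimpleGraph V) [DecidableRel G.Adj]
    (hG : G.CliqueFree 3) (T : Finset V) :
    2 * ∑ v ∈ T, #{u ∈ T | G.Adj v u} ≤ #T ^ 2 := by
  classical
  let H := G.induce (T : Set V)
  have hH : H.CliqueFree (2 + 1) := hG.comap ⟨(SimpleGraph.Embedding.induce _).toCopy⟩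
  have hmantel : #H.edgeFinset ≤ _ := hH.card_edgeFinset_le
  have hdeg (v : (T : Set V)) : H.degree v = #{u ∈ T | G.Adj v u} := by
    rw [← SimpleGraph.card_neighborFinset_eq_degree, ← card_map (Function.Embedding.subtype _)]
    congr 1
    ext u
    simp [H, and_comm]
  have hsum : ∑ v ∈ T, #{u ∈ T | G.Adj v u} = 2 * #H.edgeFinset := by
    rw [← H.sum_degrees_eq_twice_card_edges, ← Finset.sum_coe_sort]
    exact sum_congr rfl fun v _ => (hdeg v).symm
  have hcard : Fintype.card (T : Set V) = #T := by simp
  rw [hcard] at hmantel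
  rw [hsum]
  obtain h | h := Nat.mod_two_eq_zero_or_one #T
  · simp only [h] at hmantel
    norm_num at hmantel
    omega
  · have hpos : 1 ≤ #T ^ 2 := Nat.one_le_pow _ _ (by omega)
    simp only [h] at hmantel
    norm_num at hmantel
    omega

open Finset in
/-- If every vertex has at most two neighbours in `S`, only few edges meet `S`. -/
theorem four_mul_card_edgeFinset_le_of_card_neighbors_le_two {V : Type*} [Fintype V]
    [DecidableEq V] (G : SimpleGraph V) [DecidableRel G.Adj] (hG : G.CliqueFree 3) (S : Finset V)
    (hS : ∀ v, #{u ∈ S | G.Adj v u} ≤ 2) :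
    4 * #G.edgeFinset ≤ #Sᶜ ^ 2 + 8 * #Sᶜ + 4 * #S := by
  have hdeg (v : V) : G.degree v = #{u ∈ S | G.Adj v u} + #{u ∈ Sᶜ | G.Adj v u} := by
    rw [← G.card_neighborFinset_eq_degree, G.neighborFinset_eq_filter, ← union_compl S,
      filter_union, card_union_of_disjoint (disjoint_filter_filter disjoint_compl_right)]
  have hcross : ∑ v ∈ S, #{u ∈ Sᶜ | G.Adj v u} = ∑ v ∈ Sᶜ, #{u ∈ S | G.Adj v u} := by
    simpa only [bipartiteAbove, bipartiteBelow, G.adj_comm] using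
      sum_card_bipartiteAbove_eq_sum_card_bipartiteBelow (s := S) (t := Sᶜ) G.Adj
  have hmantel := two_mul_sum_card_neighbors_le_sq G hG Sᶜ
  have hin := sum_le_card_nsmul S _ 2 fun v _ => hS v
  have hout := sum_le_card_nsmul Sᶜ _ 2 fun v _ => hS v
  have hsum := G.sum_degrees_eq_twice_card_edges
  simp only [← sum_add_sum_compl S, hdeg, sum_add_distrib, smul_eq_mul] at hsum hin hout
  omega

namespace SimpleGraph.Walk

variable {V : Type*} {G : SimpleGraph V} {u : V}

theorem exists_walk_getVert_getVert (p : G.Walk u u) {i j : ℕ} (hij : i ≤ j) (hj : j ≤ p.length) :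
    ∃ q : G.Walk (p.getVert i) (p.getVert j), q.length = j - i :=
  ⟨((p.take j).drop i).copy (by simp [take_getVert, hij]) rfl, by simp [drop_length, take_length, hj]⟩

theorem exists_walk_getVert_getVert_around (p : G.Walk u u) {i j : ℕ} (hij : i ≤ j)
    (hj : j ≤ p.length) :
    ∃ q : G.Walk (p.getVert j) (p.getVert i), q.length = p.length - (j - i) :=
  ⟨(p.drop j).append (p.take i), by simp [drop_length, take_length]; omega⟩

theorem getVert_injOn_of_shortest_odd {p : G.Walk u u} (hodd : Odd p.length)
    (hmin : ∀ v (q : G.Walk v v), Odd q.length → p.length ≤ q.length) :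
    Set.InjOn p.getVert (Set.Iio p.length) := by
  intro i hi j hj h
  by_contra hne
  wlog hij : i < j generalizing i j
  · exact this hj hi h.symm (Ne.symm hne) (by omega)
  simp only [Set.mem_Iio] at hi hj
  obtain ⟨q, hq⟩ := p.exists_walk_getVert_getVert hij.le hj.le
  obtain ⟨r, hr⟩ := p.exists_walk_getVert_getVert_around hij.le hj.le
  have h1 := hmin _ (q.copy h rfl)
  have h2 := hmin _ (r.copy rfl h)
  simp only [length_copy, hq, hr, Nat.odd_iff] at h1 h2 hodd
  omega

/-- Two neighbours of a vertex on a shortest odd closed walk are at cyclic distance two. -/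
theorem index_diff_of_adj_of_shortest_odd {p : G.Walk u u} (hodd : Odd p.length)
    (hmin : ∀ v (q : G.Walk v v), Odd q.length → p.length ≤ q.length) {v : V} {i j : ℕ}
    (hij : i < j) (hj : j < p.length) (hvi : G.Adj v (p.getVert i))
    (hvj : G.Adj v (p.getVert j)) : j = i + 2 ∨ j + 2 = i + p.length := by
  obtain ⟨q, hq⟩ := p.exists_walk_getVert_getVert hij.le hj.le
  obtain ⟨r, hr⟩ := p.exists_walk_getVert_getVert_around hij.le hj.le
  have h1 := hmin _ (cons hvi (q.concat hvj.symm))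
  have h2 := hmin _ (cons hvj (r.concat hvi.symm))
  simp only [length_cons, length_concat, hq, hr, Nat.odd_iff] at h1 h2 hodd
  omega

open Finset in
theorem card_neighbors_le_two_of_shortest_odd [DecidableEq V] [DecidableRel G.Adj]
    {p : G.Walk u u} (hodd : Odd p.length)
    (hmin : ∀ v (q : G.Walk v v), Odd q.length → p.length ≤ q.length) (hlen : 5 ≤ p.length)
    (v : V) : #{w ∈ (range p.length).image p.getVert | G.Adj v w} ≤ 2 := by
  by_contra! h
  obtain ⟨a, b, c, ha, hb, hc, hab, hac, hbc⟩ := two_lt_card_iff.mp h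
  simp only [mem_filter, mem_image, mem_range] at ha hb hc
  obtain ⟨⟨i, hi, rfl⟩, hvi⟩ := ha
  obtain ⟨⟨j, hj, rfl⟩, hvj⟩ := hb
  obtain ⟨⟨k, hk, rfl⟩, hvk⟩ := hc
  have key {x y : ℕ} (hx : x < p.length) (hy : y < p.length) (hvx : G.Adj v (p.getVert x))
      (hvy : G.Adj v (p.getVert y)) (hne : p.getVert x ≠ p.getVert y) :
      y = x + 2 ∨ y + 2 = x + p.length ∨ x = y + 2 ∨ x + 2 = y + p.length := by
    rcases lt_trichotomy x y with hxy | rfl | hxy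
    · have := index_diff_of_adj_of_shortest_odd hodd hmin hxy hy hvx hvy
      omega
    · exact absurd rfl hne
    · have := index_diff_of_adj_of_shortest_odd hodd hmin hxy hx hvy hvx
      omega
  have h1 := key hi hj hvi hvj hab
  have h2 := key hi hk hvi hvk hac
  have h3 := key hj hk hvj hvk hbc
  rw [Nat.odd_iff] at hodd
  omega

theorem five_le_length_of_odd (hG : G.CliqueFree 3) (p : G.Walk u u) (hodd : Odd p.length) :
    5 ≤ p.length := by
  classical
  have hadj {i : ℕ} (hi : i < p.length) := p.adj_getVert_succ hi
  by_contra! hlt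
  rw [Nat.odd_iff] at hodd
  obtain h | h : p.length = 1 ∨ p.length = 3 := by omega
  · have h0 := hadj (i := 0) (by omega)
    rw [zero_add, ← h, getVert_length, getVert_zero] at h0
    exact G.irrefl h0
  · have h0 := hadj (i := 0) (by omega)
    have h1 := hadj (i := 1) (by omega)
    have h2 := hadj (i := 2) (by omega)
    have h3 : p.getVert (2 + 1) = p.getVert 0 := by
      rw [show 2 + 1 = p.length by omega, getVert_length, getVert_zero]
    rw [h3] at h2
    exact hG _ (is3Clique_triple_iff.mpr ⟨h0, h2.symm, h1⟩)

end SimpleGraph.Walk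

theorem SimpleGraph.exists_shortest_odd_closed_walk {V : Type*} {G : SimpleGraph V}
    (hG : ¬ G.Colorable 2) :
    ∃ (u : V) (p : G.Walk u u), Odd p.length ∧
      ∀ v (q : G.Walk v v), Odd q.length → p.length ≤ q.length := by
  classical
  have hex : ∃ L, ∃ (u : V) (p : G.Walk u u), p.length = L ∧ Odd L := by
    simp only [two_colorable_iff_forall_loop_even, not_forall, Nat.not_even_iff_odd] at hG
    obtain ⟨u, p, hp⟩ := hG
    exact ⟨_, u, p, rfl, hp⟩
  obtain ⟨u, p, hp, hodd⟩ := Nat.find_spec hex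
  exact ⟨u, p, hp ▸ hodd, fun v q hq => hp.trans_le (Nat.find_min' hex ⟨v, q, rfl, hq⟩)⟩

theorem CycleFree.cliqueFree_three {V : Type*} {G : SimpleGraph V} (h : CycleFree G 3) :
    G.CliqueFree 3 := by
  refine SimpleGraph.cliqueFree_iff.mpr ⟨fun f => ?_⟩
  exact h (f.toHom.comp (SimpleGraph.Hom.ofLE le_top)) f.injective

/-- Theorem (Häggkvist–Faudree–Schelp): if `G` is a triangle-free graph on `n` vertices that is
not bipartite, then `e(G) ≤ (n-1)²/4 + 1`. -/
theorem stmt17 {V : Type*} [Fintype V] (G : SimpleGraph V) [DecidableRel G.Adj]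
    (n : ℕ) (hcard : Fintype.card V = n)
    (hfree : CycleFree G 3)
    (hnonbip : ¬ G.Colorable 2) :
    (G.edgeFinset.card : ℝ) ≤ ((n : ℝ) - 1) ^ 2 / 4 + 1 := by
  classical
  have hG := hfree.cliqueFree_three
  obtain ⟨u, p, hodd, hmin⟩ := SimpleGraph.exists_shortest_odd_closed_walk hnonbip
  have hlen := p.five_le_length_of_odd hG hodd
  set S := (Finset.range p.length).image p.getVert with hSdef
  have hS : S.card = p.length := by
    rw [hSdef, Finset.card_image_of_injOn, Finset.card_range]
    simpa using SimpleGraph.Walk.getVert_injOn_of_shortest_odd hodd hmin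
  have hedges := four_mul_card_edgeFinset_le_of_card_neighbors_le_two G hG S
    (SimpleGraph.Walk.card_neighbors_le_two_of_shortest_odd hodd hmin hlen)
  have hn : S.card + Sᶜ.card = n := by rw [Finset.card_add_card_compl, hcard]
  have h5 : (5 : ℝ) ≤ S.card := by exact_mod_cast hS ▸ hlen
  have hnonneg : (0 : ℝ) ≤ Sᶜ.card := Nat.cast_nonneg _
  have hedges' : (4 * G.edgeFinset.card : ℝ) ≤ Sᶜ.card ^ 2 + 8 * Sᶜ.card + 4 * S.card := by
    exact_mod_cast hedges
  rw [← hn]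
  push_cast
  nlinarith [mul_nonneg hnonneg (sub_nonneg.mpr h5)]
end
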